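/- Let G be a graph, let k ≥ 2 and m, m0 ≥ 0 be integers with m+m0 > 0, and let f: V(G) → Z_k be a mapping compatible with G. If G is (2m+2m0+6k−5)-tree-connected, then G has an m-tree-connected f-factor H such that the complement of H in G is m0-tree-connected and for each vertex v, ⌊d_G(v)/2⌋ − (k−1) − m0 ≤ d_H(v) ≤ ⌈d_G(v)/2⌉ + (k−1) + m. -/

import Mathlib

open Finset

variable {V E : Type*}

/-- Degree of vertex `v` in the multigraph whose edge set is `S`
(the ambient multigraph is given by the endpoint map `ends`); a loop counts twice. -/
def mdeg [DecidableEq V] (ends : E → V × V) (S : Finset E) (v : V) : ℕ :=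
  ∑ e ∈ S, ((if (ends e).1 = v then 1 else 0) + (if (ends e).2 = v then 1 else 0))

/-- The multigraph with edge set `S` is connected: all vertices are mutually reachable. -/
def MConnected (ends : E → V × V) (S : Finset E) : Prop :=
  ∀ u v : V, Relation.ReflTransGen
    (fun a b => ∃ e ∈ S, ends e = (a, b) ∨ ends e = (b, a)) u v

/-- `T` is (the edge set of) a spanning tree: connected and with `|V| - 1` edges. -/
def IsSpanningTree [Fintype V] (ends : E → V × V) (T : Finset E) : Prop :=
  MConnected ends T ∧ T.card + 1 = Fintype.card V

/-- `S` is `m`-tree-connected: it contains `m` pairwise edge-disjoint spanning trees. -/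
def TreeConnected [Fintype V] (ends : E → V × V) (m : ℕ) (S : Finset E) : Prop :=
  ∃ T : Fin m → Finset E, (∀ i, T i ⊆ S ∧ IsSpanningTree ends (T i)) ∧
    ∀ i j, i ≠ j → Disjoint (T i) (T j)

/-- The edges of `S` crossing the cut `(A, Aᶜ)`. -/
def cutEdges [DecidableEq V] (ends : E → V × V) (S : Finset E) (A : Finset V) : Finset E :=
  S.filter fun e => ¬(((ends e).1 ∈ A) ↔ ((ends e).2 ∈ A))

/-- `S` is `m`-edge-connected: every edge cut has at least `m` edges. -/
def EdgeConnected [Fintype V] [DecidableEq V] (ends : E → V × V) (m : ℕ) (S : Finset E) : Prop :=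
  ∀ A : Finset V, A.Nonempty → A ≠ Finset.univ → m ≤ (cutEdges ends S A).card

/-- Tail of the edge `e` under the orientation `σ`. -/
def otail (ends : E → V × V) (σ : E → Bool) (e : E) : V :=
  if σ e then (ends e).1 else (ends e).2

/-- Head of the edge `e` under the orientation `σ`. -/
def ohead (ends : E → V × V) (σ : E → Bool) (e : E) : V :=
  if σ e then (ends e).2 else (ends e).1

/-- Out-degree of `v` in the edge set `S` under the orientation `σ`. -/
def outDeg [DecidableEq V] (ends : E → V × V) (σ : E → Bool) (S : Finset E) (v : V) : ℕ :=
  (S.filter fun e => otail ends σ e = v).card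

/-- In-degree of `v` in the edge set `S` under the orientation `σ`. -/
def inDeg [DecidableEq V] (ends : E → V × V) (σ : E → Bool) (S : Finset E) (v : V) : ℕ :=
  (S.filter fun e => ohead ends σ e = v).card

/-- Out-degree in a directed graph, where `ends` itself records the orientation
(first component = tail, second component = head). -/
def outDegD [DecidableEq V] (ends : E → V × V) (S : Finset E) (v : V) : ℕ :=
  (S.filter fun e => (ends e).1 = v).card

/-- In-degree in a directed graph. -/
def inDegD [DecidableEq V] (ends : E → V × V) (S : Finset E) (v : V) : ℕ :=
  (S.filter fun e => (ends e).2 = v).card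

/-- `S` is `(m, l)`-partition-connected: it decomposes into an `m`-tree-connected factor
and a factor admitting an orientation in which every vertex `v` has out-degree at least `l v`. -/
def PartitionConnected [Fintype V] [DecidableEq V] [DecidableEq E]
    (ends : E → V × V) (m : ℕ) (l : V → ℤ) (S : Finset E) : Prop :=
  ∃ S₁ ⊆ S, TreeConnected ends m S₁ ∧
    ∃ σ : E → Bool, ∀ v, l v ≤ (outDeg ends σ (S \ S₁) v : ℤ)

/-- Number of edges of `S` with both ends in `A`. -/
def eIn [DecidableEq V] (ends : E → V × V) (S : Finset E) (A : Finset V) : ℕ :=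
  (S.filter fun e => (ends e).1 ∈ A ∧ (ends e).2 ∈ A).card

/-- Number of edges of `S` with one end in `A` and the other end in `B`. -/
def eBetween [DecidableEq V] (ends : E → V × V) (S : Finset E) (A B : Finset V) : ℕ :=
  (S.filter fun e =>
    ((ends e).1 ∈ A ∧ (ends e).2 ∈ B) ∨ ((ends e).1 ∈ B ∧ (ends e).2 ∈ A)).card

/-- Every edge of `S` crosses the bipartition `(X, Xᶜ)`. -/
def BipartiteWrt [DecidableEq V] (ends : E → V × V) (S : Finset E) (X : Finset V) : Prop :=
  ∀ e ∈ S, ¬(((ends e).1 ∈ X) ↔ ((ends e).2 ∈ X))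

/-- The multigraph with edge set `S` is bipartite. -/
def IsBipartiteG [DecidableEq V] (ends : E → V × V) (S : Finset E) : Prop :=
  ∃ X : Finset V, BipartiteWrt ends S X

/-- Bipartite index: the smallest number of edges whose deletion from `S`
leaves a bipartite factor. -/
noncomputable def biIndex [DecidableEq V] [DecidableEq E]
    (ends : E → V × V) (S : Finset E) : ℕ :=
  sInf {n | ∃ H ⊆ S, IsBipartiteG ends H ∧ n = (S \ H).card}

/-- `f : V → ZMod k` is compatible with the multigraph `S` with respect to the
bipartition `(X, Xᶜ)`. -/
def CompatibleWrt [Fintype V] [DecidableEq V] (ends : E → V × V) (S : Finset E)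
    {k : ℕ} (f : V → ZMod k) (X : Finset V) : Prop :=
  (∃ x : ℕ, x ≤ eIn ends S X ∧
    (∑ v ∈ X, f v) - 2 * (x : ZMod k) = ∑ v ∈ Xᶜ, f v) ∨
  (∃ y : ℕ, y ≤ eIn ends S Xᶜ ∧
    (∑ v ∈ X, f v) = (∑ v ∈ Xᶜ, f v) - 2 * (y : ZMod k))

/-- `f : V → ZMod k` is compatible with `S`: compatible with respect to every bipartition. -/
def Compatible [Fintype V] [DecidableEq V] (ends : E → V × V) (S : Finset E)
    {k : ℕ} (f : V → ZMod k) : Prop :=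
  ∀ X : Finset V, CompatibleWrt ends S f X

namespace LT
universe u
variable {V : Type u} [DecidableEq V]


def cut (w : V → V → ℤ) (S A : Finset V) : ℤ := ∑ u ∈ A, ∑ v ∈ S \ A, w u v

def Dg (w : V → V → ℤ) (a b : V → ℤ) (S A : Finset V) : ℤ :=
  cut w S A + ∑ v ∈ A, (a v + b v)

structure LG (k : ℤ) (S : Finset V) (ex : Option V) (w : V → V → ℤ) (a b β : V → ℤ) : Prop where
  sym : ∀ u v, w u v = w v u
  w0 : ∀ u v, 0 ≤ w u v
  diag : ∀ v, w v v = 0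
  ha : ∀ v, 0 ≤ a v
  hb : ∀ v, 0 ≤ b v
  par : ∀ v ∈ S, (2:ℤ) ∣ (∑ u ∈ S, w v u) + a v + b v - β v
  sum : 2 * k ∣ (∑ v ∈ S, β v) - ∑ v ∈ S, (b v - a v)
  ii : ∀ j : ℤ, ∑ v ∈ S, (a v + b v) ≤ 2 * k - 2 + |(∑ v ∈ S, β v) + 2 * k * j|
  iii : ∀ A ⊆ S, A.Nonempty → A ≠ S → (∀ v0, ex = some v0 → A ≠ {v0}) →
    ∃ j : ℤ, 2 * k - 2 + |(∑ v ∈ A, β v) + 2 * k * j| ≤ Dg w a b S A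
  exc : ∀ v0, ex = some v0 → v0 ∈ S ∧ 2 * k ∣ β v0

def Val (S : Finset V) (x w : V → V → ℤ) : Prop :=
  (∀ u v, x u v = - x v u) ∧ ∀ u ∈ S, ∀ v ∈ S, |x u v| ≤ w u v ∧ (2:ℤ) ∣ x u v - w u v

def net (S : Finset V) (x : V → V → ℤ) (a b : V → ℤ) (v : V) : ℤ :=
  (∑ u ∈ S, x v u) + b v - a v

def Sol (k : ℤ) (S : Finset V) (w : V → V → ℤ) (a b β : V → ℤ) : Prop :=
  ∃ x, Val S x w ∧ ∀ v ∈ S, 2 * k ∣ net S x a b v - β v ∧ |net S x a b v| < 2 * k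

/-- symmetric unit -/
def eu (p q : V) (u v : V) : ℤ :=
  (if u = p ∧ v = q then 1 else 0) + (if u = q ∧ v = p then 1 else 0)
/-- antisymmetric unit -/
def fu (p q : V) (u v : V) : ℤ :=
  (if u = p ∧ v = q then 1 else 0) - (if u = q ∧ v = p then 1 else 0)

lemma eu_symm (p q u v : V) : eu p q u v = eu p q v u := by
  unfold eu; rw [add_comm]; congr 1 <;> simp [and_comm]
lemma fu_anti (p q u v : V) : fu p q u v = - fu p q v u := by
  unfold fu; rw [neg_sub]; congr 1 <;> simp [and_comm]
lemma eu_nonneg (p q u v : V) : 0 ≤ eu p q u v := by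
  unfold eu; split_ifs <;> norm_num
lemma eu_diag {p q : V} (h : p ≠ q) (v : V) : eu p q v v = 0 := by
  unfold eu
  rw [if_neg, if_neg] <;> grind
lemma fu_abs (p q u v : V) : |fu p q u v| ≤ eu p q u v := by
  unfold fu eu; split_ifs <;> norm_num
lemma fu_par (p q u v : V) : (2:ℤ) ∣ fu p q u v - eu p q u v := by
  unfold fu eu; split_ifs <;> norm_num

lemma sum_fu {S : Finset V} {p q : V} (hp : p ∈ S) (hq : q ∈ S) (u : V) :
    ∑ v ∈ S, fu p q u v = (if u = p then 1 else 0) - (if u = q then 1 else 0) := by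
  unfold fu
  rw [Finset.sum_sub_distrib]
  congr 1
  · by_cases h : u = p <;> simp [h, hq]
  · by_cases h : u = q <;> simp [h, hp]

lemma sum_eu {S : Finset V} {p q : V} (hp : p ∈ S) (hq : q ∈ S) (u : V) :
    ∑ v ∈ S, eu p q u v = (if u = p then 1 else 0) + (if u = q then 1 else 0) := by
  unfold eu
  rw [Finset.sum_add_distrib]
  congr 1
  · by_cases h : u = p <;> simp [h, hq]
  · by_cases h : u = q <;> simp [h, hp]

lemma cut_eu {S A : Finset V} {p q : V} (hp : p ∈ S) (hq : q ∈ S) (hA : A ⊆ S) :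
    cut (eu p q) S A = (if p ∈ A ∧ q ∉ A then 1 else 0) + (if q ∈ A ∧ p ∉ A then 1 else 0) := by
  unfold cut eu
  simp only [Finset.sum_add_distrib]
  have key : ∀ p q : V, q ∈ S → ∑ u ∈ A, ∑ v ∈ S \ A, (if u = p ∧ v = q then (1:ℤ) else 0)
      = (if p ∈ A ∧ q ∉ A then 1 else 0) := by
    intro p q hq
    have : ∀ u ∈ A, ∑ v ∈ S \ A, (if u = p ∧ v = q then (1:ℤ) else 0)
        = if u = p then (if q ∉ A then 1 else 0) else 0 := by
      intro u hu
      by_cases h : u = p <;> simp [h, hq]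
    rw [Finset.sum_congr rfl this]
    by_cases h : p ∈ A <;> simp [h]
  rw [key p q hq, key q p hp]

lemma cut_add (w w' : V → V → ℤ) (S A : Finset V) :
    cut (fun u v => w u v + w' u v) S A = cut w S A + cut w' S A := by
  unfold cut; simp [Finset.sum_add_distrib]
lemma cut_sub (w w' : V → V → ℤ) (S A : Finset V) :
    cut (fun u v => w u v - w' u v) S A = cut w S A - cut w' S A := by
  unfold cut; simp [Finset.sum_sub_distrib]

lemma val_add {S : Finset V} {x w : V → V → ℤ} (h : Val S x w) (p q : V) (ε : ℤ)
    (hε : ε = 1 ∨ ε = -1) :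
    Val S (fun u v => x u v + ε * fu p q u v) (fun u v => w u v + eu p q u v) := by
  refine ⟨fun u v => ?_, fun u hu v hv => ⟨?_, ?_⟩⟩
  · simp only; rw [h.1 u v, fu_anti p q u v]; ring
  · have h1 := (h.2 u hu v hv).1
    have h2 := fu_abs p q u v
    have h3 : |ε * fu p q u v| = |fu p q u v| := by
      rcases hε with rfl | rfl <;> simp
    calc _ ≤ |x u v| + |ε * fu p q u v| := abs_add_le _ _
      _ ≤ _ := by rw [h3]; linarith
  · have h1 := (h.2 u hu v hv).2
    have h2 := fu_par p q u v
    rcases hε with rfl | rfl <;> simp only <;> omega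

lemma val_sub {S : Finset V} {x w : V → V → ℤ} {p q : V} (hpq : p ≠ q) (hp : p ∈ S) (hq : q ∈ S)
    (w0 : ∀ u v, 0 ≤ w u v) (hs : ∀ u v, w u v = w v u)
    (h : Val S x (fun u v => w u v + eu p q u v)) :
    ∃ ε : ℤ, (ε = 1 ∨ ε = -1) ∧ Val S (fun u v => x u v - ε * fu p q u v) w := by
  have h1 := h.2 p hp q hq
  have e1 : eu p q p q = 1 := by simp [eu, hpq]
  simp only [e1] at h1
  refine ⟨if 0 ≤ x p q then 1 else -1, by split_ifs <;> simp, fun u v => ?_, fun u hu v hv => ?_⟩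
  · simp only; rw [h.1 u v, fu_anti p q u v]; ring
  · have h2 := h.2 u hu v hv
    have h3 := w0 p q
    have h4 := w0 u v
    have h5 := h.1 p q
    have h6 := hs p q
    simp only at h2 ⊢
    rw [abs_le] at h1 h2 ⊢
    by_cases c1 : u = p ∧ v = q
    · obtain ⟨rfl, rfl⟩ := c1
      have : fu u v u v = 1 := by simp [fu, hpq]
      rw [this]
      split_ifs <;> omega
    · by_cases c2 : u = q ∧ v = p
      · obtain ⟨rfl, rfl⟩ := c2
        have : fu v u u v = -1 := by simp [fu, hpq, Ne.symm hpq]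
        rw [this]
        split_ifs <;> omega
      · have t1 : fu p q u v = 0 := by simp [fu, c1, c2]
        have t2 : eu p q u v = 0 := by simp [eu, c1, c2]
        rw [t2] at h2
        rw [t1]
        simpa using h2

def dl (p v : V) : ℤ := if v = p then 1 else 0

lemma sum_dl (p : V) (A : Finset V) : ∑ v ∈ A, dl p v = if p ∈ A then 1 else 0 := by
  unfold dl; simp

lemma dl_nonneg (p v : V) : 0 ≤ dl p v := by unfold dl; split_ifs <;> norm_num

lemma dl_pos {p : V} {a : V → ℤ} (ha : ∀ v, 0 ≤ a v) (hp : 0 < a p) (v : V) : 0 ≤ a v - dl p v := by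
  unfold dl
  have := ha v
  split_ifs with h
  · subst h; linarith
  · linarith

lemma eu_pos {p q : V} (hpq : p ≠ q) {w : V → V → ℤ} (hs : ∀ u v, w u v = w v u)
    (hw : ∀ u v, 0 ≤ w u v) (hp : 0 < w p q) (u v : V) : 0 ≤ w u v - eu p q u v := by
  unfold eu
  have := hw u v
  by_cases h : u = p ∧ v = q
  · obtain ⟨rfl, rfl⟩ := h
    simp [hpq]; omega
  · by_cases h2 : u = q ∧ v = p
    · obtain ⟨rfl, rfl⟩ := h2
      rw [hs] at hp
      simp [hpq, Ne.symm hpq]; omega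
    · simp [h, h2, this]

def Big (k : ℤ) (S : Finset V) (w : V → V → ℤ) (a b β : V → ℤ) : Prop :=
  ∀ A ⊆ S, 2 ≤ A.card → A ≠ S → ∃ j : ℤ, 2 * k + |(∑ v ∈ A, β v) + 2 * k * j| ≤ Dg w a b S A

lemma Dg_single (w : V → V → ℤ) (diag : ∀ v, w v v = 0) (a b : V → ℤ) {S : Finset V} {v : V}
    (hv : v ∈ S) : Dg w a b S {v} = (∑ u ∈ S, w v u) + a v + b v := by
  unfold Dg cut
  simp only [Finset.sum_singleton]
  rw [← Finset.add_sum_erase S _ hv, diag, Finset.sdiff_singleton_eq_erase]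
  ring

lemma mkLG {k : ℤ} {S : Finset V} {ex' : Option V}
    {w w' : V → V → ℤ} {a b β a' b' β' : V → ℤ}
    (big : Big k S w a b β)
    (sym : ∀ u v, w' u v = w' v u) (w0 : ∀ u v, 0 ≤ w' u v) (diag : ∀ v, w' v v = 0)
    (ha : ∀ v, 0 ≤ a' v) (hb : ∀ v, 0 ≤ b' v)
    (par : ∀ v ∈ S, (2:ℤ) ∣ (∑ u ∈ S, w' v u) + a' v + b' v - β' v)
    (sum : 2 * k ∣ (∑ v ∈ S, β' v) - ∑ v ∈ S, (b' v - a' v))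
    (ii : ∀ j : ℤ, ∑ v ∈ S, (a' v + b' v) ≤ 2 * k - 2 + |(∑ v ∈ S, β' v) + 2 * k * j|)
    (chg : ∀ A ⊆ S, 2 ≤ A.card → A ≠ S →
      |(∑ v ∈ A, β' v) - ∑ v ∈ A, β v| ≤ Dg w' a' b' S A - Dg w a b S A + 2)
    (sing : ∀ v ∈ S, ex' ≠ some v → ∃ j : ℤ, 2 * k - 2 + |β' v + 2 * k * j| ≤
      (∑ u ∈ S, w' v u) + a' v + b' v)
    (exc : ∀ v0, ex' = some v0 → v0 ∈ S ∧ 2 * k ∣ β' v0) :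
    LG k S ex' w' a' b' β' := by
  refine ⟨sym, w0, diag, ha, hb, par, sum, ii, ?_, exc⟩
  intro A hA hne hAS hex
  by_cases hc : 2 ≤ A.card
  · obtain ⟨j, hj⟩ := big A hA hc hAS
    refine ⟨j, ?_⟩
    have h1 := chg A hA hc hAS
    have h2 : |(∑ v ∈ A, β' v) + 2 * k * j| ≤ |(∑ v ∈ A, β' v) - ∑ v ∈ A, β v| +
        |(∑ v ∈ A, β v) + 2 * k * j| := by
      have := abs_add_le ((∑ v ∈ A, β' v) - ∑ v ∈ A, β v) ((∑ v ∈ A, β v) + 2 * k * j)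
      rwa [show ((∑ v ∈ A, β' v) - ∑ v ∈ A, β v) + ((∑ v ∈ A, β v) + 2 * k * j)
        = (∑ v ∈ A, β' v) + 2 * k * j by ring] at this
    linarith
  · have h1 : A.card = 1 := by
      have := hne.card_pos; omega
    obtain ⟨v, rfl⟩ := Finset.card_eq_one.1 h1
    have hv : v ∈ S := hA (by simp)
    obtain ⟨j, hj⟩ := sing v hv (fun h => hex v h rfl)
    refine ⟨j, ?_⟩
    rw [Dg_single w' diag a' b' hv]
    simpa using hj

def mu (k : ℤ) (S : Finset V) (ex : Option V) (w : V → V → ℤ) (a b : V → ℤ) : ℤ :=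
  (2 * k * (∑ u ∈ S, ∑ v ∈ S, w u v) + ∑ v ∈ S, (a v + b v)) * 2 + (if ex = none then 1 else 0)

lemma sing_of {k : ℤ} {S : Finset V} {ex : Option V}
    {w : V → V → ℤ} {a b β : V → ℤ} (h : LG k S ex w a b β) (h2 : 2 ≤ S.card) {v : V} (hv : v ∈ S)
    (hex : ex ≠ some v) : ∃ j : ℤ, 2 * k - 2 + |β v + 2 * k * j| ≤ (∑ u ∈ S, w v u) + a v + b v := by
  obtain ⟨j, hj⟩ := h.iii {v} (by simpa using hv) (by simp) (by
    intro h; rw [← h] at h2; simp at h2) (by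
    intro v0 h0 h1; simp at h1; subst h1; exact hex h0)
  rw [Dg_single w h.diag a b hv] at hj
  exact ⟨j, by simpa using hj⟩

/-- the reduced residue is minimal -/
lemma abs_min {k t s j : ℤ} (hk : 0 < k) (h1 : -k ≤ t) (h2 : t ≤ k) (h : 2 * k ∣ s - t) :
    |t| ≤ |s + 2 * k * j| := by
  obtain ⟨c, hc⟩ := h
  have hs : s + 2 * k * j = t + 2 * k * (c + j) := by linarith
  rw [hs]
  generalize c + j = d
  rcases lt_trichotomy d 0 with hd | hd | hd
  · have : 2 * k * d ≤ 2 * k * (-1) := by apply mul_le_mul_of_nonneg_left <;> omega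
    rw [abs_le]; constructor <;> cases abs_cases (t + 2 * k * d) <;> linarith
  · subst hd; simp
  · have : 2 * k * 1 ≤ 2 * k * d := by apply mul_le_mul_of_nonneg_left <;> omega
    rw [abs_le]; constructor <;> cases abs_cases (t + 2 * k * d) <;> linarith

/-- values of net in a residue class -/
lemma net_vals {k t n : ℤ} (hk : 0 < k) (h1 : 0 < t) (h2 : t < 2 * k) (h : 2 * k ∣ n - t)
    (hn : |n| < 2 * k) : n = t ∨ n = t - 2 * k := by
  obtain ⟨c, hc⟩ := h
  rw [abs_lt] at hn
  have hs : n = t + 2 * k * c := by linarith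
  rcases lt_trichotomy c 0 with hd | hd | hd
  · rcases eq_or_lt_of_le (show c ≤ -1 by omega) with h | h
    · subst h; right; linarith
    · have : 2 * k * c ≤ 2 * k * (-2) := by apply mul_le_mul_of_nonneg_left <;> omega
      linarith
  · subst hd; left; linarith
  · have : 2 * k * 1 ≤ 2 * k * c := by apply mul_le_mul_of_nonneg_left <;> omega
    linarith

/-- Step (a): edge from plus to minus -/
lemma step_a {k : ℤ} (hk : 2 ≤ k) {S : Finset V}
    {w : V → V → ℤ} {a b β : V → ℤ} (h : LG k S none w a b β) (hc : 2 ≤ S.card)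
    (big : Big k S w a b β)
    (IH : ∀ ex' w' a' b' β', LG k S ex' w' a' b' β' → mu k S ex' w' a' b' < mu k S none w a b →
      Sol k S w' a' b' β')
    {p q : V} (hp : p ∈ S) (hq : q ∈ S) (hpq : p ≠ q) (hw : 0 < w p q)
    {s t : ℤ} (hs : 1 ≤ s) (hs' : s ≤ k) (hsβ : 2 * k ∣ β p - s)
    (ht : 1 ≤ t) (ht' : t ≤ k) (htβ : 2 * k ∣ β q + t) : Sol k S w a b β := by
  have hcut : ∀ A ⊆ S, Dg (fun u v => w u v - eu p q u v) a b S A = Dg w a b S A -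
      ((if p ∈ A ∧ q ∉ A then 1 else 0) + (if q ∈ A ∧ p ∉ A then 1 else 0)) := by
    intro A hA
    unfold Dg
    rw [cut_sub, cut_eu hp hq hA]; ring
  have L : LG k S none (fun u v => w u v - eu p q u v) a b (fun v => β v - dl p v + dl q v) := by
    refine mkLG big ?_ (eu_pos hpq h.sym h.w0 hw) ?_ h.ha h.hb ?_ ?_ ?_ ?_ ?_ ?_
    · intro u v; rw [h.sym, eu_symm]
    · intro v; rw [h.diag, eu_diag hpq]; rfl
    · intro v hv
      have := h.par v hv
      rw [Finset.sum_sub_distrib, sum_eu hp hq]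
      unfold dl
      split_ifs <;> omega
    · have := h.sum
      simp only [Finset.sum_add_distrib, Finset.sum_sub_distrib, sum_dl, hp, hq, if_true] at this ⊢
      convert this using 1; ring
    · intro j
      have := h.ii j
      simp only [Finset.sum_add_distrib, Finset.sum_sub_distrib, sum_dl, hp, hq, if_true] at this ⊢
      convert this using 4; ring
    · intro A hA _ _
      rw [hcut A hA]
      simp only [Finset.sum_add_distrib, Finset.sum_sub_distrib, sum_dl]
      by_cases h1 : p ∈ A <;> by_cases h2 : q ∈ A <;> simp [h1, h2] <;> norm_num
    · intro v hv _
      obtain ⟨j, hj⟩ := sing_of h hc hv (by simp)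
      rw [Finset.sum_sub_distrib, sum_eu hp hq]
      unfold dl
      by_cases h1 : v = p
      · subst h1
        obtain ⟨c, hc⟩ := hsβ
        have := abs_min (j := j) (by omega) (by omega) hs' ⟨c, hc⟩
        refine ⟨-c, ?_⟩
        rw [abs_of_pos (by omega)] at this
        simp only [hpq, if_true, if_false]
        rw [show β v - 1 + 0 + 2 * k * -c = s - 1 by linarith, abs_of_nonneg (by omega)]
        omega
      · by_cases h2 : v = q
        · subst h2
          obtain ⟨c, hc⟩ := htβ
          have := abs_min (k := k) (t := -t) (s := β v) (j := j) (by omega) (by omega) (by omega) ⟨c, by linarith⟩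
          refine ⟨-c, ?_⟩
          rw [abs_of_neg (by omega)] at this
          simp only [h1, if_true, if_false]
          rw [show β v - 0 + 1 + 2 * k * -c = -(t - 1) by linarith, abs_neg, abs_of_nonneg (by omega)]
          omega
        · refine ⟨j, ?_⟩
          simpa [h1, h2] using hj
    · intro v0 h0; simp at h0
  obtain ⟨x, hx, hn⟩ := IH none _ _ _ _ L (by
    unfold mu
    simp only [Finset.sum_sub_distrib, sum_eu hp hq]
    simp only [Finset.sum_add_distrib]
    simp [hp, hq]
    nlinarith)
  have hx' := val_add hx p q 1 (by simp)
  refine ⟨fun u v => x u v + 1 * fu p q u v, ?_, ?_⟩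
  · convert hx' using 3; ring
  · intro v hv
    obtain ⟨h1, h2⟩ := hn v hv
    have e : net S (fun u v => x u v + 1 * fu p q u v) a b v = net S x a b v + dl p v - dl q v := by
      unfold net dl
      simp only [Finset.sum_add_distrib, one_mul, sum_fu hp hq]; ring
    rw [e]
    simp only at h1
    refine ⟨by obtain ⟨c, hc⟩ := h1; exact ⟨c, by linarith⟩, ?_⟩
    unfold dl at h1 ⊢
    by_cases h3 : v = p
    · subst h3
      simp only [hpq, if_true, if_false] at h1 ⊢
      have h4 : 2 * k ∣ net S x a b v - (s - 1) := by
        obtain ⟨c, hc⟩ := h1; obtain ⟨c', hc'⟩ := hsβ; exact ⟨c + c', by linarith⟩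
      by_cases h5 : s = 1
      · subst h5
        have : net S x a b v = 0 := by
          apply Int.eq_zero_of_abs_lt_dvd (by simpa using h4) h2
        rw [this]; norm_num; linarith
      · rcases net_vals (by omega) (by omega) (by omega) h4 h2 with h | h <;> rw [h, abs_lt] <;> constructor <;> linarith
    · by_cases h6 : v = q
      · subst h6
        simp only [h3, if_true, if_false] at h1 ⊢
        have h4 : 2 * k ∣ net S x a b v - (1 - t) := by
          obtain ⟨c, hc⟩ := h1; obtain ⟨c', hc'⟩ := htβ; exact ⟨c + c', by linarith⟩
        by_cases h5 : t = 1
        · subst h5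
          have : net S x a b v = 0 := by
            apply Int.eq_zero_of_abs_lt_dvd (by simpa using h4) h2
          rw [this]; norm_num; linarith
        · have h4' : 2 * k ∣ net S x a b v - (1 - t + 2 * k) := by
            obtain ⟨c, hc⟩ := h4; exact ⟨c - 1, by linarith⟩
          rcases net_vals (by omega) (by omega) (by omega) h4' h2 with h | h <;> rw [h, abs_lt] <;> constructor <;> linarith
      · simpa [h3, h6] using h2


lemma Dg_swap (w : V → V → ℤ) (a b : V → ℤ) (S A : Finset V) : Dg w b a S A = Dg w a b S A := by
  unfold Dg; congr 1; exact Finset.sum_congr rfl (fun v _ => add_comm _ _)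

lemma abs_flip (k s j : ℤ) : |-s + 2 * k * (-j)| = |s + 2 * k * j| := by
  rw [← abs_neg]; congr 1; ring

lemma neg_LG {k : ℤ} {S : Finset V} {ex : Option V}
    {w : V → V → ℤ} {a b β : V → ℤ} (h : LG k S ex w a b β) :
    LG k S ex w b a (fun v => - β v) := by
  have hs : ∀ A : Finset V, ∑ v ∈ A, - β v = - ∑ v ∈ A, β v := fun A => by simp
  refine ⟨h.sym, h.w0, h.diag, h.hb, h.ha, ?_, ?_, ?_, ?_, ?_⟩
  · intro v hv
    have := h.par v hv
    omega
  · obtain ⟨c, hc⟩ := h.sum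
    simp only [Finset.sum_sub_distrib] at hc
    refine ⟨-c, ?_⟩
    simp only [hs, Finset.sum_sub_distrib]; linarith
  · intro j
    have := h.ii (-j)
    rw [hs, ← abs_flip, neg_neg]
    rw [show ∑ v ∈ S, (b v + a v) = ∑ v ∈ S, (a v + b v) from
      Finset.sum_congr rfl (fun v _ => add_comm _ _)]
    simpa using this
  · intro A hA h1 h2 h3
    obtain ⟨j, hj⟩ := h.iii A hA h1 h2 h3
    exact ⟨-j, by rw [hs, abs_flip, Dg_swap]; exact hj⟩
  · intro v0 h0
    exact ⟨(h.exc v0 h0).1, (dvd_neg).2 (h.exc v0 h0).2⟩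

lemma neg_Big {k : ℤ} {S : Finset V}
    {w : V → V → ℤ} {a b β : V → ℤ} (h : Big k S w a b β) :
    Big k S w b a (fun v => - β v) := by
  have hs : ∀ A : Finset V, ∑ v ∈ A, - β v = - ∑ v ∈ A, β v := fun A => by simp
  intro A hA h1 h2
  obtain ⟨j, hj⟩ := h A hA h1 h2
  exact ⟨-j, by rw [hs, abs_flip, Dg_swap]; exact hj⟩

lemma neg_Sol {k : ℤ} {S : Finset V}
    {w : V → V → ℤ} {a b β : V → ℤ} (h : Sol k S w b a (fun v => - β v)) : Sol k S w a b β := by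
  obtain ⟨x, hx, hn⟩ := h
  refine ⟨fun u v => - x u v, ⟨fun u v => by simp only; rw [hx.1 u v], fun u hu v hv => ?_⟩, ?_⟩
  · have := hx.2 u hu v hv
    refine ⟨by simpa using this.1, ?_⟩
    show (2:ℤ) ∣ - x u v - w u v
    omega
  · intro v hv
    obtain ⟨⟨c, hc⟩, h2⟩ := hn v hv
    have e : net S (fun u v => - x u v) a b v = - net S x b a v := by
      unfold net; simp; ring
    rw [e, abs_neg]
    exact ⟨⟨-c, by linarith⟩, h2⟩

lemma neg_mu (k : ℤ) (S : Finset V) (ex : Option V)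
    (w : V → V → ℤ) (a b : V → ℤ) : mu k S ex w b a = mu k S ex w a b := by
  unfold mu
  rw [show ∑ v ∈ S, (b v + a v) = ∑ v ∈ S, (a v + b v) from
      Finset.sum_congr rfl (fun v _ => add_comm _ _)]

/-- Step (b) -/
lemma step_b {k : ℤ} (hk : 2 ≤ k) {S : Finset V}
    {w : V → V → ℤ} {a b β : V → ℤ} (h : LG k S none w a b β) (hc : 2 ≤ S.card)
    (big : Big k S w a b β)
    (IH : ∀ ex' w' a' b' β', LG k S ex' w' a' b' β' → mu k S ex' w' a' b' < mu k S none w a b →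
      Sol k S w' a' b' β')
    {p : V} (hp : p ∈ S) (hw : 0 < b p)
    {s : ℤ} (hs : 1 ≤ s) (hs' : s ≤ k) (hsβ : 2 * k ∣ β p - s) : Sol k S w a b β := by
  have hcut : ∀ A : Finset V, Dg w a (fun v => b v - dl p v) S A = Dg w a b S A -
      (if p ∈ A then 1 else 0) := by
    intro A
    unfold Dg
    simp only [Finset.sum_add_distrib, Finset.sum_sub_distrib, sum_dl]; ring
  have L : LG k S none w a (fun v => b v - dl p v) (fun v => β v - dl p v) := by
    refine mkLG big h.sym h.w0 h.diag h.ha (dl_pos h.hb hw) ?_ ?_ ?_ ?_ ?_ ?_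
    · intro v hv
      have := h.par v hv
      omega
    · obtain ⟨c, hc⟩ := h.sum
      refine ⟨c, ?_⟩
      simp only [Finset.sum_sub_distrib] at hc ⊢
      linarith
    · intro j
      have := h.ii j
      simp only [Finset.sum_add_distrib, Finset.sum_sub_distrib, sum_dl, hp, if_true] at this ⊢
      cases abs_cases (∑ v ∈ S, β v + 2 * k * j) <;>
      cases abs_cases (∑ v ∈ S, β v - 1 + 2 * k * j) <;> linarith
    · intro A hA _ _
      rw [hcut A]
      simp only [Finset.sum_sub_distrib, sum_dl]
      by_cases h1 : p ∈ A <;> simp [h1]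
    · intro v hv _
      obtain ⟨j, hj⟩ := sing_of h hc hv (by simp)
      unfold dl
      by_cases h1 : v = p
      · subst h1
        obtain ⟨c, hc⟩ := hsβ
        have := abs_min (j := j) (by omega) (by omega) hs' ⟨c, hc⟩
        refine ⟨-c, ?_⟩
        rw [abs_of_pos (by omega)] at this
        simp only [if_true]
        rw [show β v - 1 + 2 * k * -c = s - 1 by linarith, abs_of_nonneg (by omega)]
        omega
      · refine ⟨j, ?_⟩
        simpa [h1] using hj
    · intro v0 h0; simp at h0
  obtain ⟨x, hx, hn⟩ := IH none _ _ _ _ L (by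
    unfold mu
    simp only [Finset.sum_sub_distrib, Finset.sum_add_distrib, sum_dl, hp, if_true]
    linarith)
  refine ⟨x, hx, ?_⟩
  · intro v hv
    obtain ⟨h1, h2⟩ := hn v hv
    have e : net S x a b v = net S x a (fun v => b v - dl p v) v + dl p v := by
      unfold net
      ring
    rw [e]
    simp only at h1
    refine ⟨by obtain ⟨c, hc⟩ := h1; exact ⟨c, by linarith⟩, ?_⟩
    generalize net S x a (fun v => b v - dl p v) v = n at h1 h2 ⊢
    unfold dl at h1 ⊢
    by_cases h3 : v = p
    · subst h3
      simp only [if_true] at h1 ⊢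
      have h4 : 2 * k ∣ n - (s - 1) := by
        obtain ⟨c, hc⟩ := h1; obtain ⟨c', hc'⟩ := hsβ; exact ⟨c + c', by linarith⟩
      by_cases h5 : s = 1
      · subst h5
        have : n = 0 := by
          apply Int.eq_zero_of_abs_lt_dvd (by simpa using h4) h2
        rw [this]; norm_num; linarith
      · rcases net_vals (by omega) (by omega) (by omega) h4 h2 with h | h <;> rw [h, abs_lt] <;> constructor <;> linarith
    · simpa [h3] using h2

/-- zero cuts are impossible -/
lemma step_c {k : ℤ} (hk : 2 ≤ k) {S : Finset V}
    {w : V → V → ℤ} {a b β : V → ℤ} (h : LG k S none w a b β) {A : Finset V} (hA : A ⊆ S)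
    (hne : A.Nonempty) (hne' : (S \ A).Nonempty) (h0 : ∀ u ∈ A, ∀ v ∈ S \ A, w u v = 0) : False := by
  have hAS : A ≠ S := by rintro rfl; simp at hne'
  have hSA : S \ A ≠ S := by
    intro h; rw [Finset.sdiff_eq_self_iff_disjoint] at h
    obtain ⟨v, hv⟩ := hne
    exact (Finset.disjoint_left.1 h (hA hv)) hv
  obtain ⟨j, hj⟩ := h.iii A hA hne hAS (by simp)
  obtain ⟨i, hi⟩ := h.iii (S \ A) Finset.sdiff_subset hne' hSA (by simp)
  have c1 : cut w S A = 0 := Finset.sum_eq_zero (fun u hu => Finset.sum_eq_zero (fun v hv => h0 u hu v hv))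
  have c2 : cut w S (S \ A) = 0 := Finset.sum_eq_zero (fun u hu => Finset.sum_eq_zero (fun v hv => by
    rw [h.sym]; apply h0 v _ u hu; simpa [hA] using hv))
  unfold Dg at hj hi
  rw [c1] at hj; rw [c2] at hi
  have := h.ii (j + i)
  have s1 := Finset.sum_sdiff (f := β) hA
  have s2 := Finset.sum_sdiff (f := fun v => a v + b v) hA
  rw [← s1, ← s2] at this
  have t := abs_add_le (∑ v ∈ A, β v + 2 * k * j) (∑ v ∈ S \ A, β v + 2 * k * i)
  rw [show ∑ v ∈ A, β v + 2 * k * j + (∑ v ∈ S \ A, β v + 2 * k * i) = ∑ x ∈ S \ A, β x + ∑ x ∈ A, β x + 2 * k * (j + i) by ring] at t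
  linarith

/-- Step (d) -/
lemma step_d {k : ℤ} (hk : 2 ≤ k) {S : Finset V}
    {w : V → V → ℤ} {a b β : V → ℤ} (h : LG k S none w a b β) (hc : 2 ≤ S.card)
    (big : Big k S w a b β)
    (IH : ∀ ex' w' a' b' β', LG k S ex' w' a' b' β' → mu k S ex' w' a' b' < mu k S none w a b →
      Sol k S w' a' b' β')
    {p q : V} (hp : p ∈ S) (hq : q ∈ S) (hpq : p ≠ q) (hw : 0 < w p q)
    (hb0 : ∀ v ∈ S, b v = 0)
    {s t : ℤ} (hs : 1 ≤ s) (hs' : s ≤ k - 1) (hsβ : 2 * k ∣ β p - s)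
    (ht : 1 ≤ t) (ht' : t ≤ k) (htβ : 2 * k ∣ β q - t) : Sol k S w a b β := by
  have hcut : ∀ A ⊆ S, Dg (fun u v => w u v - eu p q u v) a (fun v => b v + (k - s) * dl p v) S A
      = Dg w a b S A - ((if p ∈ A ∧ q ∉ A then 1 else 0) + (if q ∈ A ∧ p ∉ A then 1 else 0))
      + (if p ∈ A then k - s else 0) := by
    intro A hA
    unfold Dg
    rw [cut_sub, cut_eu hp hq hA]
    simp only [Finset.sum_add_distrib, ← Finset.mul_sum, sum_dl, mul_ite, mul_one, mul_zero]
    ring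
  have hB : ∑ v ∈ S, b v = 0 := Finset.sum_eq_zero hb0
  have L : LG k S none (fun u v => w u v - eu p q u v) a (fun v => b v + (k - s) * dl p v)
      (fun v => β v + (k - s + 1) * dl p v - dl q v) := by
    refine mkLG big ?_ (eu_pos hpq h.sym h.w0 hw) ?_ h.ha ?_ ?_ ?_ ?_ ?_ ?_ ?_
    · intro u v; rw [h.sym, eu_symm]
    · intro v; rw [h.diag, eu_diag hpq]; rfl
    · intro v
      have := h.hb v
      have := mul_nonneg (show 0 ≤ k - s by omega) (dl_nonneg p v)
      linarith
    · intro v hv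
      have := h.par v hv
      rw [Finset.sum_sub_distrib, sum_eu hp hq]
      unfold dl
      split_ifs <;> omega
    · obtain ⟨c, hc⟩ := h.sum
      refine ⟨c, ?_⟩
      simp only [Finset.sum_add_distrib, ← Finset.mul_sum, Finset.sum_sub_distrib, sum_dl, hp, hq, if_true] at hc ⊢
      linarith
    · intro j
      have h1 := h.ii
      obtain ⟨c, hc⟩ := h.sum
      simp only [Finset.sum_add_distrib, ← Finset.mul_sum, Finset.sum_sub_distrib, sum_dl, hp, hq, if_true, hB] at h1 hc ⊢
      have ho : 0 ≤ ∑ v ∈ S, a v := Finset.sum_nonneg (fun v _ => h.ha v)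
      set o := ∑ v ∈ S, a v with ho_def
      have hβ : ∑ v ∈ S, β v = - o + 2 * k * c := by linarith
      have h2 := h1 (1 - c)
      rw [hβ, show -o + 2 * k * c + 2 * k * (1 - c) = 2 * k - o by ring] at h2
      have h3 : o ≤ 2 * k - 1 := by
        cases abs_cases (2 * k - o) <;> linarith
      rw [hβ, show -o + 2 * k * c + (k - s + 1) * 1 - 1 + 2 * k * j = k - s - o + 2 * k * (c + j) by ring]
      generalize c + j = d
      rcases lt_trichotomy d 0 with hd | hd | hd
      · have : 2 * k * d ≤ 2 * k * (-1) := by apply mul_le_mul_of_nonneg_left <;> omega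
        cases abs_cases (k - s - o + 2 * k * d) <;> linarith
      · subst hd
        cases abs_cases (k - s - o + 2 * k * 0) <;> linarith
      · have : 2 * k * 1 ≤ 2 * k * d := by apply mul_le_mul_of_nonneg_left <;> omega
        cases abs_cases (k - s - o + 2 * k * d) <;> linarith
    · intro A hA _ _
      rw [hcut A hA]
      simp only [Finset.sum_add_distrib, ← Finset.mul_sum, Finset.sum_sub_distrib, sum_dl]
      by_cases h1 : p ∈ A <;> by_cases h2 : q ∈ A <;> simp [h1, h2] <;> rw [abs_le] <;> constructor <;> linarith
    · intro v hv _
      obtain ⟨j, hj⟩ := sing_of h hc hv (by simp)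
      rw [Finset.sum_sub_distrib, sum_eu hp hq]
      unfold dl
      by_cases h1 : v = p
      · subst h1
        obtain ⟨c, hc⟩ := hsβ
        have := abs_min (j := j) (by omega) (by omega) (show s ≤ k by omega) ⟨c, hc⟩
        refine ⟨-c - 1, ?_⟩
        rw [abs_of_pos (by omega)] at this
        simp only [hpq, if_true, if_false]
        rw [show β v + (k - s + 1) * 1 - 0 + 2 * k * (-c - 1) = - (k - 1) by linarith, abs_neg, abs_of_nonneg (by omega)]
        linarith
      · by_cases h2 : v = q
        · subst h2
          obtain ⟨c, hc⟩ := htβ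
          have := abs_min (j := j) (by omega) (by omega) ht' ⟨c, hc⟩
          refine ⟨-c, ?_⟩
          rw [abs_of_pos (by omega)] at this
          simp only [h1, if_true, if_false]
          rw [show β v + (k - s + 1) * 0 - 1 + 2 * k * -c = t - 1 by linarith, abs_of_nonneg (by omega)]
          linarith
        · refine ⟨j, ?_⟩
          simpa [h1, h2] using hj
    · intro v0 h0; simp at h0
  obtain ⟨x, hx, hn⟩ := IH none _ _ _ _ L (by
    unfold mu
    simp only [Finset.sum_sub_distrib, sum_eu hp hq]
    simp only [Finset.sum_add_distrib, ← Finset.mul_sum, sum_dl]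
    simp [hp, hq]
    nlinarith)
  have hx' := val_add hx p q (-1) (by simp)
  refine ⟨fun u v => x u v + (-1) * fu p q u v, ?_, ?_⟩
  · convert hx' using 3; ring
  · intro v hv
    obtain ⟨h1, h2⟩ := hn v hv
    have e : net S (fun u v => x u v + (-1) * fu p q u v) a b v =
        net S x a (fun v => b v + (k - s) * dl p v) v - (k - s + 1) * dl p v + dl q v := by
      unfold net dl
      simp only [Finset.sum_add_distrib, ← Finset.mul_sum, sum_fu hp hq]; ring
    rw [e]
    simp only at h1
    refine ⟨by obtain ⟨c, hc⟩ := h1; exact ⟨c, by linarith⟩, ?_⟩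
    generalize net S x a (fun v => b v + (k - s) * dl p v) v = n at h1 h2 ⊢
    unfold dl at h1 ⊢
    by_cases h3 : v = p
    · subst h3
      simp only [hpq, if_true, if_false] at h1 ⊢
      have h4 : 2 * k ∣ n - (k + 1) := by
        obtain ⟨c, hc⟩ := h1; obtain ⟨c', hc'⟩ := hsβ; exact ⟨c + c', by linarith⟩
      rcases net_vals (by omega) (by omega) (by omega) h4 h2 with h | h <;> rw [h, abs_lt] <;> constructor <;> linarith
    · by_cases h6 : v = q
      · subst h6
        simp only [h3, if_true, if_false] at h1 ⊢
        have h4 : 2 * k ∣ n - (t - 1) := by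
          obtain ⟨c, hc⟩ := h1; obtain ⟨c', hc'⟩ := htβ; exact ⟨c + c', by linarith⟩
        by_cases h5 : t = 1
        · subst h5
          have : n = 0 := by
            apply Int.eq_zero_of_abs_lt_dvd (by simpa using h4) h2
          rw [this]; norm_num; linarith
        · rcases net_vals (by omega) (by omega) (by omega) h4 h2 with h | h <;> rw [h, abs_lt] <;> constructor <;> linarith
      · simpa [h3, h6] using h2

lemma residue {k : ℤ} (hk : 2 ≤ k) (x : ℤ) (h : ¬ 2 * k ∣ x) :
    (∃ s, 1 ≤ s ∧ s ≤ k ∧ 2 * k ∣ x - s) ∨ (∃ s, 1 ≤ s ∧ s ≤ k ∧ 2 * k ∣ x + s) := by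
  have h1 := Int.emod_add_mul_ediv x (2 * k)
  have h2 := Int.emod_nonneg x (show 2 * k ≠ 0 by omega)
  have h3 := Int.emod_lt_of_pos x (show 0 < 2 * k by omega)
  have h4 : x % (2 * k) ≠ 0 := fun h5 => h (Int.dvd_of_emod_eq_zero h5)
  by_cases h6 : x % (2 * k) ≤ k
  · exact Or.inl ⟨x % (2 * k), by omega, h6, ⟨x / (2 * k), by linarith⟩⟩
  · exact Or.inr ⟨2 * k - x % (2 * k), by omega, by omega, ⟨x / (2 * k) + 1, by linarith⟩⟩

lemma step_plus {k : ℤ} (hk : 2 ≤ k) {S : Finset V}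
    {w : V → V → ℤ} {a b β : V → ℤ} (h : LG k S none w a b β) (hc : 2 ≤ S.card)
    (big : Big k S w a b β)
    (IH : ∀ ex' w' a' b' β', LG k S ex' w' a' b' β' → mu k S ex' w' a' b' < mu k S none w a b →
      Sol k S w' a' b' β')
    (hpl : ∀ v ∈ S, ∃ s, 1 ≤ s ∧ s ≤ k ∧ 2 * k ∣ β v - s) : Sol k S w a b β := by
  by_cases h1 : ∃ v ∈ S, 0 < b v
  · obtain ⟨v, hv, hb⟩ := h1
    obtain ⟨s, hs, hs', hd⟩ := hpl v hv
    exact step_b hk h hc big IH hv hb hs hs' hd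
  · have hb0 : ∀ v ∈ S, b v = 0 := by
      intro v hv
      have := h.hb v
      by_contra h2
      exact h1 ⟨v, hv, by omega⟩
    obtain ⟨p, hp⟩ : S.Nonempty := Finset.card_pos.1 (by omega)
    have : ∃ q ∈ S, w p q ≠ 0 := by
      by_contra hno
      push Not at hno
      refine step_c hk h (A := {p}) (by simpa using hp) (by simp) ?_ ?_
      · rw [← Finset.card_pos, Finset.card_sdiff_of_subset (by simpa using hp)]; simp; omega
      · intro u hu v hv
        simp at hu hv; subst hu; exact hno v hv.1
    obtain ⟨q, hq, hpq0⟩ := this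
    have hw : 0 < w p q := lt_of_le_of_ne (h.w0 p q) (Ne.symm hpq0)
    have hpq : p ≠ q := by rintro rfl; exact hpq0 (h.diag p)
    obtain ⟨s, hs, hs', hsd⟩ := hpl p hp
    obtain ⟨t, ht, ht', htd⟩ := hpl q hq
    by_cases hsk : s = k
    · subst hsk
      refine step_a hk h hc big IH hq hp (Ne.symm hpq) (by rw [h.sym]; exact hw) ht ht' htd hs le_rfl ?_
      obtain ⟨c, hc⟩ := hsd
      exact ⟨c + 1, by linarith⟩
    · exact step_d hk h hc big IH hp hq hpq hw hb0 hs (by omega) hsd ht ht' htd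

lemma step_none {k : ℤ} (hk : 2 ≤ k) {S : Finset V}
    {w : V → V → ℤ} {a b β : V → ℤ} (h : LG k S none w a b β) (hc : 2 ≤ S.card)
    (big : Big k S w a b β)
    (IH : ∀ ex' w' a' b' β', LG k S ex' w' a' b' β' → mu k S ex' w' a' b' < mu k S none w a b →
      Sol k S w' a' b' β') : Sol k S w a b β := by
  by_cases h0 : ∃ v ∈ S, 2 * k ∣ β v
  · obtain ⟨v, hv, hd⟩ := h0
    refine IH (some v) w a b β ⟨h.sym, h.w0, h.diag, h.ha, h.hb, h.par, h.sum, h.ii, ?_, ?_⟩ ?_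
    · intro A h1 h2 h3 _
      exact h.iii A h1 h2 h3 (by simp)
    · rintro v0 h1; simp at h1; subst h1; exact ⟨hv, hd⟩
    · unfold mu; simp
  push Not at h0
  classical
  set P := S.filter (fun v => ∃ s, 1 ≤ s ∧ s ≤ k ∧ 2 * k ∣ β v - s) with hP
  have hN : ∀ v ∈ S, v ∉ P → ∃ s, 1 ≤ s ∧ s ≤ k ∧ 2 * k ∣ β v + s := by
    intro v hv hvP
    rcases residue hk (β v) (h0 v hv) with h1 | h1
    · exact absurd (by simp [hP, hv, h1]) hvP
    · exact h1
  by_cases hPS : P = S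
  · apply step_plus hk h hc big IH
    intro v hv
    rw [← hPS] at hv
    exact (Finset.mem_filter.1 hv).2
  by_cases hPe : P = ∅
  · apply neg_Sol
    refine step_plus hk (neg_LG h) hc (neg_Big big) ?_ ?_
    · intro ex' w' a' b' β' h1 h2
      rw [neg_mu k S none w a b] at h2
      exact IH _ _ _ _ _ h1 h2
    · intro v hv
      obtain ⟨s, h1, h2, ⟨c, h3⟩⟩ := hN v hv (by simp [hPe])
      exact ⟨s, h1, h2, ⟨-c, by linarith⟩⟩
  by_cases hedge : ∃ p ∈ P, ∃ q ∈ S \ P, w p q ≠ 0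
  · obtain ⟨p, hp, q, hq, hw⟩ := hedge
    have hw' : 0 < w p q := lt_of_le_of_ne (h.w0 p q) (Ne.symm hw)
    have hpq : p ≠ q := by rintro rfl; exact hw (h.diag p)
    rw [Finset.mem_sdiff] at hq
    obtain ⟨s, h1, h2, h3⟩ := (Finset.mem_filter.1 hp).2
    obtain ⟨t, h4, h5, h6⟩ := hN q hq.1 hq.2
    exact step_a hk h hc big IH (Finset.mem_filter.1 hp).1 hq.1 hpq hw' h1 h2 h3 h4 h5 h6
  · push Not at hedge
    refine (step_c hk h (A := P) (Finset.filter_subset _ _) (Finset.nonempty_iff_ne_empty.2 hPe) ?_ hedge).elim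
    rw [Finset.sdiff_nonempty]
    intro hh
    exact hPS (Finset.Subset.antisymm (Finset.filter_subset _ _) hh)

/-- lifting two edges at the exceptional vertex -/
lemma lift_two {k : ℤ} (hk : 2 ≤ k) {S : Finset V} {v0 : V}
    {w : V → V → ℤ} {a b β : V → ℤ} (h : LG k S (some v0) w a b β) (hc : 2 ≤ S.card)
    (big : Big k S w a b β)
    (IH : ∀ ex' w' a' b' β', LG k S ex' w' a' b' β' → mu k S ex' w' a' b' < mu k S (some v0) w a b →
      Sol k S w' a' b' β')
    {p q : V} (hp : p ∈ S) (hq : q ∈ S) (hpq : p ≠ q) (h0p : v0 ≠ p) (h0q : v0 ≠ q)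
    (hwp : 0 < w v0 p) (hwq : 0 < w v0 q) : Sol k S w a b β := by
  have h0 := (h.exc v0 rfl).1
  have nn : ∀ u v, 0 ≤ w u v - eu v0 p u v - eu v0 q u v := by
    refine eu_pos (w := fun u v => w u v - eu v0 p u v) h0q ?_ (eu_pos h0p h.sym h.w0 hwp) ?_
    · intro u v; rw [h.sym, eu_symm]
    · have : eu v0 p v0 q = 0 := by simp [eu, Ne.symm hpq, h0p]
      simp only [this]; omega
  have L : LG k S (some v0) (fun u v => w u v - eu v0 p u v - eu v0 q u v + eu p q u v) a b β := by
    refine mkLG big ?_ ?_ ?_ h.ha h.hb ?_ h.sum h.ii ?_ ?_ h.exc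
    · intro u v; rw [h.sym, eu_symm, eu_symm v0 q, eu_symm p q]
    · intro u v; have := nn u v; have := eu_nonneg p q u v; linarith
    · intro v; rw [h.diag, eu_diag hpq, eu_diag h0p, eu_diag h0q]; rfl
    · intro v hv
      have := h.par v hv
      rw [Finset.sum_add_distrib, Finset.sum_sub_distrib, Finset.sum_sub_distrib, sum_eu hp hq,
        sum_eu h0 hp, sum_eu h0 hq]
      split_ifs <;> omega
    · intro A hA _ _
      unfold Dg
      rw [cut_add, cut_sub (fun u v => w u v - eu v0 p u v), cut_sub, cut_eu hp hq hA, cut_eu h0 hp hA, cut_eu h0 hq hA]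
      simp only [sub_self, abs_zero]
      by_cases h1 : p ∈ A <;> by_cases h2 : q ∈ A <;> by_cases h3 : v0 ∈ A <;> simp [h1, h2, h3] <;> linarith
    · intro v hv hvx
      obtain ⟨j, hj⟩ := sing_of h hc hv hvx
      refine ⟨j, ?_⟩
      have h3 : v ≠ v0 := by rintro rfl; exact hvx rfl
      rw [Finset.sum_add_distrib, Finset.sum_sub_distrib, Finset.sum_sub_distrib, sum_eu hp hq,
        sum_eu h0 hp, sum_eu h0 hq]
      by_cases h1 : v = p <;> by_cases h2 : v = q <;> simp [h1, h2, h3] <;> simp_all <;> linarith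
  obtain ⟨x, hx, hn⟩ := IH _ _ _ _ _ L (by
    unfold mu
    simp only [Finset.sum_add_distrib, Finset.sum_sub_distrib, sum_eu hp hq, sum_eu h0 hp, sum_eu h0 hq]
    simp [hp, hq, h0]
    nlinarith)
  obtain ⟨ε, hε, hx1⟩ := val_sub hpq hp hq nn (by
    intro u v; rw [h.sym, eu_symm, eu_symm v0 q]) hx
  have hε' : -ε = 1 ∨ -ε = -1 := by omega
  have hx2 := val_add hx1 v0 p (-ε) hε'
  have hx3 := val_add hx2 v0 q ε hε
  refine ⟨fun u v ↦ x u v - ε * fu p q u v + -ε * fu v0 p u v + ε * fu v0 q u v, ?_, ?_⟩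
  · convert hx3 using 3; ring
  · intro v hv
    have e : net S (fun u v ↦ x u v - ε * fu p q u v + -ε * fu v0 p u v + ε * fu v0 q u v) a b v = net S x a b v := by
      unfold net
      simp only [Finset.sum_add_distrib, Finset.sum_sub_distrib, ← Finset.mul_sum, sum_fu h0 hp, sum_fu h0 hq, sum_fu hp hq]
      ring
    rw [e]
    exact hn v hv

lemma lift_a {k : ℤ} (hk : 2 ≤ k) {S : Finset V} {v0 : V}
    {w : V → V → ℤ} {a b β : V → ℤ} (h : LG k S (some v0) w a b β) (hc : 2 ≤ S.card)
    (big : Big k S w a b β)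
    (IH : ∀ ex' w' a' b' β', LG k S ex' w' a' b' β' → mu k S ex' w' a' b' < mu k S (some v0) w a b →
      Sol k S w' a' b' β')
    {p : V} (hp : p ∈ S) (h0p : v0 ≠ p)
    (hwp : 0 < w v0 p) (ha0 : 0 < a v0) : Sol k S w a b β := by
  have h0 := (h.exc v0 rfl).1
  have L : LG k S (some v0) (fun u v => w u v - eu v0 p u v) (fun v => a v - dl v0 v + dl p v) b β := by
    refine mkLG big ?_ (eu_pos h0p h.sym h.w0 hwp) ?_ ?_ h.hb ?_ ?_ ?_ ?_ ?_ h.exc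
    · intro u v; rw [h.sym, eu_symm]
    · intro v; rw [h.diag, eu_diag h0p]; rfl
    · intro v
      have := dl_pos h.ha ha0 v
      have := dl_nonneg p v
      linarith
    · intro v hv
      have := h.par v hv
      rw [Finset.sum_sub_distrib, sum_eu h0 hp]
      unfold dl
      split_ifs <;> omega
    · obtain ⟨c, hc⟩ := h.sum
      refine ⟨c, ?_⟩
      simp only [Finset.sum_add_distrib, Finset.sum_sub_distrib, sum_dl, h0, hp, if_true] at hc ⊢
      linarith
    · intro j
      have := h.ii j
      simp only [Finset.sum_add_distrib, Finset.sum_sub_distrib, sum_dl, h0, hp, if_true] at this ⊢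
      linarith
    · intro A hA _ _
      unfold Dg
      rw [cut_sub, cut_eu h0 hp hA]
      simp only [sub_self, abs_zero, Finset.sum_add_distrib, Finset.sum_sub_distrib, sum_dl]
      by_cases h1 : p ∈ A <;> by_cases h3 : v0 ∈ A <;> simp [h1, h3] <;> linarith
    · intro v hv hvx
      obtain ⟨j, hj⟩ := sing_of h hc hv hvx
      refine ⟨j, ?_⟩
      have h3 : v ≠ v0 := by rintro rfl; exact hvx rfl
      rw [Finset.sum_sub_distrib, sum_eu h0 hp]
      unfold dl
      by_cases h1 : v = p
      · subst h1; simp only [h3, if_true, if_false]; linarith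
      · simp only [h1, h3, if_false]; linarith
  obtain ⟨x, hx, hn⟩ := IH _ _ _ _ _ L (by
    unfold mu
    simp only [Finset.sum_add_distrib, Finset.sum_sub_distrib, sum_eu h0 hp, sum_dl]
    simp [hp, h0]
    nlinarith)
  have hx2 := val_add hx v0 p 1 (by simp)
  refine ⟨fun u v ↦ x u v + 1 * fu v0 p u v, ?_, ?_⟩
  · convert hx2 using 3; ring
  · intro v hv
    have e : net S (fun u v ↦ x u v + 1 * fu v0 p u v) a b v = net S x (fun v => a v - dl v0 v + dl p v) b v := by
      unfold net dl
      simp only [Finset.sum_add_distrib, one_mul, sum_fu h0 hp]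
      ring
    rw [e]
    exact hn v hv

lemma step_exc {k : ℤ} (hk : 2 ≤ k) {S : Finset V} {v0 : V}
    {w : V → V → ℤ} {a b β : V → ℤ} (h : LG k S (some v0) w a b β) (hc : 2 ≤ S.card)
    (big : Big k S w a b β)
    (IH : ∀ ex' w' a' b' β', LG k S ex' w' a' b' β' → mu k S ex' w' a' b' < mu k S (some v0) w a b →
      Sol k S w' a' b' β')
    (IH1 : ∀ S' : Finset V, S'.Nonempty → S'.card < S.card → ∀ ex' w' a' b' β', LG k S' ex' w' a' b' β' →
      Sol k S' w' a' b' β') : Sol k S w a b β := by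
  obtain ⟨h0, c0, hc0⟩ := h.exc v0 rfl
  have hSne : (S.erase v0).Nonempty := by
    rw [← Finset.card_pos, Finset.card_erase_of_mem h0]; omega
  have hSlt : (S.erase v0).card < S.card := Finset.card_erase_lt_of_mem h0
  have hsub : S.erase v0 ⊆ S := Finset.erase_subset _ _
  have hss : ∀ g : V → ℤ, ∑ v ∈ S, g v = g v0 + ∑ v ∈ S.erase v0, g v := fun g =>
    (Finset.add_sum_erase S g h0).symm
  -- the only neighbour, if any, is u
  have key : a v0 = 0 → b v0 = 0 → (∃ u ∈ S, u ≠ v0 ∧ ∀ v ∈ S, v ≠ u → w v0 v = 0) → Sol k S w a b β := by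
    rintro ha0 hb0 ⟨u, hu, huv, hw⟩
    have hev : (2:ℤ) ∣ w v0 u := by
      have := h.par v0 h0
      rw [ha0, hb0, Finset.sum_eq_single_of_mem u hu (fun v hv hvu => hw v hv hvu), hc0] at this
      have h2 : (2:ℤ) ∣ 2 * k * c0 := ⟨k * c0, by ring⟩
      omega
    have L : LG k (S.erase v0) none w a b β := by
      refine ⟨h.sym, h.w0, h.diag, h.ha, h.hb, ?_, ?_, ?_, ?_, by simp⟩
      · intro v hv
        have h1 := h.par v (hsub hv)
        rw [hss] at h1
        have h2 : (2:ℤ) ∣ w v v0 := by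
          rw [h.sym]
          by_cases hvu : v = u
          · rw [hvu]; exact hev
          · rw [hw v (hsub hv) hvu]; simp
        omega
      · obtain ⟨c, h1⟩ := h.sum
        rw [hss, hss, ha0, hb0, hc0] at h1
        exact ⟨c - c0, by linarith⟩
      · intro j
        have h1 := h.ii (j - c0)
        rw [hss, hss, ha0, hb0, hc0] at h1
        rw [show 2 * k * c0 + ∑ v ∈ S.erase v0, β v + 2 * k * (j - c0) = ∑ v ∈ S.erase v0, β v + 2 * k * j by ring] at h1
        linarith
      · intro A hA hne hAS _
        have hv0A : v0 ∉ A := fun hh => by have := hA hh; simp at this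
        have hAS' : A ⊆ S := hA.trans hsub
        by_cases huA : u ∈ A
        · obtain ⟨j, hj⟩ := h.iii (insert v0 A) (Finset.insert_subset h0 hAS') (by simp) (by
            intro hh; apply hAS; rw [← hh]; simp [hv0A]) (by
            rintro v hv hh
            simp at hv; subst hv
            have : u ∈ ({v0} : Finset V) := by rw [← hh]; simp [huA]
            simp at this; exact huv this)
          refine ⟨j + c0, ?_⟩
          rw [Finset.sum_insert hv0A, hc0] at hj
          rw [show ∑ v ∈ A, β v + 2 * k * (j + c0) = 2 * k * c0 + ∑ v ∈ A, β v + 2 * k * j by ring]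
          refine hj.trans (le_of_eq ?_)
          unfold Dg cut
          rw [Finset.sum_insert hv0A, Finset.sum_insert hv0A, ha0, hb0]
          have e1 : S \ insert v0 A = S.erase v0 \ A := by
            ext x; simp; tauto
          rw [e1]
          have e2 : ∑ v ∈ S.erase v0 \ A, w v0 v = 0 := by
            apply Finset.sum_eq_zero
            intro v hv
            rw [Finset.mem_sdiff] at hv
            exact hw v (hsub hv.1) (by rintro rfl; exact hv.2 huA)
          rw [e2]; ring
        · obtain ⟨j, hj⟩ := h.iii A hAS' hne (by rintro rfl; exact hv0A h0) (by
            rintro v hv hh; simp at hv; subst hv; rw [hh] at hv0A; simp at hv0A)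
          refine ⟨j, hj.trans (le_of_eq ?_)⟩
          unfold Dg cut
          congr 1
          apply Finset.sum_congr rfl
          intro y hy
          have e1 : S \ A = insert v0 (S.erase v0 \ A) := by
            ext x; simp only [Finset.mem_sdiff, Finset.mem_insert, Finset.mem_erase]
            constructor
            · rintro ⟨h1, h2⟩
              by_cases hx : x = v0
              · left; exact hx
              · right; exact ⟨⟨hx, h1⟩, h2⟩
            · rintro (rfl | ⟨⟨_, h1⟩, h2⟩)
              · exact ⟨h0, hv0A⟩
              · exact ⟨h1, h2⟩
          rw [e1, Finset.sum_insert (by simp), h.sym, hw y (hAS' hy) (by rintro rfl; exact huA hy)]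
          ring
    obtain ⟨x, hx, hn⟩ := IH1 _ hSne hSlt _ _ _ _ _ L
    refine ⟨fun u v => if u = v0 ∨ v = v0 then 0 else x u v, ⟨?_, ?_⟩, ?_⟩
    · intro y z
      simp only [or_comm]
      split_ifs
      · simp
      · exact hx.1 y z
    · intro y hy z hz
      by_cases h1 : y = v0 ∨ z = v0
      · simp only [h1, if_true]
        refine ⟨by simpa using h.w0 y z, ?_⟩
        rcases h1 with rfl | rfl
        · by_cases hzu : z = u
          · subst hzu; omega
          · rw [hw z hz hzu]; simp
        · by_cases hzu : y = u
          · subst hzu; rw [h.sym]; omega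
          · rw [h.sym, hw y hy hzu]; simp
      · simp only [h1, if_false]
        push Not at h1
        exact hx.2 y (by simp [h1, hy]) z (by simp [h1, hz])
    · intro v hv
      by_cases hvv : v = v0
      · have e : net S (fun u v => if u = v0 ∨ v = v0 then 0 else x u v) a b v = 0 := by
          unfold net; simp [hvv, ha0, hb0]
        rw [e, hvv, hc0]
        exact ⟨⟨-c0, by ring⟩, by simp; omega⟩
      · have e : net S (fun u v => if u = v0 ∨ v = v0 then 0 else x u v) a b v = net (S.erase v0) x a b v := by
          unfold net
          rw [hss]
          simp only [or_true, if_true, hvv, false_or]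
          congr 2
          rw [zero_add]
          apply Finset.sum_congr rfl
          intro z hz
          simp [(Finset.mem_erase.1 hz).1]
        rw [e]
        exact hn v (by simp [hvv, hv])
  by_cases hnb : ∃ p ∈ S, w v0 p ≠ 0
  · obtain ⟨p, hp, hwp⟩ := hnb
    have h0p : v0 ≠ p := by rintro rfl; exact hwp (h.diag _)
    have hwp' : 0 < w v0 p := lt_of_le_of_ne (h.w0 _ _) (Ne.symm hwp)
    by_cases ha0 : 0 < a v0
    · exact lift_a hk h hc big IH hp h0p hwp' ha0
    by_cases hb0 : 0 < b v0
    · apply neg_Sol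
      refine lift_a hk (neg_LG h) hc (neg_Big big) ?_ hp h0p hwp' hb0
      intro ex' w' a' b' β' h1 h2
      rw [neg_mu k S _ w a b] at h2
      exact IH _ _ _ _ _ h1 h2
    by_cases hq : ∃ q ∈ S, q ≠ p ∧ w v0 q ≠ 0
    · obtain ⟨q, hq, hqp, hwq⟩ := hq
      have h0q : v0 ≠ q := by rintro rfl; exact hwq (h.diag _)
      have hwq' : 0 < w v0 q := lt_of_le_of_ne (h.w0 _ _) (Ne.symm hwq)
      exact lift_two hk h hc big IH hp hq (Ne.symm hqp) h0p h0q hwp' hwq'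
    · push Not at hq
      have := h.ha v0
      have := h.hb v0
      exact key (by omega) (by omega) ⟨p, hp, Ne.symm h0p, hq⟩
  · push Not at hnb
    by_cases hz : a v0 + b v0 = 0
    · have := h.ha v0
      have := h.hb v0
      obtain ⟨u, hu⟩ := hSne
      rw [Finset.mem_erase] at hu
      exact key (by omega) (by omega) ⟨u, hu.2, hu.1, fun v hv _ => hnb v hv⟩
    · exfalso
      obtain ⟨j, hj⟩ := h.iii (S.erase v0) hsub hSne (by
        intro hh; rw [hh] at hSlt; omega) (by
        intro v hv hh
        simp at hv; subst hv
        have : v0 ∈ S.erase v0 := by rw [hh]; simp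
        simp at this)
      have h1 := h.ii (j - c0)
      rw [hss, hss, hc0, show 2 * k * c0 + ∑ v ∈ S.erase v0, β v + 2 * k * (j - c0) = ∑ v ∈ S.erase v0, β v + 2 * k * j by ring] at h1
      unfold Dg at hj
      have e : cut w S (S.erase v0) = 0 := by
        unfold cut
        apply Finset.sum_eq_zero
        intro y hy
        apply Finset.sum_eq_zero
        intro z hz
        have : z = v0 := by
          simp at hz; tauto
        rw [this, h.sym, hnb y (hsub hy)]
      have := h.ha v0
      have := h.hb v0
      rw [e] at hj
      omega

lemma split_lem (A : Finset V) (w : V → ℤ) (hw : ∀ v ∈ A, 0 ≤ w v) (C : ℤ) (h0 : 0 ≤ C)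
    (h1 : C ≤ ∑ v ∈ A, w v) : ∃ c : V → ℤ, (∀ v ∈ A, 0 ≤ c v ∧ c v ≤ w v) ∧ ∑ v ∈ A, c v = C := by
  induction A using Finset.induction_on generalizing C with
  | empty => exact ⟨fun _ => 0, by simp, by simp at h1 ⊢; omega⟩
  | insert p A hp ih =>
    rw [Finset.sum_insert hp] at h1
    have hwp := hw p (by simp)
    obtain ⟨c, hc, hs⟩ := ih (fun v hv => hw v (by simp [hv])) (C - min C (w p)) (by
      have := min_le_left C (w p); omega) (by
      have : 0 ≤ ∑ v ∈ A, w v := Finset.sum_nonneg (fun v hv => hw v (by simp [hv]))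
      rcases le_total C (w p) with h | h
      · rw [min_eq_left h]; simpa using this
      · rw [min_eq_right h]; omega)
    refine ⟨fun v => if v = p then min C (w p) else c v, ?_, ?_⟩
    · intro v hv
      by_cases h : v = p
      · subst h; simp; omega
      · simp only [h, if_false]
        exact hc v (by simpa [h] using hv)
    · rw [Finset.sum_insert hp]
      simp only [if_true]
      have : ∑ v ∈ A, (if v = p then min C (w p) else c v) = ∑ v ∈ A, c v := by
        apply Finset.sum_congr rfl
        intro v hv
        rw [if_neg]; rintro rfl; exact hp hv
      rw [this, hs]; ring

lemma even_in (A : Finset V) (w : V → V → ℤ) (hs : ∀ u v, w u v = w v u) (hd : ∀ v, w v v = 0) :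
    (2:ℤ) ∣ ∑ u ∈ A, ∑ v ∈ A, w u v := by
  induction A using Finset.induction_on with
  | empty => simp
  | insert p A hp ih =>
    rw [Finset.sum_insert hp, Finset.sum_insert hp, hd]
    simp only [Finset.sum_insert hp, Finset.sum_add_distrib]
    have e : ∑ v ∈ A, w v p = ∑ v ∈ A, w p v := Finset.sum_congr rfl (fun v _ => hs v p)
    rw [e]
    omega

lemma par_set {k : ℤ} {S : Finset V} {ex : Option V}
    {w : V → V → ℤ} {a b β : V → ℤ} (h : LG k S ex w a b β) {A : Finset V} (hA : A ⊆ S) :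
    (2:ℤ) ∣ Dg w a b S A - ∑ v ∈ A, β v := by
  have h1 : (2:ℤ) ∣ ∑ v ∈ A, ((∑ u ∈ S, w v u) + a v + b v - β v) :=
    Finset.dvd_sum (fun v hv => h.par v (hA hv))
  have h2 := even_in A w h.sym h.diag
  have h3 : ∑ v ∈ A, ∑ u ∈ S, w v u = cut w S A + ∑ u ∈ A, ∑ v ∈ A, w u v := by
    unfold cut
    rw [← Finset.sum_add_distrib]
    exact Finset.sum_congr rfl (fun v _ => (Finset.sum_sdiff hA).symm)
  simp only [Finset.sum_add_distrib, Finset.sum_sub_distrib] at h1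
  rw [h3] at h1
  unfold Dg
  simp only [Finset.sum_add_distrib]
  omega

lemma contract {k : ℤ} {S : Finset V} {ex : Option V}
    {w : V → V → ℤ} {a b β : V → ℤ} (h : LG k S ex w a b β)
    {A : Finset V} (hA : A ⊆ S) (hA2 : 2 ≤ A.card) (hAS : A ≠ S)
    (hsm : ∀ j : ℤ, Dg w a b S A ≤ 2 * k - 2 + |(∑ v ∈ A, β v) + 2 * k * j|)
    (IH1 : ∀ S' : Finset V, S'.Nonempty → S'.card < S.card → ∀ ex' w' a' b' β', LG k S' ex' w' a' b' β' →
      Sol k S' w' a' b' β') : Sol k S w a b β := by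
  obtain ⟨a0, ha0⟩ : A.Nonempty := Finset.card_pos.1 (by omega)
  set O := S \ A with hO
  have ha0O : a0 ∉ O := by simp [hO, ha0]
  have hOS : O ⊆ S := Finset.sdiff_subset
  have hdis : Disjoint A O := Finset.disjoint_sdiff
  have hS : ∀ g : V → ℤ, ∑ v ∈ S, g v = ∑ v ∈ A, g v + ∑ v ∈ O, g v := fun g => by
    rw [add_comm]; exact (Finset.sum_sdiff hA).symm
  set S' := insert a0 O with hS'
  have hS's : ∀ g : V → ℤ, ∑ v ∈ S', g v = g a0 + ∑ v ∈ O, g v := fun g => Finset.sum_insert ha0O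
  set w' : V → V → ℤ := fun u v => if u = v then 0 else if u = a0 then ∑ z ∈ A, w z v else
    if v = a0 then ∑ z ∈ A, w z u else w u v with hw'
  have hne0 : ∀ v ∈ O, v ≠ a0 := fun v hv hh => ha0O (hh ▸ hv)
  have w1 : ∀ v ∈ O, w' a0 v = ∑ z ∈ A, w z v := by
    intro v hv; simp [hw', Ne.symm (hne0 v hv)]
  have w2 : ∀ v ∈ O, w' v a0 = ∑ z ∈ A, w z v := by
    intro v hv; simp [hw', hne0 v hv]
  have w3 : ∀ u ∈ O, ∀ v ∈ O, w' u v = w u v := by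
    intro u hu v hv
    by_cases e : u = v
    · subst e; simp [hw', h.diag]
    · simp [hw', e, hne0 v hv, hne0 u hu]
  set lf : (V → ℤ) → V → ℤ := fun g v => if v = a0 then ∑ z ∈ A, g z else g v with hlf
  have lf0 : ∀ g, lf g a0 = ∑ z ∈ A, g z := by intro g; simp [hlf]
  have lf1 : ∀ g, ∀ v ∈ O, lf g v = g v := by intro g v hv; simp [hlf, hne0 v hv]
  have lfS : ∀ g, ∑ v ∈ S', lf g v = ∑ v ∈ S, g v := by
    intro g
    rw [hS's, lf0, hS, Finset.sum_congr rfl (lf1 g)]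
  have lfB0 : ∀ g, ∀ B ⊆ O, ∑ v ∈ B, lf g v = ∑ v ∈ B, g v := by
    intro g B hB
    exact Finset.sum_congr rfl (fun v hv => lf1 g v (hB hv))
  have lfB1 : ∀ g, ∀ B ⊆ O, ∑ v ∈ insert a0 B, lf g v = ∑ v ∈ A ∪ B, g v := by
    intro g B hB
    rw [Finset.sum_insert (fun hh => ha0O (hB hh)), lf0, lfB0 g B hB,
      Finset.sum_union (hdis.mono_right hB)]
  have D0 : ∀ B ⊆ O, Dg w' (lf a) (lf b) S' B = Dg w a b S B := by
    intro B hB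
    unfold Dg
    congr 1
    · unfold cut
      have e1 : S' \ B = insert a0 (O \ B) := by
        rw [hS', Finset.insert_sdiff_of_notMem _ (fun hh => ha0O (hB hh))]
      have e2 : S \ B = A ∪ (O \ B) := by
        ext x
        have := @hA x
        have hB' := @hB x
        simp only [hO, Finset.mem_sdiff, Finset.mem_union] at *
        tauto
      rw [e1, e2]
      apply Finset.sum_congr rfl
      intro u hu
      rw [Finset.sum_insert (by simp [ha0O]), Finset.sum_union (hdis.mono_right Finset.sdiff_subset),
        w2 u (hB hu)]
      congr 1
      · exact Finset.sum_congr rfl (fun v _ => h.sym _ _)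
      · exact Finset.sum_congr rfl (fun v hv => w3 u (hB hu) v (Finset.sdiff_subset hv))
    · simp only [Finset.sum_add_distrib, lfB0 _ B hB]
  have D1 : ∀ B ⊆ O, Dg w' (lf a) (lf b) S' (insert a0 B) = Dg w a b S (A ∪ B) := by
    intro B hB
    unfold Dg
    congr 1
    · unfold cut
      have e1 : S' \ insert a0 B = O \ B := by
        ext x
        simp only [hS', Finset.mem_sdiff, Finset.mem_insert]
        constructor
        · rintro ⟨h1, h2⟩; exact ⟨by tauto, by tauto⟩
        · rintro ⟨h1, h2⟩; exact ⟨by tauto, by have := hne0 x h1; tauto⟩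
      have e2 : S \ (A ∪ B) = O \ B := by
        ext x; simp only [hO, Finset.mem_sdiff, Finset.mem_union]; tauto
      rw [e1, e2, Finset.sum_insert (fun hh => ha0O (hB hh)), Finset.sum_union (hdis.mono_right hB)]
      congr 1
      · rw [Finset.sum_comm]
        exact Finset.sum_congr rfl (fun v hv => w1 v (Finset.sdiff_subset hv))
      · exact Finset.sum_congr rfl (fun u hu => Finset.sum_congr rfl (fun v hv =>
          w3 u (hB hu) v (Finset.sdiff_subset hv)))
    · simp only [Finset.sum_add_distrib, lfB1 _ B hB]
  have ha0' : ∀ g : V → ℤ, (∀ v, 0 ≤ g v) → ∀ v, 0 ≤ lf g v := by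
    intro g hg v
    simp only [hlf]
    split_ifs
    · exact Finset.sum_nonneg (fun z _ => hg z)
    · exact hg v
  have hcard : S'.card < S.card := by
    rw [hS', Finset.card_insert_of_notMem ha0O, hO, Finset.card_sdiff_of_subset hA]
    have := Finset.card_le_card hA
    omega
  have w'diag : ∀ v, w' v v = 0 := by intro v; simp [hw']
  -- outside
  have L1 : LG k S' (ex.filter (fun v => decide (v ∉ A))) w' (lf a) (lf b) (lf β) := by
    refine ⟨?_, ?_, w'diag, ha0' a h.ha, ha0' b h.hb, ?_, ?_, ?_, ?_, ?_⟩
    · intro u v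
      simp only [hw']
      by_cases e1 : u = v
      · subst e1; rfl
      · by_cases e2 : u = a0
        · subst e2; simp [e1, Ne.symm e1]
        · by_cases e3 : v = a0
          · subst e3; simp [e1, Ne.symm e1]
          · simp [e1, Ne.symm e1, e2, e3, h.sym u v]
    · intro u v
      simp only [hw']
      split_ifs
      · exact le_rfl
      · exact Finset.sum_nonneg (fun z _ => h.w0 _ _)
      · exact Finset.sum_nonneg (fun z _ => h.w0 _ _)
      · exact h.w0 _ _
    · intro v hv
      rw [← Dg_single w' w'diag _ _ hv]
      rw [hS', Finset.mem_insert] at hv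
      rcases hv with rfl | hv
      · have := D1 ∅ (by simp)
        simp only [insert_empty_eq, Finset.union_empty] at this
        rw [this, lf0]
        exact par_set h hA
      · rw [D0 {v} (by simpa using hv), lf1 _ v hv, Dg_single w h.diag a b (hOS hv)]
        exact h.par v (hOS hv)
    · have := h.sum
      simp only [Finset.sum_sub_distrib, lfS] at this ⊢
      exact this
    · intro j
      have := h.ii j
      simp only [Finset.sum_add_distrib, lfS] at this ⊢
      exact this
    · intro B hB hne hBS hex
      by_cases hB0 : a0 ∈ B
      · obtain ⟨B1, hB1, rfl⟩ : ∃ B1 ⊆ O, B = insert a0 B1 :=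
          ⟨B.erase a0, by
            intro x hx
            have := hB (Finset.mem_of_mem_erase hx)
            rw [hS', Finset.mem_insert] at this
            exact this.resolve_left (Finset.ne_of_mem_erase hx), by rw [Finset.insert_erase hB0]⟩
        rw [D1 B1 hB1, lfB1 β B1 hB1]
        apply h.iii
        · exact Finset.union_subset hA (hB1.trans hOS)
        · exact ⟨a0, by simp [ha0]⟩
        · intro hh
          apply hBS
          rw [hS']
          congr 1
          apply Finset.Subset.antisymm hB1
          intro x hx
          have h1 := hOS hx
          rw [← hh, Finset.mem_union] at h1
          rw [hO, Finset.mem_sdiff] at hx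
          tauto
        · intro v0 _ hh
          have : (A ∪ B1).card = 1 := by rw [hh]; simp
          have := Finset.card_le_card (Finset.subset_union_left (s₁ := A) (s₂ := B1))
          omega
      · have hBO : B ⊆ O := by
          intro x hx
          have := hB hx
          rw [hS', Finset.mem_insert] at this
          exact this.resolve_left (by rintro rfl; exact hB0 hx)
        rw [D0 B hBO, lfB0 β B hBO]
        apply h.iii B (hBO.trans hOS) hne
        · rintro rfl
          exact hB0 (hA ha0)
        · intro v0 hv0 hh
          apply hex v0 _ hh
          have : v0 ∈ O := hBO (by rw [hh]; simp)
          rw [hv0]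
          rw [hO, Finset.mem_sdiff] at this
          simp [Option.filter, this.2]
    · intro v0 hv0
      rw [Option.filter_eq_some_iff] at hv0
      obtain ⟨h1, h2⟩ := h.exc v0 hv0.1
      have : v0 ∈ O := by
        rw [hO, Finset.mem_sdiff]; exact ⟨h1, by simpa using hv0.2⟩
      exact ⟨by rw [hS', Finset.mem_insert]; right; exact this, by rw [lf1 _ _ this]; exact h2⟩
  obtain ⟨x', hx', hn'⟩ := IH1 S' (by simp [hS']) hcard _ _ _ _ _ L1
  have hspl : ∀ v ∈ O, ∃ c : V → ℤ, (∀ z ∈ A, 0 ≤ c z ∧ c z ≤ w z v) ∧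
      x' a0 v = ∑ z ∈ A, (w z v - 2 * c z) := by
    intro v hv
    have h1 := hx'.2 a0 (by simp [hS']) v (by simp [hS', hv])
    rw [w1 v hv] at h1
    rw [abs_le] at h1
    obtain ⟨c, hc, hs⟩ := split_lem A (fun z => w z v) (fun z _ => h.w0 _ _)
      ((∑ z ∈ A, w z v - x' a0 v) / 2) (by omega) (by omega)
    refine ⟨c, hc, ?_⟩
    rw [Finset.sum_sub_distrib, ← Finset.mul_sum, hs]
    omega
  choose! c hc hcx using hspl
  -- inside
  have hcard2 : A.card < S.card := Finset.card_lt_card (hA.ssubset_of_ne hAS)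
  have Dtot : ∀ B ⊆ A, Dg w (fun z => a z + ∑ v ∈ O, c v z) (fun z => b z + ∑ v ∈ O, (w z v - c v z)) A B
      = Dg w a b S B := by
    intro B hB
    unfold Dg cut
    have e : S \ B = (A \ B) ∪ O := by
      ext x
      have := @hA x
      have hB' := @hB x
      simp only [hO, Finset.mem_sdiff, Finset.mem_union] at *
      tauto
    rw [e, ← Finset.sum_add_distrib, ← Finset.sum_add_distrib]
    apply Finset.sum_congr rfl
    intro z hz
    rw [Finset.sum_union (hdis.mono_left Finset.sdiff_subset)]
    simp only [Finset.sum_sub_distrib]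
    ring
  have L2 : LG k A (ex.filter (fun v => decide (v ∈ A))) w
      (fun z => a z + ∑ v ∈ O, (if z ∈ A then c v z else 0))
      (fun z => b z + ∑ v ∈ O, (if z ∈ A then w z v - c v z else 0)) β := by
    have cg : ∀ B ⊆ A, Dg w (fun z => a z + ∑ v ∈ O, (if z ∈ A then c v z else 0))
      (fun z => b z + ∑ v ∈ O, (if z ∈ A then w z v - c v z else 0)) A B = Dg w a b S B := by
      intro B hB
      rw [← Dtot B hB]
      unfold Dg
      congr 1
      apply Finset.sum_congr rfl
      intro z hz
      simp [hB hz]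
    refine ⟨h.sym, h.w0, h.diag, ?_, ?_, ?_, ?_, ?_, ?_, ?_⟩
    · intro z
      apply add_nonneg (h.ha z)
      apply Finset.sum_nonneg
      intro v hv
      split_ifs with hz
      · exact (hc v hv z hz).1
      · exact le_rfl
    · intro z
      apply add_nonneg (h.hb z)
      apply Finset.sum_nonneg
      intro v hv
      split_ifs with hz
      · have := (hc v hv z hz).2; omega
      · exact le_rfl
    · intro v hv
      have e := cg {v} (by simpa using hv)
      rw [Dg_single w h.diag _ _ hv, Dg_single w h.diag a b (hA hv)] at e
      rw [e]
      exact h.par v (hA hv)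
    · obtain ⟨d, hd⟩ := (hn' a0 (by simp [hS'])).1
      refine ⟨-d, ?_⟩
      unfold net at hd
      rw [hS's, lf0, lf0, lf0, Finset.sum_congr rfl hcx, Finset.sum_comm] at hd
      have h00 : x' a0 a0 = 0 := by have := hx'.1 a0 a0; omega
      rw [h00] at hd
      have e : ∀ z ∈ A, (b z + ∑ v ∈ O, (if z ∈ A then w z v - c v z else 0)) -
          (a z + ∑ v ∈ O, (if z ∈ A then c v z else 0)) = b z - a z + ∑ v ∈ O, (w z v - 2 * c v z) := by
        intro z hz
        simp only [hz, if_true, Finset.sum_sub_distrib, ← Finset.mul_sum]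
        ring
      rw [Finset.sum_congr rfl e, Finset.sum_add_distrib, Finset.sum_sub_distrib]
      linarith
    · intro j
      have h1 := hsm j
      have h2 := cg A (Finset.Subset.refl A)
      rw [← h2] at h1
      unfold Dg cut at h1
      simpa using h1
    · intro B hB hne hBA hex
      rw [cg B hB]
      apply h.iii B (hB.trans hA) hne
      · rintro rfl; exact hAS (Finset.Subset.antisymm hA hB)
      · intro v0 hv0 hh
        apply hex v0 _ hh
        have : v0 ∈ A := hB (by rw [hh]; simp)
        rw [hv0]
        simp [Option.filter, this]
    · intro v0 hv0
      rw [Option.filter_eq_some_iff] at hv0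
      exact ⟨by simpa using hv0.2, (h.exc v0 hv0.1).2⟩
  obtain ⟨x'', hx'', hn''⟩ := IH1 A ⟨a0, ha0⟩ hcard2 _ _ _ _ _ L2
  refine ⟨fun u v => if u ∈ A then (if v ∈ A then x'' u v else w u v - 2 * c v u) else
    (if v ∈ A then - (w v u - 2 * c u v) else x' u v), ⟨?_, ?_⟩, ?_⟩
  · intro u v
    simp only
    split_ifs
    · exact hx''.1 u v
    · ring
    · ring
    · exact hx'.1 u v
  · intro u hu v hv
    simp only
    by_cases h1 : u ∈ A <;> by_cases h2 : v ∈ A <;> simp only [h1, h2, if_true, if_false]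
    · exact hx''.2 u h1 v h2
    · have := hc v (by simp [hO, hv, h2]) u h1
      rw [abs_le]; omega
    · have := hc u (by simp [hO, hu, h1]) v h2
      rw [abs_le, h.sym u v]; omega
    · have hu' : u ∈ O := by simp [hO, hu, h1]
      have hv' : v ∈ O := by simp [hO, hv, h2]
      rw [← w3 u hu' v hv']
      exact hx'.2 u (by simp [hS', hu']) v (by simp [hS', hv'])
  · intro v hv
    by_cases h1 : v ∈ A
    · have := hn'' v h1
      convert this using 2
      · congr 1
        unfold net
        rw [hS]
        simp only [h1, if_true]
        rw [Finset.sum_congr rfl (fun u hu => if_pos hu),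
          Finset.sum_congr rfl (fun u hu => if_neg (Finset.disjoint_right.1 hdis hu))]
        simp only [Finset.sum_sub_distrib, ← Finset.mul_sum]
        ring
      · congr 1
        unfold net
        rw [hS]
        simp only [h1, if_true]
        rw [Finset.sum_congr rfl (fun u hu => if_pos hu),
          Finset.sum_congr rfl (fun u hu => if_neg (Finset.disjoint_right.1 hdis hu))]
        simp only [Finset.sum_sub_distrib, ← Finset.mul_sum]
        ring
    · have hv' : v ∈ O := by simp [hO, hv, h1]
      have := hn' v (by simp [hS', hv'])
      rw [lf1 β v hv'] at this
      have e : net S (fun u v => if u ∈ A then (if v ∈ A then x'' u v else w u v - 2 * c v u) else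
        (if v ∈ A then - (w v u - 2 * c u v) else x' u v)) a b v = net S' x' (lf a) (lf b) v := by
        unfold net
        rw [hS, hS's, lf1 a v hv', lf1 b v hv']
        simp only [h1, if_false]
        rw [Finset.sum_congr rfl (fun u hu => if_pos hu),
          Finset.sum_congr rfl (fun u hu => if_neg (Finset.disjoint_right.1 hdis hu)),
          hx'.1 v a0, hcx v hv', Finset.sum_neg_distrib]
      rw [e]
      exact this

theorem main {k : ℤ} (hk : 2 ≤ k) : ∀ (n : ℕ) (S : Finset V), S.card = n → S.Nonempty →
    ∀ (ex : Option V) (w : V → V → ℤ) (a b β : V → ℤ), LG k S ex w a b β → Sol k S w a b β := by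
  intro n
  induction n using Nat.strong_induction_on with
  | _ n ihn =>
  intro S hSn hSne
  have IH1 : ∀ S' : Finset V, S'.Nonempty → S'.card < S.card → ∀ ex' w' a' b' β', LG k S' ex' w' a' b' β' →
      Sol k S' w' a' b' β' := by
    intro S' hne hlt ex' w' a' b' β' hL
    exact ihn S'.card (by omega) S' rfl hne ex' w' a' b' β' hL
  have key : ∀ (N : ℕ) (ex : Option V) (w : V → V → ℤ) (a b β : V → ℤ), LG k S ex w a b β →
      (mu k S ex w a b).toNat = N → Sol k S w a b β := by
    intro N
    induction N using Nat.strong_induction_on with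
    | _ N ihN =>
    intro ex w a b β h hN
    by_cases hc : 2 ≤ S.card
    · have IH : ∀ ex' w' a' b' β', LG k S ex' w' a' b' β' → mu k S ex' w' a' b' < mu k S ex w a b →
          Sol k S w' a' b' β' := by
        intro ex' w' a' b' β' hL hlt
        refine ihN _ ?_ ex' w' a' b' β' hL rfl
        have hnn : 0 ≤ mu k S ex' w' a' b' := by
          unfold mu
          have h1 : 0 ≤ ∑ u ∈ S, ∑ v ∈ S, w' u v := Finset.sum_nonneg (fun u _ => Finset.sum_nonneg (fun v _ => hL.w0 _ _))
          have h2 : 0 ≤ ∑ v ∈ S, (a' v + b' v) := Finset.sum_nonneg (fun v _ => add_nonneg (hL.ha _) (hL.hb _))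
          have h3 : (0:ℤ) ≤ if ex' = none then 1 else 0 := by split_ifs <;> norm_num
          have h4 : 0 ≤ 2 * k * ∑ u ∈ S, ∑ v ∈ S, w' u v := mul_nonneg (by omega) h1
          linarith
        omega
      by_cases hbig : Big k S w a b β
      · cases ex with
        | none => exact step_none hk h hc hbig IH
        | some v0 => exact step_exc hk h hc hbig IH IH1
      · unfold Big at hbig
        push Not at hbig
        obtain ⟨A, hA, hA2, hAS, hj⟩ := hbig
        refine contract h hA hA2 hAS ?_ IH1
        intro j
        have h1 := hj j
        obtain ⟨d, h2⟩ := par_set h hA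
        have h3 : (2:ℤ) ∣ Dg w a b S A - |∑ v ∈ A, β v + 2 * k * j| := by
          rcases abs_cases (∑ v ∈ A, β v + 2 * k * j) with ⟨e, _⟩ | ⟨e, _⟩
          · rw [e]; exact ⟨d - k * j, by linarith⟩
          · rw [e]; exact ⟨d + k * j + ∑ v ∈ A, β v, by linarith⟩
        omega
    · obtain ⟨v, rfl⟩ : ∃ v, S = {v} := Finset.card_eq_one.1 (by have := hSne.card_pos; omega)
      refine ⟨fun _ _ => 0, ⟨by simp, ?_⟩, ?_⟩
      · intro y hy z hz
        simp at hy hz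
        subst hy; subst hz
        simp [h.diag]
      · intro y hy
        simp at hy
        subst hy
        have h1 := h.sum
        have h2 := h.ii
        have h3 := h.ha y
        have h4 := h.hb y
        simp at h1 h2
        unfold net
        simp
        obtain ⟨d, hd⟩ := h1
        refine ⟨⟨-d, by linarith⟩, ?_⟩
        have e : β y = b y - a y + 2 * k * d := by linarith
        by_contra hcon
        push Not at hcon
        rcases abs_cases (b y - a y) with ⟨e1, e2⟩ | ⟨e1, e2⟩
        · have h5 := h2 (- d - 1)
          rw [e, show b y - a y + 2 * k * d + 2 * k * (-d - 1) = b y - a y - 2 * k by ring, abs_of_nonneg (by omega)] at h5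
          omega
        · have h5 := h2 (- d + 1)
          rw [e, show b y - a y + 2 * k * d + 2 * k * (-d + 1) = b y - a y + 2 * k by ring, abs_of_nonpos (by omega)] at h5
          omega
  intro ex w a b β h
  exact key _ ex w a b β h rfl

end LT

namespace GR
universe u v
variable {V : Type u} {E : Type v} [Fintype V] [DecidableEq V] [DecidableEq E]

lemma rtg_mono {r s : V → V → Prop} (hrs : ∀ a b, r a b → s a b) {a b : V}
    (h : Relation.ReflTransGen r a b) : Relation.ReflTransGen s a b := by
  induction h with
  | refl => exact .refl
  | tail _ h2 ih => exact ih.tail (hrs _ _ h2)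

lemma rtg_symm {r : V → V → Prop} (hrs : ∀ a b, r a b → r b a) {a b : V}
    (h : Relation.ReflTransGen r a b) : Relation.ReflTransGen r b a := by
  induction h with
  | refl => exact .refl
  | tail _ h2 ih => exact Relation.ReflTransGen.head (hrs _ _ h2) ih

/-- number of arcs of S entering A -/
def din (t h : E → V) (S : Finset E) (A : Finset V) : ℕ :=
  (S.filter fun e => h e ∈ A ∧ t e ∉ A).card

lemma din_submod (t h : E → V) (S : Finset E) (A B : Finset V) :
    din t h S (A ∩ B) + din t h S (A ∪ B) ≤ din t h S A + din t h S B := by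
  unfold din
  simp only [Finset.card_filter, ← Finset.sum_add_distrib]
  apply Finset.sum_le_sum
  intro e _
  by_cases h1 : h e ∈ A <;> by_cases h2 : h e ∈ B <;> by_cases h3 : t e ∈ A <;>
    by_cases h4 : t e ∈ B <;> simp [h1, h2, h3, h4]

/-- arborescence rooted at r -/
structure Arb (t h : E → V) (r : V) (F : Finset E) : Prop where
  one : ∀ v, v ≠ r → (F.filter fun e => h e = v).card = 1
  root : (F.filter fun e => h e = r).card = 0
  reach : ∀ v, Relation.ReflTransGen (fun a b => ∃ e ∈ F, t e = a ∧ h e = b) r v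

structure PArb (t h : E → V) (r : V) (M : ℕ) (S : Finset E) (U : Finset V) (F : Finset E) : Prop where
  sub : F ⊆ S
  rU : r ∈ U
  one : ∀ v ∈ U, v ≠ r → (F.filter fun e => h e = v).card = 1
  root : (F.filter fun e => h e = r).card = 0
  hU : ∀ e ∈ F, h e ∈ U
  reach : ∀ v ∈ U, Relation.ReflTransGen (fun a b => ∃ e ∈ F, t e = a ∧ h e = b) r v
  conn : ∀ A : Finset V, A.Nonempty → r ∉ A → M ≤ din t h (S \ F) A

lemma grow_step (t h : E → V) (r : V) (M : ℕ) (S : Finset E)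
    (hS : ∀ A : Finset V, A.Nonempty → r ∉ A → M + 1 ≤ din t h S A)
    {U : Finset V} {F : Finset E} (hP : PArb t h r M S U F) (hU : U ≠ univ) :
    ∃ e ∈ S \ F, t e ∈ U ∧ h e ∉ U ∧ PArb t h r M S (insert (h e) U) (insert e F) := by
  -- suffices to find a good arc
  suffices hg : ∃ e ∈ S \ F, t e ∈ U ∧ h e ∉ U ∧ ∀ B : Finset V, r ∉ B → h e ∈ B → t e ∉ B →
      M + 1 ≤ din t h (S \ F) B by
    obtain ⟨e, he, hte, hhe, hgood⟩ := hg
    rw [Finset.mem_sdiff] at he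
    refine ⟨e, Finset.mem_sdiff.2 he, hte, hhe, ?_⟩
    have hrne : h e ≠ r := fun hh => hhe (hh ▸ hP.rU)
    refine ⟨?_, ?_, ?_, ?_, ?_, ?_, ?_⟩
    · exact Finset.insert_subset he.1 hP.sub
    · simp [hP.rU]
    · intro v hv hvr
      rw [Finset.filter_insert]
      by_cases hve : h e = v
      · rw [if_pos hve]
        have : F.filter (fun e => h e = v) = ∅ := by
          rw [Finset.filter_eq_empty_iff]
          intro e' he' hh
          exact hhe (by rw [hve, ← hh]; exact hP.hU e' he')
        rw [this]; simp
      · rw [if_neg hve]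
        exact hP.one v (by simpa [Ne.symm hve] using hv) hvr
    · rw [Finset.filter_insert, if_neg hrne]
      exact hP.root
    · intro e' he'
      rw [Finset.mem_insert] at he' ⊢
      rcases he' with rfl | he'
      · left; rfl
      · right; exact hP.hU e' he'
    · have mono : ∀ v ∈ U, Relation.ReflTransGen (fun a b => ∃ e' ∈ insert e F, t e' = a ∧ h e' = b) r v := by
        intro v hv
        refine rtg_mono ?_ (hP.reach v hv)
        rintro a b ⟨e', he', hh⟩
        exact ⟨e', by simp [he'], hh⟩
      intro v hv
      rw [Finset.mem_insert] at hv
      rcases hv with rfl | hv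
      · exact (mono _ hte).tail ⟨e, by simp, rfl, rfl⟩
      · exact mono v hv
    · intro A hA hrA
      have hsplit : S \ insert e F = (S \ F).erase e := by
        ext x; simp only [Finset.mem_sdiff, Finset.mem_insert, Finset.mem_erase]; tauto
      rw [hsplit]
      unfold din
      rw [Finset.filter_erase]
      by_cases hin : h e ∈ A ∧ t e ∉ A
      · have := hgood A hrA hin.1 hin.2
        unfold din at this
        have h2 := Finset.pred_card_le_card_erase (s := (S \ F).filter fun e => h e ∈ A ∧ t e ∉ A) (a := e)
        omega
      · rw [Finset.erase_eq_of_notMem (by simp [hin])]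
        exact hP.conn A hA hrA
  have hFin : ∀ A : Finset V, din t h (S \ F) (A \ U) = din t h S (A \ U) := by
    intro A
    unfold din
    congr 1
    ext e
    simp only [Finset.mem_filter, Finset.mem_sdiff]
    constructor
    · rintro ⟨⟨h1, h2⟩, h3⟩; exact ⟨h1, h3⟩
    · rintro ⟨h1, h3⟩; exact ⟨⟨h1, fun hh => h3.1.2 (hP.hU e hh)⟩, h3⟩
  by_cases hd : ∃ A : Finset V, r ∉ A ∧ (A \ U).Nonempty ∧ din t h (S \ F) A = M
  · obtain ⟨A, hA, hmin⟩ := Finset.exists_min_image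
      ((univ : Finset (Finset V)).filter fun A => r ∉ A ∧ (A \ U).Nonempty ∧ din t h (S \ F) A = M)
      Finset.card (by obtain ⟨A, hA⟩ := hd; exact ⟨A, by simpa using hA⟩)
    simp only [Finset.mem_filter, Finset.mem_univ, true_and] at hA hmin
    obtain ⟨hrA, hne, hdA⟩ := hA
    have h1 : M + 1 ≤ din t h (S \ F) (A \ U) := by
      rw [hFin]; exact hS _ hne (fun hh => hrA (Finset.mem_sdiff.1 hh).1)
    have h2 : ∃ e ∈ S \ F, (h e ∈ A \ U ∧ t e ∉ A \ U) ∧ ¬ (h e ∈ A ∧ t e ∉ A) := by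
      by_contra hno
      push Not at hno
      have : din t h (S \ F) (A \ U) ≤ din t h (S \ F) A := by
        apply Finset.card_le_card
        intro e he
        rw [Finset.mem_filter] at he ⊢
        exact ⟨he.1, hno e he.1 he.2⟩
      omega
    obtain ⟨e, he, ⟨h3, h4⟩, h5⟩ := h2
    simp only [Finset.mem_sdiff, not_and, not_not] at h3 h4 h5
    have h6 := h5 h3.1
    refine ⟨e, he, h4 h6, h3.2, ?_⟩
    intro B hrB hhB htB
    by_contra hlt
    have hB1 := hP.conn B ⟨_, hhB⟩ hrB
    have hBM : din t h (S \ F) B = M := by omega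
    have hsub := din_submod t h (S \ F) A B
    have hi := hP.conn (A ∩ B) ⟨h e, by simp [h3.1, hhB]⟩ (by simp [hrA])
    have hu := hP.conn (A ∪ B) ⟨h e, by simp [h3.1]⟩ (by simp [hrA, hrB])
    have hm := hmin (A ∩ B) ⟨by simp [hrA], ⟨h e, by simp [h3, hhB]⟩, by omega⟩
    have : (A ∩ B).card < A.card := by
      apply Finset.card_lt_card
      refine ⟨Finset.inter_subset_left, fun hh => htB ?_⟩
      exact (Finset.mem_inter.1 (hh h6)).2
    omega
  · push Not at hd
    have hne : (univ \ U).Nonempty := by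
      rw [Finset.sdiff_nonempty]
      intro hh; exact hU (Finset.Subset.antisymm (Finset.subset_univ _) hh)
    have h1 : M + 1 ≤ din t h (S \ F) (univ \ U) := by
      rw [hFin]; exact hS _ hne (by simp [hP.rU])
    obtain ⟨e, he⟩ : ((S \ F).filter fun e => h e ∈ univ \ U ∧ t e ∉ univ \ U).Nonempty := by
      rw [← Finset.card_pos]; unfold din at h1; omega
    simp only [Finset.mem_filter, Finset.mem_sdiff, Finset.mem_univ, true_and, not_not] at he
    refine ⟨e, by simp [he.1], he.2.2, he.2.1, ?_⟩
    intro B hrB hhB htB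
    have hB1 := hP.conn B ⟨_, hhB⟩ hrB
    have := hd B hrB ⟨h e, by simp [hhB, he.2.1]⟩
    omega

lemma grow (t h : E → V) (r : V) (M : ℕ) (S : Finset E)
    (hS : ∀ A : Finset V, A.Nonempty → r ∉ A → M + 1 ≤ din t h S A) :
    ∀ (n : ℕ) (U : Finset V) (F : Finset E), (univ \ U).card = n → PArb t h r M S U F →
      ∃ F', PArb t h r M S univ F' := by
  intro n
  induction n with
  | zero =>
    intro U F hn hP
    have : U = univ := by
      rw [Finset.card_eq_zero, Finset.sdiff_eq_empty_iff_subset] at hn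
      exact Finset.Subset.antisymm (Finset.subset_univ _) hn
    subst this
    exact ⟨F, hP⟩
  | succ n ih =>
    intro U F hn hP
    have hU : U ≠ univ := by rintro rfl; simp at hn
    obtain ⟨e, he, _, hhe, hP'⟩ := grow_step t h r M S hS hP hU
    refine ih _ _ ?_ hP'
    have : univ \ insert (h e) U = (univ \ U).erase (h e) := by
      ext x; simp
    rw [this, Finset.card_erase_of_mem (by simp [hhe]), hn]; rfl

theorem edmonds (t h : E → V) (r : V) : ∀ (M : ℕ) (S : Finset E),
    (∀ A : Finset V, A.Nonempty → r ∉ A → M ≤ din t h S A) →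
    ∃ F : Fin M → Finset E, (∀ i, F i ⊆ S ∧ Arb t h r (F i)) ∧ ∀ i j, i ≠ j → Disjoint (F i) (F j) := by
  intro M
  induction M with
  | zero => intro S _; exact ⟨fun i => i.elim0, fun i => i.elim0, fun i => i.elim0⟩
  | succ M ih =>
    intro S hS
    obtain ⟨F0, hF0⟩ := grow t h r M S hS _ {r} ∅ rfl ⟨by simp, by simp, by simp, by simp, by simp,
      by simp [Relation.ReflTransGen.refl], fun A hA hr => by
        have := hS A hA hr; simp; omega⟩
    obtain ⟨F, hF, hd⟩ := ih (S \ F0) hF0.conn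
    refine ⟨Fin.cons F0 F, ?_, ?_⟩
    · intro i
      refine Fin.cases ?_ ?_ i
      · exact ⟨by simpa using hF0.sub, by
          simpa using (⟨fun v hv => hF0.one v (by simp) hv, hF0.root, fun v => hF0.reach v (by simp)⟩ : Arb t h r F0)⟩
      · intro i
        simp only [Fin.cons_succ]
        exact ⟨(hF i).1.trans Finset.sdiff_subset, (hF i).2⟩
    · have hdis : ∀ i, Disjoint F0 (F i) := fun i =>
        Finset.disjoint_sdiff.mono_right (hF i).1
      intro i j
      refine Fin.cases ?_ ?_ i
      · refine Fin.cases ?_ ?_ j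
        · simp
        · intro j _; simpa using hdis j
      · intro i
        refine Fin.cases ?_ ?_ j
        · intro _; simpa using (hdis i).symm
        · intro j hij
          simp only [Fin.cons_succ]
          exact hd i j (fun hh => hij (by rw [hh]))

lemma Arb.card {t h : E → V} {r : V} {F : Finset E} (hF : Arb t h r F) : F.card + 1 = Fintype.card V := by
  have h1 : F.card = ∑ v : V, (F.filter fun e => h e = v).card :=
    Finset.card_eq_sum_card_fiberwise (fun _ _ => by simp)
  have h2 : ∀ v : V, (F.filter fun e => h e = v).card = if v = r then 0 else 1 := by
    intro v
    split_ifs with hv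
    · rw [hv]; exact hF.root
    · exact hF.one v hv
  rw [h1, Finset.sum_congr rfl (fun v _ => h2 v)]
  have h3 : ∑ v : V, (if v = r then 0 else 1) = (univ.erase r).card := by
    rw [← Finset.sum_erase_add univ _ (Finset.mem_univ r)]
    rw [Finset.sum_congr rfl (fun v hv => if_neg (Finset.ne_of_mem_erase hv))]
    simp
  rw [h3, Finset.card_erase_of_mem (by simp), Finset.card_univ]
  have : 0 < Fintype.card V := Fintype.card_pos_iff.2 ⟨r⟩
  omega

lemma Arb.tree {ends : E → V × V} {t h : E → V} {r : V} {F : Finset E} (hF : Arb t h r F)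
    (ho : ∀ e, ends e = (t e, h e) ∨ ends e = (h e, t e)) : IsSpanningTree ends F := by
  refine ⟨?_, hF.card⟩
  have sym : ∀ a b, (∃ e ∈ F, ends e = (a, b) ∨ ends e = (b, a)) → (∃ e ∈ F, ends e = (b, a) ∨ ends e = (a, b)) := by
    rintro a b ⟨e, he, hh⟩; exact ⟨e, he, hh.symm⟩
  have toR : ∀ v, Relation.ReflTransGen (fun a b => ∃ e ∈ F, ends e = (a, b) ∨ ends e = (b, a)) r v := by
    intro v
    refine rtg_mono ?_ (hF.reach v)
    rintro a b ⟨e, he, rfl, rfl⟩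
    exact ⟨e, he, ho e⟩
  intro u v
  refine Relation.ReflTransGen.trans ?_ (toR v)
  exact rtg_symm (fun a b hab => sym a b hab) (toR u)

lemma eIn_supermod (ends : E → V × V) (S : Finset E) (A B : Finset V) :
    eIn ends S A + eIn ends S B ≤ eIn ends S (A ∪ B) + eIn ends S (A ∩ B) := by
  unfold eIn
  simp only [Finset.card_filter, ← Finset.sum_add_distrib]
  apply Finset.sum_le_sum
  intro e _
  by_cases h1 : (ends e).1 ∈ A <;> by_cases h2 : (ends e).1 ∈ B <;> by_cases h3 : (ends e).2 ∈ A <;>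
    by_cases h4 : (ends e).2 ∈ B <;> simp [h1, h2, h3, h4]

def Sparse (ends : E → V × V) (c : ℕ) (S : Finset E) : Prop :=
  ∀ A : Finset V, A.Nonempty → eIn ends S A + c ≤ c * A.card

def Tight (ends : E → V × V) (c : ℕ) (S : Finset E) (A : Finset V) : Prop :=
  A.Nonempty ∧ eIn ends S A + c = c * A.card

lemma Tight.union {ends : E → V × V} {c : ℕ} {S : Finset E} (hS : Sparse ends c S) {A B : Finset V}
    (hA : Tight ends c S A) (hB : Tight ends c S B) (hAB : (A ∩ B).Nonempty) :
    Tight ends c S (A ∪ B) := by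
  refine ⟨hA.1.mono Finset.subset_union_left, ?_⟩
  have h1 := eIn_supermod ends S A B
  have h2 := hS _ hAB
  have h3 := hS (A ∪ B) (hA.1.mono Finset.subset_union_left)
  have h4 := Finset.card_union_add_card_inter A B
  have h5 := hA.2
  have h6 := hB.2
  have h7 : c * (A ∪ B).card + c * (A ∩ B).card = c * A.card + c * B.card := by
    rw [← mul_add, ← mul_add, h4]
  omega

lemma exists_max_tight {ends : E → V × V} {c : ℕ} {S : Finset E} (hS : Sparse ends c S) (v : V) :
    ∃ P : Finset V, v ∈ P ∧ Tight ends c S P ∧ ∀ A, Tight ends c S A → (A ∩ P).Nonempty → A ⊆ P := by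
  classical
  obtain ⟨P, hP, hmax⟩ := Finset.exists_max_image
    ((univ : Finset (Finset V)).filter fun A => v ∈ A ∧ Tight ends c S A) Finset.card
    ⟨{v}, by
      have := hS {v} (by simp)
      simp only [Finset.mem_filter, Finset.mem_univ, true_and, Finset.mem_singleton]
      refine ⟨by simp, ?_⟩
      simp only [Finset.card_singleton] at this ⊢; omega⟩
  simp only [Finset.mem_filter, Finset.mem_univ, true_and] at hP hmax
  refine ⟨P, hP.1, hP.2, ?_⟩
  intro A hA hne
  have h1 := hmax (A ∪ P) ⟨by simp [hP.1], Tight.union hS hA hP.2 hne⟩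
  have h2 : P = A ∪ P := Finset.eq_of_subset_of_card_le Finset.subset_union_right h1
  rw [h2]; exact Finset.subset_union_left

/-- number of edges of S crossing the partition into the fibres of π -/
def crs {W : Type*} [DecidableEq W] (ends : E → V × V) (S : Finset E) (π : V → W) : ℕ :=
  (S.filter fun e => π (ends e).1 ≠ π (ends e).2).card

lemma exists_full_sparse (ends : E → V × V) (c : ℕ) (B : Finset E) [Nonempty V]
    (hB : ∀ π : V → Finset V, c * ((univ.image π).card - 1) ≤ crs ends B π) :
    ∃ S ⊆ B, Sparse ends c S ∧ S.card + c = c * Fintype.card V := by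
  classical
  obtain ⟨S, hS, hmax⟩ := Finset.exists_max_image
    (B.powerset.filter fun S => Sparse ends c S) Finset.card
    ⟨∅, by
      simp only [Finset.mem_filter, Finset.mem_powerset, Finset.empty_subset, true_and]
      intro A hA
      have : 1 ≤ A.card := hA.card_pos
      simp [eIn]; nlinarith⟩
  simp only [Finset.mem_filter, Finset.mem_powerset] at hS hmax
  obtain ⟨hSB, hSp⟩ := hS
  refine ⟨S, hSB, hSp, ?_⟩
  choose P hvP hPt hPmax using fun v => exists_max_tight hSp v
  have hPeq : ∀ u v, u ∈ P v → P u = P v := by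
    intro u v huv
    apply Finset.Subset.antisymm
    · exact hPmax v _ (hPt u) ⟨u, by simp [hvP u, huv]⟩
    · exact hPmax u _ (hPt v) ⟨u, by simp [hvP u, huv]⟩
  have hcr : ∀ e ∈ B, P (ends e).1 ≠ P (ends e).2 → e ∈ S := by
    intro e he hne
    by_contra heS
    have hns : ¬ Sparse ends c (insert e S) := by
      intro hh
      have := hmax (insert e S) ⟨Finset.insert_subset he hSB, hh⟩
      rw [Finset.card_insert_of_notMem heS] at this
      omega
    unfold Sparse at hns
    push Not at hns
    obtain ⟨A, hA, hlt⟩ := hns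
    have h0 := hSp A hA
    unfold eIn at hlt
    rw [Finset.filter_insert] at hlt
    split_ifs at hlt with hin
    · rw [Finset.card_insert_of_notMem (by simp [heS])] at hlt
      have ht : Tight ends c S A := ⟨hA, by unfold eIn at h0 ⊢; omega⟩
      have hsub := hPmax (ends e).1 A ht ⟨(ends e).1, by simp [hin.1, hvP]⟩
      exact hne (hPeq _ _ (hsub hin.2)).symm
    · unfold eIn at h0; omega
  have hup := hSp univ Finset.univ_nonempty
  have huniv : eIn ends S univ = S.card := by simp [eIn]
  rw [huniv, Finset.card_univ] at hup
  have hcB := hB P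
  have hcS : crs ends B P = (S.filter fun e => P (ends e).1 ≠ P (ends e).2).card := by
    unfold crs; congr 1; ext e; simp only [Finset.mem_filter]
    exact ⟨fun h => ⟨hcr e h.1 h.2, h.2⟩, fun h => ⟨hSB h.1, h.2⟩⟩
  have hsplit := Finset.card_filter_add_card_filter_not (s := S) (fun e => P (ends e).1 = P (ends e).2)
  have hnc : (S.filter fun e => P (ends e).1 = P (ends e).2).card = ∑ Q ∈ univ.image P, eIn ends S Q := by
    rw [Finset.card_eq_sum_card_fiberwise (f := fun e => P (ends e).1) (t := univ.image P)
      (fun e _ => by simp)]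
    apply Finset.sum_congr rfl
    intro Q hQ
    obtain ⟨w, -, rfl⟩ := Finset.mem_image.1 hQ
    unfold eIn
    congr 1
    ext e
    simp only [Finset.mem_filter]
    constructor
    · rintro ⟨⟨h1, h2⟩, h3⟩
      refine ⟨h1, ?_, ?_⟩
      · rw [← h3]; exact hvP _
      · rw [← h3, h2]; exact hvP _
    · rintro ⟨h1, h2, h3⟩
      exact ⟨⟨h1, (hPeq _ _ h2).trans (hPeq _ _ h3).symm⟩, hPeq _ _ h2⟩
  have hsum : ∑ Q ∈ univ.image P, (eIn ends S Q + c) = c * Fintype.card V := by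
    have h1 : ∀ Q ∈ univ.image P, eIn ends S Q + c = c * (univ.filter fun v => P v = Q).card := by
      intro Q hQ
      obtain ⟨w, -, rfl⟩ := Finset.mem_image.1 hQ
      rw [(hPt w).2]
      congr 2
      ext v; simp only [Finset.mem_filter, Finset.mem_univ, true_and]
      exact ⟨fun h => hPeq _ _ h, fun h => h ▸ hvP v⟩
    rw [Finset.sum_congr rfl h1, ← Finset.mul_sum]
    rw [← Finset.card_eq_sum_card_fiberwise (f := P) (fun e _ => by simp), Finset.card_univ]
  rw [Finset.sum_add_distrib, Finset.sum_const, smul_eq_mul] at hsum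
  have hpos : 1 ≤ (univ.image P).card := by
    rw [Nat.one_le_iff_ne_zero, ← Nat.pos_iff_ne_zero, Finset.card_pos]
    exact Finset.univ_nonempty.image _
  have hmul : c * ((univ.image P).card - 1) + c = (univ.image P).card * c := by
    obtain ⟨j, hj⟩ := Nat.exists_eq_add_of_le hpos
    rw [hj]; simp; ring
  have : (S.filter fun e => ¬ P (ends e).1 = P (ends e).2).card = crs ends B P := hcS.symm
  omega

theorem nwt (ends : E → V × V) (c : ℕ) (B : Finset E) [Nonempty V]
    (hB : ∀ π : V → Finset V, c * ((univ.image π).card - 1) ≤ crs ends B π) :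
    TreeConnected ends c B := by
  classical
  obtain ⟨S, hSB, hSp, hcard⟩ := exists_full_sparse ends c B hB
  obtain ⟨r⟩ : Nonempty V := inferInstance
  have hall := (Finset.all_card_le_biUnion_card_iff_exists_injective
    (fun e : {e // e ∈ S} => (({(ends e.1).1, (ends e.1).2} : Finset V).erase r) ×ˢ (univ : Finset (Fin c)))).1 ?_
  · obtain ⟨g, hg, hmem⟩ := hall
    let h : E → V := fun e => if he : e ∈ S then (g ⟨e, he⟩).1 else (ends e).2
    let t : E → V := fun e => if h e = (ends e).2 then (ends e).1 else (ends e).2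
    have hS : ∀ e (he : e ∈ S), h e = (g ⟨e, he⟩).1 := fun e he => by simp [h, he]
    have hends : ∀ e, h e = (ends e).1 ∨ h e = (ends e).2 := by
      intro e
      by_cases he : e ∈ S
      · have := hmem ⟨e, he⟩
        rw [hS e he]
        simp at this
        tauto
      · right; simp [h, he]
    have ho : ∀ e, ends e = (t e, h e) ∨ ends e = (h e, t e) := by
      intro e
      by_cases h2 : h e = (ends e).2
      · left; simp [t, h2]
      · right
        rcases hends e with h1 | h1
        · ext <;> simp [t, h1.symm, h2]
        · exact absurd h1 h2
    have hr : ∀ e ∈ S, h e ≠ r := by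
      intro e he
      have := hmem ⟨e, he⟩
      rw [hS e he]
      simp at this
      tauto
    obtain ⟨F, hF, hd⟩ := edmonds t h r c S (by
      intro A hA hrA
      have h1 : (S.filter fun e => h e ∉ A).card ≤ ((univ \ A).erase r ×ˢ (univ : Finset (Fin c))).card := by
        have himg : (S.filter fun e => h e ∉ A) =
            ((univ : Finset {e // e ∈ S}).filter fun e => h e.1 ∉ A).image Subtype.val := by
          ext e; simp; tauto
        rw [himg, Finset.card_image_of_injective _ Subtype.val_injective]
        apply Finset.card_le_card_of_injOn g
        · rintro ⟨e, he⟩ hh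
          simp only [Finset.coe_filter, Finset.mem_univ, true_and, Set.mem_setOf_eq] at hh
          have h1 := hr e he
          rw [hS e he] at hh h1
          simp [hh, h1]
        · exact hg.injOn
      have h2 := Finset.card_filter_add_card_filter_not (s := S) (fun e => h e ∈ A)
      have h3 : (S.filter fun e => h e ∈ A).card = din t h S A + eIn ends S A := by
        unfold din eIn
        rw [← Finset.card_filter_add_card_filter_not (s := S.filter fun e => h e ∈ A) (fun e => t e ∉ A),
          Finset.filter_filter, Finset.filter_filter]
        congr 2
        ext e
        simp only [Finset.mem_filter]
        rcases ho e with h | h <;> rw [h] <;> simp; tauto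
      have h4 := hSp A hA
      have h5 : ((univ \ A).erase r).card + 1 + A.card = Fintype.card V := by
        rw [Finset.card_erase_add_one (by simp [hrA]), ← Finset.card_univ]
        exact Finset.card_sdiff_add_card_eq_card (Finset.subset_univ _)
      rw [Finset.card_product, Finset.card_univ (α := Fin c), Fintype.card_fin] at h1
      rw [← h5] at hcard
      have h6 : c * (((univ \ A).erase r).card + 1 + A.card) = ((univ \ A).erase r).card * c + c + c * A.card := by ring
      omega)
    exact ⟨F, fun i => ⟨(hF i).1.trans hSB, (hF i).2.tree ho⟩, hd⟩
  · intro s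
    rcases s.eq_empty_or_nonempty with rfl | hs
    · simp
    let U : Finset V := s.biUnion fun e => {(ends e.1).1, (ends e.1).2}
    have h1 : s.biUnion (fun e : {e // e ∈ S} => (({(ends e.1).1, (ends e.1).2} : Finset V).erase r) ×ˢ (univ : Finset (Fin c)))
        = (U.erase r) ×ˢ univ := by
      ext ⟨x, i⟩
      simp only [U, Finset.mem_biUnion, Finset.mem_product, Finset.mem_erase, Finset.mem_univ, and_true]
      constructor
      · rintro ⟨e, h1, h2, h3⟩; exact ⟨h2, e, h1, h3⟩
      · rintro ⟨h2, e, h1, h3⟩; exact ⟨e, h1, h2, h3⟩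
    rw [h1, Finset.card_product, Finset.card_univ, Fintype.card_fin]
    have hU : U.Nonempty := by
      obtain ⟨e, he⟩ := hs
      exact ⟨(ends e.1).1, by simp only [U, Finset.mem_biUnion]; exact ⟨e, he, by simp⟩⟩
    have h2 := hSp U hU
    have h3 : s.card ≤ eIn ends S U := by
      rw [← Finset.card_image_of_injective s Subtype.val_injective]
      apply Finset.card_le_card
      intro e he
      obtain ⟨e', he', rfl⟩ := Finset.mem_image.1 he
      simp only [Finset.mem_filter, U, Finset.mem_biUnion]
      exact ⟨e'.2, ⟨e', he', by simp⟩, ⟨e', he', by simp⟩⟩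
    have h4 : U.card ≤ (U.erase r).card + 1 := by
      have := Finset.pred_card_le_card_erase (s := U) (a := r); omega
    have h5 : c * U.card ≤ c * ((U.erase r).card + 1) := Nat.mul_le_mul_left _ h4
    have h6 : c * ((U.erase r).card + 1) = (U.erase r).card * c + c := by ring
    omega

lemma conn_cut {ends : E → V × V} {T : Finset E} (hT : MConnected ends T) {A : Finset V}
    (hA : A.Nonempty) (hA' : A ≠ univ) : (cutEdges ends T A).Nonempty := by
  obtain ⟨u, hu⟩ := hA
  obtain ⟨v, hv⟩ : ∃ v, v ∉ A := by
    by_contra hh; push Not at hh; exact hA' (Finset.eq_univ_iff_forall.2 hh)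
  by_contra hno
  rw [Finset.not_nonempty_iff_eq_empty] at hno
  have key : ∀ w, Relation.ReflTransGen (fun a b => ∃ e ∈ T, ends e = (a, b) ∨ ends e = (b, a)) u w → w ∈ A := by
    intro w hw
    induction hw with
    | refl => exact hu
    | tail _ h2 ih =>
      obtain ⟨e, he, hh⟩ := h2
      by_contra hc
      have : e ∈ cutEdges ends T A := by
        unfold cutEdges
        rw [Finset.mem_filter]
        refine ⟨he, ?_⟩
        rcases hh with hh | hh <;> rw [hh] <;> simp [ih, hc]
      rw [hno] at this
      simp at this
  exact hv (key v (hT u v))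

lemma cut_mono (ends : E → V × V) {S S' : Finset E} (h : S ⊆ S') (A : Finset V) :
    (cutEdges ends S A).card ≤ (cutEdges ends S' A).card :=
  Finset.card_le_card (Finset.filter_subset_filter _ h)

lemma fam_cut {ι : Type*} [DecidableEq ι] {ends : E → V × V} (T : ι → Finset E) (I : Finset ι) (W : Finset E)
    (hT : ∀ i ∈ I, MConnected ends (T i)) (hW : ∀ i ∈ I, T i ⊆ W)
    (hd : ∀ i ∈ I, ∀ j ∈ I, i ≠ j → Disjoint (T i) (T j)) {A : Finset V}
    (hA : A.Nonempty) (hA' : A ≠ univ) : I.card ≤ (cutEdges ends W A).card := by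
  have h1 : ∀ i : ι, i ∈ I → ∃ e, e ∈ cutEdges ends (T i) A := fun i hi => conn_cut (hT i hi) hA hA'
  calc I.card = ∑ i ∈ I, 1 := by simp
    _ ≤ ∑ i ∈ I, (cutEdges ends (T i) A).card :=
        Finset.sum_le_sum fun i hi => Finset.card_pos.2 (h1 i hi)
    _ = (I.biUnion fun i => cutEdges ends (T i) A).card := by
        rw [Finset.card_biUnion]
        intro i hi j hj hij
        exact Finset.disjoint_filter_filter (hd i hi j hj hij)
    _ ≤ _ := by
        apply Finset.card_le_card
        intro e he
        obtain ⟨i, hi, he⟩ := Finset.mem_biUnion.1 he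
        exact Finset.filter_subset_filter _ (hW i hi) he

lemma conn_crs {W : Type*} [DecidableEq W] {ends : E → V × V} {T : Finset E} (hT : MConnected ends T) (π : V → W) :
    (univ.image π).card ≤ crs ends T π + 1 := by
  have key : ∀ n, n ≤ (univ.image π).card → ∃ C ⊆ univ.image π, C.card = n ∧
      n ≤ ((T.filter fun e => π (ends e).1 ≠ π (ends e).2).filter
        fun e => π (ends e).1 ∈ C ∧ π (ends e).2 ∈ C).card + 1 := by
    intro n
    induction n with
    | zero => intro _; exact ⟨∅, by simp, by simp, by simp⟩
    | succ n ih =>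
      intro hn
      obtain ⟨C, hC, hCn, hc⟩ := ih (by omega)
      have hlt : C.card < (univ.image π).card := by omega
      obtain ⟨q, hq, hqC⟩ := Finset.exists_mem_notMem_of_card_lt_card hlt
      rcases Nat.eq_zero_or_pos n with rfl | hpos
      · exact ⟨{q}, by simpa using hq, by simp, by omega⟩
      have hA : (univ.filter fun v => π v ∈ C).Nonempty := by
        obtain ⟨p, hp⟩ : C.Nonempty := by rw [← Finset.card_pos]; omega
        obtain ⟨v, -, hv⟩ := Finset.mem_image.1 (hC hp)
        exact ⟨v, by simp [hv, hp]⟩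
      have hA' : (univ.filter fun v => π v ∈ C) ≠ univ := by
        obtain ⟨v, -, hv⟩ := Finset.mem_image.1 hq
        intro hh
        have : v ∈ (univ.filter fun v => π v ∈ C) := by rw [hh]; simp
        simp [hv, hqC] at this
      obtain ⟨e, he⟩ := conn_cut hT hA hA'
      simp only [cutEdges, Finset.mem_filter, Finset.mem_univ, true_and] at he
      have step : ∀ x, x ∉ C → x ∈ univ.image π → (π (ends e).1 = x ∧ π (ends e).2 ∈ C ∨ π (ends e).2 = x ∧ π (ends e).1 ∈ C) →
        ∃ C ⊆ univ.image π, C.card = n + 1 ∧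
      n + 1 ≤ ((T.filter fun e => π (ends e).1 ≠ π (ends e).2).filter
        fun e => π (ends e).1 ∈ C ∧ π (ends e).2 ∈ C).card + 1 := by
        intro x hx hx' hxe
        refine ⟨insert x C, Finset.insert_subset hx' hC, by rw [Finset.card_insert_of_notMem hx, hCn], ?_⟩
        have hne : e ∉ ((T.filter fun e => π (ends e).1 ≠ π (ends e).2).filter
            fun e => π (ends e).1 ∈ C ∧ π (ends e).2 ∈ C) := by
          simp only [Finset.mem_filter]
          rintro ⟨-, h1, h2⟩
          rcases hxe with h | h
          · exact hx (h.1 ▸ h1)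
          · exact hx (h.1 ▸ h2)
        have := Finset.card_insert_of_notMem hne
        have h2 : (insert e ((T.filter fun e => π (ends e).1 ≠ π (ends e).2).filter
            fun e => π (ends e).1 ∈ C ∧ π (ends e).2 ∈ C)).card ≤ ((T.filter fun e => π (ends e).1 ≠ π (ends e).2).filter
            fun e => π (ends e).1 ∈ insert x C ∧ π (ends e).2 ∈ insert x C).card := by
          apply Finset.card_le_card
          intro e' he'
          rw [Finset.mem_insert] at he'
          rcases he' with rfl | he'
          · simp only [Finset.mem_filter, Finset.mem_insert]
            refine ⟨⟨he.1, ?_⟩, ?_⟩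
            · intro hh; apply he.2; rw [hh]
            · tauto
          · simp only [Finset.mem_filter, Finset.mem_insert] at he' ⊢
            tauto
        omega
      by_cases h1 : π (ends e).1 ∈ C
      · exact step (π (ends e).2) (by tauto) (by simp) (by tauto)
      · exact step (π (ends e).1) (by tauto) (by simp) (by tauto)
  obtain ⟨C, -, -, hc⟩ := key _ le_rfl
  refine hc.trans ?_
  gcongr
  exact Finset.card_le_card (Finset.filter_subset _ _)

lemma fam_crs {ι : Type*} [DecidableEq ι] {W : Type*} [DecidableEq W] {ends : E → V × V} (T : ι → Finset E) (I : Finset ι)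
    (hT : ∀ i ∈ I, MConnected ends (T i))
    (hd : ∀ i ∈ I, ∀ j ∈ I, i ≠ j → Disjoint (T i) (T j)) (π : V → W) :
    I.card * ((univ.image π).card - 1) ≤ crs ends (I.biUnion T) π := by
  calc I.card * ((univ.image π).card - 1) = ∑ i ∈ I, ((univ.image π).card - 1) := by simp
    _ ≤ ∑ i ∈ I, crs ends (T i) π :=
        Finset.sum_le_sum fun i hi => by have := conn_crs (hT i hi) π; omega
    _ = (I.biUnion fun i => (T i).filter fun e => π (ends e).1 ≠ π (ends e).2).card := by
        rw [Finset.card_biUnion]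
        · rfl
        intro i hi j hj hij
        exact Finset.disjoint_filter_filter (hd i hi j hj hij)
    _ ≤ _ := by
        apply Finset.card_le_card
        rw [Finset.filter_biUnion]

lemma max_cut (ends : E → V × V) (S : Finset E) : ∃ X : Finset V, ∀ A : Finset V,
    (cutEdges ends S A).card ≤ 2 * (cutEdges ends (cutEdges ends S X) A).card := by
  obtain ⟨X, -, hmax⟩ := Finset.exists_max_image (univ : Finset (Finset V)) (fun X => (cutEdges ends S X).card) ⟨∅, by simp⟩
  refine ⟨X, fun A => ?_⟩
  have h := hmax (symmDiff X A) (by simp)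
  simp only [cutEdges, Finset.filter_filter, Finset.card_filter, Finset.mul_sum] at h ⊢
  have : ∀ e ∈ S, (if ¬((ends e).1 ∈ A ↔ (ends e).2 ∈ A) then 1 else 0) + (if ¬((ends e).1 ∈ X ↔ (ends e).2 ∈ X) then 1 else 0)
      = 2 * (if ¬((ends e).1 ∈ X ↔ (ends e).2 ∈ X) ∧ ¬((ends e).1 ∈ A ↔ (ends e).2 ∈ A) then 1 else 0)
       + (if ¬((ends e).1 ∈ symmDiff X A ↔ (ends e).2 ∈ symmDiff X A) then 1 else 0) := by
    intro e _
    by_cases h1 : (ends e).1 ∈ A <;> by_cases h2 : (ends e).1 ∈ X <;> by_cases h3 : (ends e).2 ∈ A <;>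
    by_cases h4 : (ends e).2 ∈ X <;> simp [h1, h2, h3, h4, Finset.mem_symmDiff]
  have h2 := Finset.sum_congr rfl this
  rw [Finset.sum_add_distrib, Finset.sum_add_distrib] at h2
  omega

lemma sum_cut {W : Type*} [DecidableEq W] (ends : E → V × V) (S : Finset E) (π : V → W) :
    ∑ q ∈ univ.image π, (cutEdges ends S (univ.filter fun v => π v = q)).card = 2 * crs ends S π := by
  simp only [cutEdges, crs, Finset.card_filter, Finset.mul_sum]
  rw [Finset.sum_comm]
  apply Finset.sum_congr rfl
  intro e _
  simp only [Finset.mem_filter, Finset.mem_univ, true_and]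
  by_cases h : π (ends e).1 = π (ends e).2
  · simp [h]
  · have : ∀ q ∈ univ.image π, (if ¬(π (ends e).1 = q ↔ π (ends e).2 = q) then 1 else 0)
      = (if π (ends e).1 = q then 1 else 0) + (if π (ends e).2 = q then 1 else 0) := by
      intro q _
      by_cases h1 : π (ends e).1 = q <;> by_cases h2 : π (ends e).2 = q <;> simp [h1, h2]
      exact h (h1.trans h2.symm)
    rw [Finset.sum_congr rfl this, Finset.sum_add_distrib]
    simp [h]

lemma split_trees {ends : E → V × V} {n : ℕ} {B : Finset E} (h : TreeConnected ends (n + 1) B) :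
    ∃ Ts R : Finset E, Ts ⊆ B ∧ R ⊆ B ∧ Disjoint Ts R ∧ MConnected ends Ts ∧
      ∀ A : Finset V, A.Nonempty → A ≠ univ → n ≤ (cutEdges ends R A).card := by
  obtain ⟨T, hT, hd⟩ := h
  refine ⟨T 0, (univ.erase 0).biUnion T, (hT 0).1, ?_, ?_, (hT 0).2.1, ?_⟩
  · intro e he
    obtain ⟨i, -, he⟩ := Finset.mem_biUnion.1 he
    exact (hT i).1 he
  · rw [Finset.disjoint_biUnion_right]
    intro i hi
    exact hd 0 i (Finset.ne_of_mem_erase hi).symm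
  · intro A hA hA'
    have := fam_cut T (univ.erase 0) ((univ.erase 0).biUnion T) (fun i _ => (hT i).2.1)
      (fun i hi => Finset.subset_biUnion_of_mem T hi) (fun i _ j _ => hd i j) hA hA'
    rwa [Finset.card_erase_of_mem (by simp), Finset.card_univ, Fintype.card_fin] at this

lemma hit_card {ι : Type*} [DecidableEq ι] (T : ι → Finset E) (I : Finset ι) (J : Finset E)
    (hd : ∀ i ∈ I, ∀ j ∈ I, i ≠ j → Disjoint (T i) (T j)) :
    (I.filter fun i => ¬ Disjoint (T i) J).card ≤ J.card := by
  calc (I.filter fun i => ¬ Disjoint (T i) J).card = ∑ i ∈ (I.filter fun i => ¬ Disjoint (T i) J), 1 := by simp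
    _ ≤ ∑ i ∈ (I.filter fun i => ¬ Disjoint (T i) J), (T i ∩ J).card :=
        Finset.sum_le_sum fun i hi => by
          have := (Finset.mem_filter.1 hi).2
          rw [Finset.not_disjoint_iff_nonempty_inter] at this
          exact this.card_pos
    _ = ((I.filter fun i => ¬ Disjoint (T i) J).biUnion fun i => T i ∩ J).card := by
        rw [Finset.card_biUnion]
        intro i hi j hj hij
        exact (hd i (Finset.mem_filter.1 hi).1 j (Finset.mem_filter.1 hj).1 hij).mono
          Finset.inter_subset_left Finset.inter_subset_left
    _ ≤ _ := by
        apply Finset.card_le_card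
        intro e he
        obtain ⟨i, hi, he⟩ := Finset.mem_biUnion.1 he
        exact (Finset.mem_inter.1 he).2

theorem choice_sets [Fintype E] [Nonempty V] (ends : E → V × V) (k N : ℕ) (hk : 2 ≤ k)
    (hG : TreeConnected ends (N + (6 * k - 4)) (univ : Finset E)) :
    ∃ (X : Finset V) (J Ts R : Finset E),
      (∀ e ∈ J, ((ends e).1 ∈ X ↔ (ends e).2 ∈ X)) ∧ J.card ≤ k - 1 ∧
      (J.card = k - 1 ∨ ∀ e, ((ends e).1 ∈ X ↔ (ends e).2 ∈ X) → e ∈ J) ∧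
      (∀ e ∈ Ts, ¬ ((ends e).1 ∈ X ↔ (ends e).2 ∈ X)) ∧
      (∀ e ∈ R, ¬ ((ends e).1 ∈ X ↔ (ends e).2 ∈ X)) ∧
      Disjoint Ts R ∧ MConnected ends Ts ∧
      (∀ A : Finset V, A.Nonempty → A ≠ univ → 3 * k - 3 ≤ (cutEdges ends R A).card) ∧
      (∀ A : Finset V, A.Nonempty → A ≠ univ → N ≤ (cutEdges ends (univ \ (J ∪ R ∪ Ts)) A).card) := by
  obtain ⟨T, hT, hd⟩ := hG
  have hk3 : 3 * k - 2 = (3 * k - 3) + 1 := by omega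
  obtain ⟨I2, hI2⟩ : ∃ I2 : Finset (Fin (N + (6 * k - 4))), I2.card = 6 * k - 4 := by
    obtain ⟨I, -, h⟩ := Finset.exists_subset_card_eq (s := (univ : Finset (Fin (N + (6 * k - 4))))) (n := 6 * k - 4)
      (by simp)
    exact ⟨I, h⟩
  have hI2c : (univ \ I2).card = N := by
    rw [Finset.card_sdiff_of_subset (Finset.subset_univ _), Finset.card_univ, Fintype.card_fin, hI2]; omega
  set G2 := I2.biUnion T with hG2
  obtain ⟨X, hX⟩ := max_cut ends G2
  by_cases hin : k - 1 ≤ (G2.filter fun e => ((ends e).1 ∈ X ↔ (ends e).2 ∈ X)).card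
  · obtain ⟨J, hJ, hJc⟩ := Finset.exists_subset_card_eq hin
    have htc : TreeConnected ends (3 * k - 2) (cutEdges ends G2 X) := by
      apply nwt
      intro π
      have h1 := fam_crs T I2 (fun i _ => (hT i).2.1) (fun i _ j _ => hd i j) π
      have h2 := sum_cut ends G2 π
      have h3 := sum_cut ends (cutEdges ends G2 X) π
      have h4 : ∑ q ∈ univ.image π, (cutEdges ends G2 (univ.filter fun v => π v = q)).card
        ≤ ∑ q ∈ univ.image π, 2 * (cutEdges ends (cutEdges ends G2 X) (univ.filter fun v => π v = q)).card :=
        Finset.sum_le_sum fun q _ => hX _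
      rw [← Finset.mul_sum, h2, h3] at h4
      have h5 : I2.card = 2 * (3 * k - 2) := by omega
      rw [h5, mul_assoc, ← hG2] at h1
      omega
    rw [hk3] at htc
    obtain ⟨Ts, R, hTs, hR, hdis, hconn, hRc⟩ := split_trees htc
    refine ⟨X, J, Ts, R, fun e he => (Finset.mem_filter.1 (hJ he)).2, hJc.le, Or.inl hJc,
      fun e he => (Finset.mem_filter.1 (hTs he)).2, fun e he => (Finset.mem_filter.1 (hR he)).2, hdis, hconn, hRc, ?_⟩
    intro A hA hA'
    rw [← hI2c]
    refine fam_cut T (univ \ I2) _ (fun i _ => (hT i).2.1) ?_ (fun i _ j _ => hd i j) hA hA'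
    intro i hi e he
    rw [Finset.mem_sdiff]
    refine ⟨by simp, fun hh => ?_⟩
    have : e ∈ G2 := by
      rw [Finset.mem_union, Finset.mem_union] at hh
      rcases hh with (hh | hh) | hh
      · exact (Finset.mem_filter.1 (hJ hh)).1
      · exact (Finset.mem_filter.1 (hR hh)).1
      · exact (Finset.mem_filter.1 (hTs hh)).1
    obtain ⟨j, hj, he'⟩ := Finset.mem_biUnion.1 this
    have hij : i ≠ j := by rintro rfl; exact (Finset.mem_sdiff.1 hi).2 hj
    exact Finset.disjoint_left.1 (hd i j hij) he he'
  · push Not at hin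
    have h1 := hit_card T I2 (G2.filter fun e => ((ends e).1 ∈ X ↔ (ends e).2 ∈ X)) (fun i _ j _ => hd i j)
    have h2 := Finset.card_filter_add_card_filter_not (s := I2)
      (fun i => Disjoint (T i) (G2.filter fun e => ((ends e).1 ∈ X ↔ (ends e).2 ∈ X)))
    obtain ⟨I3, hI3, hI3c⟩ := Finset.exists_subset_card_eq (n := 3 * k - 2)
      (s := I2.filter fun i => Disjoint (T i) (G2.filter fun e => ((ends e).1 ∈ X ↔ (ends e).2 ∈ X))) (by omega)
    have htc : TreeConnected ends (3 * k - 2) (I3.biUnion T) := by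
      refine ⟨fun j => T (I3.orderEmbOfFin hI3c j), fun j => ⟨?_, (hT _).2⟩, fun i j hij => hd _ _ ?_⟩
      · exact Finset.subset_biUnion_of_mem T (Finset.orderEmbOfFin_mem _ _ _)
      · intro hh; exact hij ((I3.orderEmbOfFin hI3c).injective hh)
    have hcut : ∀ e ∈ I3.biUnion T, ¬ ((ends e).1 ∈ X ↔ (ends e).2 ∈ X) := by
      intro e he hh
      obtain ⟨i, hi, he⟩ := Finset.mem_biUnion.1 he
      have := Finset.mem_filter.1 (hI3 hi)
      exact Finset.disjoint_left.1 this.2 he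
        (Finset.mem_filter.2 ⟨Finset.mem_biUnion.2 ⟨i, this.1, he⟩, hh⟩)
    rw [hk3] at htc
    obtain ⟨Ts, R, hTs, hR, hdis, hconn, hRc⟩ := split_trees htc
    obtain ⟨J, hJ1, hJ2, hJ3⟩ : ∃ J : Finset E, (∀ e ∈ J, ((ends e).1 ∈ X ↔ (ends e).2 ∈ X)) ∧ J.card ≤ k - 1 ∧
      (J.card = k - 1 ∨ ∀ e, ((ends e).1 ∈ X ↔ (ends e).2 ∈ X) → e ∈ J) := by
      by_cases hin2 : k - 1 ≤ ((univ : Finset E).filter fun e => ((ends e).1 ∈ X ↔ (ends e).2 ∈ X)).card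
      · obtain ⟨J, hJ, hJc⟩ := Finset.exists_subset_card_eq hin2
        exact ⟨J, fun e he => (Finset.mem_filter.1 (hJ he)).2, hJc.le, Or.inl hJc⟩
      · exact ⟨(univ : Finset E).filter fun e => ((ends e).1 ∈ X ↔ (ends e).2 ∈ X),
          fun e he => (Finset.mem_filter.1 he).2, by omega, Or.inr fun e he => by simp [he]⟩
    refine ⟨X, J, Ts, R, hJ1, hJ2, hJ3, fun e he => hcut e (hTs he), fun e he => hcut e (hR he), hdis, hconn, hRc, ?_⟩
    intro A hA hA'
    have h3 := hit_card T (univ \ I3) J (fun i _ j _ => hd i j)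
    have h4 := Finset.card_filter_add_card_filter_not (s := univ \ I3) (fun i => Disjoint (T i) J)
    have h5 : (univ \ I3).card = N + (6 * k - 4) - (3 * k - 2) := by
      rw [Finset.card_sdiff_of_subset (Finset.subset_univ _), Finset.card_univ, Fintype.card_fin, hI3c]
    have h6 := fam_cut T ((univ \ I3).filter fun i => Disjoint (T i) J) (univ \ (J ∪ R ∪ Ts))
      (fun i _ => (hT i).2.1) ?_ (fun i _ j _ => hd i j) hA hA'
    · omega
    · intro i hi e he
      rw [Finset.mem_filter, Finset.mem_sdiff] at hi
      rw [Finset.mem_sdiff]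
      refine ⟨by simp, fun hh => ?_⟩
      rw [Finset.mem_union, Finset.mem_union] at hh
      have h7 : e ∉ I3.biUnion T := by
        intro hh
        obtain ⟨j, hj, he'⟩ := Finset.mem_biUnion.1 hh
        have hij : i ≠ j := by rintro rfl; exact hi.1.2 hj
        exact Finset.disjoint_left.1 (hd i j hij) he he'
      rcases hh with (hh | hh) | hh
      · exact Finset.disjoint_left.1 hi.2 he hh
      · exact h7 (hR hh)
      · exact h7 (hTs hh)

lemma sum_symmDiff2 (A B : Finset E) (g : E → ZMod 2) :
    ∑ e ∈ symmDiff A B, g e = ∑ e ∈ A, g e + ∑ e ∈ B, g e := by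
  have h1 : symmDiff A B = (A \ B) ∪ (B \ A) := rfl
  rw [h1, Finset.sum_union (disjoint_sdiff_sdiff)]
  rw [← Finset.sum_sdiff (Finset.inter_subset_left : A ∩ B ⊆ A), ← Finset.sum_sdiff (Finset.inter_subset_right : A ∩ B ⊆ B)]
  have h2 : A \ (A ∩ B) = A \ B := by ext; simp
  have h3 : B \ (A ∩ B) = B \ A := by ext; simp
  rw [h2, h3]
  have := CharTwo.add_self_eq_zero (∑ e ∈ A ∩ B, g e)
  linear_combination -this

lemma mdeg_symmDiff (ends : E → V × V) (A B : Finset E) (w : V) :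
    (mdeg ends (symmDiff A B) w : ZMod 2) = mdeg ends A w + mdeg ends B w := by
  unfold mdeg
  push_cast
  exact sum_symmDiff2 A B _

lemma path_par {ends : E → V × V} {T : Finset E} (u v : V)
    (h : Relation.ReflTransGen (fun a b => ∃ e ∈ T, ends e = (a, b) ∨ ends e = (b, a)) u v) :
    ∃ P ⊆ T, ∀ w, (mdeg ends P w : ZMod 2) = (if w = u then 1 else 0) + (if w = v then 1 else 0) := by
  induction h with
  | refl => exact ⟨∅, by simp, fun w => by simp [mdeg, CharTwo.add_self_eq_zero]⟩
  | @tail b c _ h2 ih =>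
    obtain ⟨P, hP, hw⟩ := ih
    obtain ⟨e, he, hh⟩ := h2
    refine ⟨symmDiff P {e}, ?_, ?_⟩
    · intro x hx
      rw [Finset.mem_symmDiff] at hx
      rcases hx with hx | hx
      · exact hP hx.1
      · rw [Finset.mem_singleton.1 hx.1]; exact he
    · intro w
      rw [mdeg_symmDiff, hw]
      have h3 : (mdeg ends {e} w : ZMod 2) = (if w = b then 1 else 0) + (if w = c then 1 else 0) := by
        unfold mdeg
        rw [Finset.sum_singleton]
        rcases hh with hh | hh <;> rw [hh] <;> push_cast <;> simp only [eq_comm]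
        rw [add_comm]
      rw [h3]
      have := CharTwo.add_self_eq_zero (if w = b then 1 else 0 : ZMod 2)
      linear_combination this

lemma tjoin {ends : E → V × V} {T : Finset E} (hT : MConnected ends T) (D : V → ℕ)
    (hD : Even (∑ v, D v)) [Nonempty V] : ∃ J ⊆ T, ∀ v, Even (D v + mdeg ends J v) := by
  obtain ⟨r⟩ : Nonempty V := inferInstance
  have key : ∀ A : Finset V, ∃ P ⊆ T, ∀ w, (mdeg ends P w : ZMod 2) =
      ∑ v ∈ A, (D v : ZMod 2) * ((if w = r then 1 else 0) + (if w = v then 1 else 0)) := by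
    intro A
    induction A using Finset.induction_on with
    | empty => exact ⟨∅, by simp, fun w => by simp [mdeg]⟩
    | insert v A hv ih =>
      obtain ⟨P, hP, hw⟩ := ih
      rcases (show ∀ x : ZMod 2, x = 0 ∨ x = 1 by decide) (D v : ZMod 2) with h0 | h1
      · exact ⟨P, hP, fun w => by rw [Finset.sum_insert hv, h0, hw]; simp⟩
      · obtain ⟨Q, hQ, hq⟩ := path_par r v (hT r v)
        refine ⟨symmDiff Q P, ?_, ?_⟩
        · intro x hx
          rw [Finset.mem_symmDiff] at hx
          rcases hx with hx | hx
          · exact hQ hx.1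
          · exact hP hx.1
        · intro w
          rw [mdeg_symmDiff, Finset.sum_insert hv, h1, hw, hq, one_mul]
  obtain ⟨P, hP, hw⟩ := key univ
  refine ⟨P, hP, fun v => ?_⟩
  rw [← ZMod.natCast_eq_zero_iff_even]
  push_cast
  rw [hw]
  simp only [mul_add, Finset.sum_add_distrib, ← Finset.sum_mul]
  have h2 : (∑ x, (D x : ZMod 2)) = 0 := by
    rw [← ZMod.natCast_eq_zero_iff_even] at hD
    rw [← hD]; push_cast; rfl
  rw [h2]
  simp [CharTwo.add_self_eq_zero]

lemma mdeg_insert (ends : E → V × V) {S : Finset E} {e : E} (he : e ∉ S) (v : V) :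
    mdeg ends (insert e S) v = ((if (ends e).1 = v then 1 else 0) + (if (ends e).2 = v then 1 else 0)) + mdeg ends S v := by
  unfold mdeg; rw [Finset.sum_insert he]

def Ori (ends : E → V × V) (t h : E → V) : Prop := ∀ e, ends e = (t e, h e) ∨ ends e = (h e, t e)

lemma euler : ∀ (n : ℕ) (ends : E → V × V) (S : Finset E), S.card = n → (∀ v, Even (mdeg ends S v)) →
    ∃ t h : E → V, Ori ends t h ∧
      ∀ w, ∑ e ∈ S, ((if t e = w then 1 else 0) - (if h e = w then 1 else 0) : ℤ) = 0 := by
  intro n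
  induction n with
  | zero =>
    intro ends S hS _
    rw [Finset.card_eq_zero] at hS
    subst hS
    exact ⟨fun e => (ends e).1, fun e => (ends e).2, fun e => Or.inl rfl, by simp⟩
  | succ n ih =>
    intro ends S hS hev
    obtain ⟨e1, he1⟩ : S.Nonempty := by rw [← Finset.card_pos]; omega
    obtain ⟨S', hS', rfl⟩ : ∃ S', e1 ∉ S' ∧ S = insert e1 S' :=
      ⟨S.erase e1, by simp, (Finset.insert_erase he1).symm⟩
    have hcard : S'.card = n := by rw [Finset.card_insert_of_notMem hS'] at hS; omega
    obtain ⟨u, v, huv⟩ : ∃ u v, ends e1 = (u, v) := ⟨_, _, rfl⟩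
    by_cases hl : u = v
    · subst hl
      obtain ⟨t, h, ho, hb⟩ := ih ends S' hcard (by
        intro w
        have := hev w
        rw [mdeg_insert _ hS', huv] at this
        by_cases hw : u = w
        · simp only [hw, if_true] at this
          rw [Nat.even_iff] at this ⊢; omega
        · simpa [hw] using this)
      refine ⟨t, h, ho, fun w => ?_⟩
      rw [Finset.sum_insert hS', hb]
      have : t e1 = h e1 := by
        rcases ho e1 with hh | hh <;> rw [huv] at hh <;> simp at hh <;> rw [← hh.1, ← hh.2]
      simp [this]
    · obtain ⟨e2, he2, hve2⟩ : ∃ e2 ∈ S', (ends e2).1 = v ∨ (ends e2).2 = v := by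
        by_contra hno
        push Not at hno
        have h1 := hev v
        rw [mdeg_insert _ hS', huv] at h1
        have h2 : mdeg ends S' v = 0 := by
          unfold mdeg
          apply Finset.sum_eq_zero
          intro e he
          simp [hno e he]
        rw [h2] at h1
        simp [hl] at h1
      obtain ⟨x, hx⟩ : ∃ x, ends e2 = (v, x) ∨ ends e2 = (x, v) := by
        rcases hve2 with hh | hh
        · exact ⟨(ends e2).2, Or.inl (by rw [← hh])⟩
        · exact ⟨(ends e2).1, Or.inr (by rw [← hh])⟩
      have hne : e1 ≠ e2 := by rintro rfl; exact hS' he2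
      obtain ⟨S'', hS'', rfl⟩ : ∃ S'', e2 ∉ S'' ∧ S' = insert e2 S'' :=
        ⟨S'.erase e2, by simp, (Finset.insert_erase he2).symm⟩
      have he1'' : e1 ∉ S'' := fun hh => hS' (by simp [hh])
      have hupd : ∀ e ∈ S'', Function.update ends e2 (u, x) e = ends e := by
        intro e he
        rw [Function.update_of_ne]; rintro rfl; exact hS'' he
      obtain ⟨t, h, ho, hb⟩ := ih (Function.update ends e2 (u, x)) (insert e2 S'') hcard (by
        intro w
        have := hev w
        rw [mdeg_insert _ hS', mdeg_insert _ hS'', huv] at this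
        rw [mdeg_insert _ hS'']
        have h3 : mdeg (Function.update ends e2 (u, x)) S'' w = mdeg ends S'' w := by
          unfold mdeg
          apply Finset.sum_congr rfl
          intro e he; rw [hupd e he]
        rw [h3, Function.update_self]
        rw [Nat.even_iff] at this ⊢
        rcases hx with hx | hx <;> rw [hx] at this <;> dsimp only at this ⊢ <;> split_ifs at this ⊢ <;> omega)
      have ho2 := ho e2
      rw [Function.update_self] at ho2
      have hoo : ∀ e, e ≠ e2 → (ends e = (t e, h e) ∨ ends e = (h e, t e)) := by
        intro e he
        have := ho e
        rwa [Function.update_of_ne he] at this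
      -- general finishing
      have fin : ∀ p1 p2 q1 q2 : V, (ends e1 = (p1, q1) ∨ ends e1 = (q1, p1)) → (ends e2 = (p2, q2) ∨ ends e2 = (q2, p2)) →
          (∀ w, ((if p1 = w then 1 else 0) - (if q1 = w then 1 else 0) : ℤ) + ((if p2 = w then 1 else 0) - (if q2 = w then 1 else 0))
            = (if t e2 = w then 1 else 0) - (if h e2 = w then 1 else 0)) →
          ∃ t h : E → V, Ori ends t h ∧
            ∀ w, ∑ e ∈ insert e1 (insert e2 S''), ((if t e = w then 1 else 0) - (if h e = w then 1 else 0) : ℤ) = 0 := by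
        intro p1 p2 q1 q2 hp1 hp2 heq
        refine ⟨fun e => if e = e1 then p1 else if e = e2 then p2 else t e,
          fun e => if e = e1 then q1 else if e = e2 then q2 else h e, ?_, ?_⟩
        · intro e
          by_cases h1 : e = e1
          · subst h1; simpa using hp1
          · by_cases h2 : e = e2
            · subst h2; simpa [h1] using hp2
            · simpa [h1, h2] using hoo e h2
        · intro w
          have h4 := hb w
          rw [Finset.sum_insert hS''] at h4
          rw [Finset.sum_insert hS', Finset.sum_insert hS'']
          have h5 : ∀ e ∈ S'', e ≠ e1 ∧ e ≠ e2 := by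
            intro e he
            exact ⟨by rintro rfl; exact he1'' he, by rintro rfl; exact hS'' he⟩
          rw [Finset.sum_congr rfl (fun e he => by
            simp [(h5 e he).1, (h5 e he).2] :
            ∀ e ∈ S'', _ = ((if t e = w then 1 else 0) - (if h e = w then 1 else 0) : ℤ))]
          simp only [if_true, hne.symm, if_false]
          linear_combination h4 + heq w
      rcases ho2 with hh | hh
      · simp only [Prod.mk.injEq] at hh
        refine fin u v v x (Or.inl huv) hx ?_
        intro w; rw [← hh.1, ← hh.2]; ring
      · simp only [Prod.mk.injEq] at hh
        refine fin v x u v (Or.inr huv) hx.symm ?_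
        intro w; rw [← hh.1, ← hh.2]; ring

lemma alt_signs (U : Finset E) (s : ℤ) (hs : s = 1 ∨ s = -1) :
    ∃ c : E → ℤ, (∀ e, c e = 1 ∨ c e = -1) ∧ (∑ e ∈ U, c e = 0 ∨ ∑ e ∈ U, c e = s) := by
  induction U using Finset.induction_on with
  | empty => exact ⟨fun _ => 1, fun _ => Or.inl rfl, Or.inl (by simp)⟩
  | insert e U he ih =>
    obtain ⟨c, hc, hsum⟩ := ih
    have aux : ∀ x : ℤ, ∑ e' ∈ insert e U, Function.update c e x e' = x + ∑ e' ∈ U, c e' := by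
      intro x
      rw [Finset.sum_insert he, Function.update_self]
      congr 1
      apply Finset.sum_congr rfl
      intro e' he'
      rw [Function.update_of_ne]; rintro rfl; exact he he'
    have aux2 : ∀ x : ℤ, (x = 1 ∨ x = -1) → ∀ e', Function.update c e x e' = 1 ∨ Function.update c e x e' = -1 := by
      intro x hx e'
      by_cases h : e' = e
      · subst h; simpa using hx
      · rw [Function.update_of_ne h]; exact hc e'
    rcases hsum with h | h
    · exact ⟨Function.update c e s, aux2 s hs, Or.inr (by rw [aux, h]; ring)⟩
    · exact ⟨Function.update c e (-s), aux2 (-s) (by omega), Or.inl (by rw [aux, h]; ring)⟩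

def one (a b : V) : ℤ := if a = b then 1 else 0

lemma one_nonneg (a b : V) : 0 ≤ one a b := by unfold one; split_ifs <;> simp
lemma one_le (a b : V) : one a b ≤ 1 := by unfold one; split_ifs <;> simp
lemma one_self (a : V) : one a a = 1 := by simp [one]
lemma one_ne {a b : V} (h : a ≠ b) : one a b = 0 := by simp [one, h]

lemma colour (t h : E → V) (r : V) (M s : ℤ) (hM : 1 ≤ M) (hs : s = 1 ∨ s = -1) :
    ∀ (n : ℕ) (U : Finset E), U.card = n → ∀ (I p : V → ℤ), (∀ v, |I v| ≤ p v) → (∀ v, 2 ∣ p v - I v) →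
      (∀ v, p v + ∑ e ∈ U, one (t e) v = ∑ e ∈ U, one (h e) v + if v = r then 0 else M) →
      ∃ c : E → ℤ, (∀ e, c e = 1 ∨ c e = -1) ∧
        (∀ v, v ≠ r → |I v + ∑ e ∈ U, c e * (one (t e) v + one (h e) v)| ≤ M) ∧
        (I r + ∑ e ∈ U, c e * (one (t e) r + one (h e) r) = 0 ∨
         I r + ∑ e ∈ U, c e * (one (t e) r + one (h e) r) = 2 * s) := by
  intro n
  induction n with
  | zero =>
    intro U hU I p hI hpar hbal
    rw [Finset.card_eq_zero] at hU
    subst hU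
    refine ⟨fun _ => 1, fun _ => Or.inl rfl, ?_, ?_⟩
    · intro v hv
      have h1 := hbal v
      have h2 := hI v
      simp [hv] at h1 ⊢
      omega
    · have h1 := hbal r
      have h2 := hI r
      simp at h1 ⊢
      left
      rw [h1] at h2
      exact abs_nonpos_iff.1 h2
  | succ n ih =>
    intro U hU I p hI hpar hbal
    have hp0 : ∀ v, 0 ≤ p v := fun v => (abs_nonneg _).trans (hI v)
    by_cases hex : ∃ e ∈ U, 0 < p (h e)
    · obtain ⟨e, he, hpe⟩ := hex
      obtain ⟨U', hU', rfl⟩ : ∃ U', e ∉ U' ∧ U = insert e U' :=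
        ⟨U.erase e, by simp, (Finset.insert_erase he).symm⟩
      rw [Finset.card_insert_of_notMem hU'] at hU
      obtain ⟨d, hd, hd1⟩ : ∃ d : ℤ, (d = 1 ∨ d = -1) ∧ |I (h e) + d| ≤ p (h e) - 1 := by
        have h1 := hI (h e)
        have h2 := hpar (h e)
        by_cases h3 : 0 < I (h e)
        · refine ⟨-1, Or.inr rfl, ?_⟩
          rw [abs_le] at h1 ⊢; omega
        · refine ⟨1, Or.inl rfl, ?_⟩
          rw [abs_le] at h1 ⊢; omega
      have hih := ih U' (by omega)
        (fun v => I v + d * (one (t e) v + one (h e) v)) (fun v => p v - one (h e) v + one (t e) v) ?_ ?_ ?_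
      · obtain ⟨c, hc, hc1, hc2⟩ := hih
        have aux : ∀ v, ∑ e' ∈ insert e U', Function.update c e d e' * (one (t e') v + one (h e') v)
          = d * (one (t e) v + one (h e) v) + ∑ e' ∈ U', c e' * (one (t e') v + one (h e') v) := by
          intro v
          rw [Finset.sum_insert hU', Function.update_self]
          congr 1
          apply Finset.sum_congr rfl
          intro e' he'
          rw [Function.update_of_ne]; rintro rfl; exact hU' he'
        refine ⟨Function.update c e d, ?_, ?_, ?_⟩
        · intro e'
          by_cases h : e' = e
          · subst h; simpa using hd
          · rw [Function.update_of_ne h]; exact hc e'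
        · intro v hv
          rw [aux, ← add_assoc]; exact hc1 v hv
        · rw [aux, ← add_assoc]; exact hc2
      · intro v
        have h0 := hI v
        by_cases h1 : h e = v
        · rw [h1] at hd1
          rw [h1, one_self]
          by_cases h2 : t e = v
          · rw [h2, one_self]
            rw [abs_le] at h0 hd1 ⊢; rcases hd with rfl | rfl <;> omega
          · rw [one_ne h2]
            rw [abs_le] at h0 hd1 ⊢; rcases hd with rfl | rfl <;> omega
        · rw [one_ne h1]
          have h3 := one_nonneg (t e) v
          rw [abs_le] at h0 ⊢; rcases hd with rfl | rfl <;> omega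
      · intro v
        have h0 := hpar v
        rcases hd with rfl | rfl <;> omega
      · intro v
        have h0 := hbal v
        rw [Finset.sum_insert hU', Finset.sum_insert hU'] at h0
        linear_combination h0
    · push Not at hex
      have hz : ∀ e ∈ U, p (h e) = 0 := fun e he => le_antisymm (hex e he) (hp0 _)
      have hhr : ∀ e ∈ U, h e = r := by
        by_contra hcon
        push Not at hcon
        obtain ⟨e0, he0, hne⟩ := hcon
        have h1 : ∑ v ∈ U.image h, ∑ e ∈ U, one (t e) v = ∑ v ∈ U.image h, ∑ e ∈ U, one (h e) v +
            ∑ v ∈ U.image h, (if v = r then 0 else M) := by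
          rw [← Finset.sum_add_distrib]
          apply Finset.sum_congr rfl
          intro v hv
          obtain ⟨e, he, rfl⟩ := Finset.mem_image.1 hv
          rw [← hbal, hz e he, zero_add]
        have h2 : ∑ v ∈ U.image h, ∑ e ∈ U, one (h e) v = U.card := by
          rw [Finset.sum_comm]
          have : ∀ e ∈ U, ∑ v ∈ U.image h, one (h e) v = 1 := by
            intro e he
            unfold one
            rw [Finset.sum_ite_eq, if_pos (Finset.mem_image_of_mem h he)]
          rw [Finset.sum_congr rfl this]; simp
        have h3 : ∑ v ∈ U.image h, ∑ e ∈ U, one (t e) v ≤ U.card := by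
          rw [Finset.sum_comm]
          have : ∀ e ∈ U, ∑ v ∈ U.image h, one (t e) v ≤ 1 := by
            intro e he
            unfold one
            rw [Finset.sum_ite_eq]; split_ifs <;> simp
          calc _ ≤ ∑ e ∈ U, (1 : ℤ) := Finset.sum_le_sum this
            _ = _ := by simp
        have h4 : M ≤ ∑ v ∈ U.image h, (if v = r then 0 else M) := by
          have := Finset.single_le_sum (f := fun v => if v = r then 0 else M) (s := U.image h)
            (fun v _ => by split_ifs <;> omega) (Finset.mem_image_of_mem h he0)
          simpa [hne] using this
        omega
      have hUne : U.Nonempty := by rw [← Finset.card_pos]; omega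
      have hpr : p r = 0 := by
        obtain ⟨e, he⟩ := hUne
        rw [← hhr e he]; exact hz e he
      have htr : ∀ e ∈ U, t e = r := by
        have h1 := hbal r
        rw [hpr, if_pos rfl, add_zero, zero_add] at h1
        have h2 : ∑ e ∈ U, one (t e) r = ∑ e ∈ U, (1 : ℤ) := by
          rw [h1]
          apply Finset.sum_congr rfl
          intro e he; rw [hhr e he, one_self]
        have h3 := (Finset.sum_eq_sum_iff_of_le (fun e _ => one_le (t e) r)).1 h2
        intro e he
        have := h3 e he
        by_contra hne
        rw [one_ne hne] at this
        omega
      obtain ⟨c, hc, hsum⟩ := alt_signs U s hs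
      refine ⟨c, hc, ?_, ?_⟩
      · intro v hv
        have h1 : ∑ e ∈ U, c e * (one (t e) v + one (h e) v) = 0 := by
          apply Finset.sum_eq_zero
          intro e he
          rw [htr e he, hhr e he, one_ne hv.symm]; ring
        have h2 := hbal v
        have h3 : ∀ (g : E → V), (∀ e ∈ U, g e = r) → ∑ e ∈ U, one (g e) v = 0 := by
          intro g hg
          apply Finset.sum_eq_zero
          intro e he
          rw [hg e he, one_ne hv.symm]
        rw [h3 t htr, h3 h hhr, if_neg hv] at h2
        rw [h1, add_zero]
        have := hI v
        omega
      · have h0 : I r = 0 := by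
          have := hI r
          rw [hpr] at this
          exact abs_nonpos_iff.1 this
        have h1 : ∑ e ∈ U, c e * (one (t e) r + one (h e) r) = 2 * ∑ e ∈ U, c e := by
          rw [Finset.mul_sum]
          apply Finset.sum_congr rfl
          intro e he
          rw [htr e he, hhr e he, one_self]; ring
        rw [h0, h1]
        rcases hsum with h | h <;> rw [h] <;> simp

theorem colour_Q (t h : E → V) (r : V) (Q : Finset E) (m m₀ : ℕ) (hM : 0 < m + m₀)
    (hb : ∀ v, ∑ e ∈ Q, one (t e) v = ∑ e ∈ Q, one (h e) v)
    (F : Fin (m + m₀) → Finset E) (hF : ∀ i, F i ⊆ Q ∧ Arb t h r (F i))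
    (hd : ∀ i j, i ≠ j → Disjoint (F i) (F j)) :
    ∃ c : E → ℤ, (∀ e, c e = 1 ∨ c e = -1) ∧ (∀ i : Fin m, ∀ e ∈ F (Fin.castAdd m₀ i), c e = 1) ∧
      (∀ i : Fin m₀, ∀ e ∈ F (Fin.natAdd m i), c e = -1) ∧
      ∀ v, -2 * (m₀ : ℤ) ≤ ∑ e ∈ Q, c e * (one (t e) v + one (h e) v) ∧
        ∑ e ∈ Q, c e * (one (t e) v + one (h e) v) ≤ 2 * (m : ℤ) := by
  classical
  set T := (univ : Finset (Fin (m + m₀))).biUnion F with hT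
  have hTQ : T ⊆ Q := by
    intro e he
    obtain ⟨i, -, he⟩ := Finset.mem_biUnion.1 he
    exact (hF i).1 he
  obtain ⟨c0, hc0, hc0r, hc0b⟩ : ∃ c0 : E → ℤ, (∀ e, c0 e = 1 ∨ c0 e = -1) ∧
      (∀ i : Fin m, ∀ e ∈ F (Fin.castAdd m₀ i), c0 e = 1) ∧
      (∀ i : Fin m₀, ∀ e ∈ F (Fin.natAdd m i), c0 e = -1) := by
    refine ⟨fun e => if ∃ i : Fin m, e ∈ F (Fin.castAdd m₀ i) then 1 else -1, ?_, ?_, ?_⟩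
    · intro e; dsimp only; split_ifs <;> simp
    · intro i e he; dsimp only; rw [if_pos ⟨i, he⟩]
    · intro i e he
      dsimp only
      rw [if_neg]
      rintro ⟨j, hj⟩
      have hij : (Fin.castAdd m₀ j) ≠ Fin.natAdd m i := by
        intro hh
        have := congrArg Fin.val hh
        simp at this
        omega
      exact Finset.disjoint_left.1 (hd _ _ hij) hj he
  have sumT : ∀ g : E → ℤ, ∑ e ∈ T, g e = ∑ i, ∑ e ∈ F i, g e := by
    intro g
    rw [hT, Finset.sum_biUnion]
    intro i _ j _ hij
    exact hd i j hij
  have hone : ∀ i v, ∑ e ∈ F i, one (h e) v = if v = r then 0 else 1 := by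
    intro i v
    have h1 : ∑ e ∈ F i, one (h e) v = ((F i).filter fun e => h e = v).card := by
      unfold one; rw [Finset.card_filter]; push_cast; rfl
    rw [h1]
    split_ifs with hv
    · rw [hv, (hF i).2.root]; rfl
    · rw [(hF i).2.one v hv]; rfl
  have hTh : ∀ v, ∑ e ∈ T, one (h e) v = if v = r then 0 else ((m + m₀ : ℕ) : ℤ) := by
    intro v
    rw [sumT, Finset.sum_congr rfl (fun i _ => hone i v)]
    split_ifs <;> simp
  have hTc : ∀ v, ∑ e ∈ T, c0 e * one (h e) v = if v = r then 0 else ((m : ℤ) - m₀) := by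
    intro v
    rw [sumT, Fin.sum_univ_add]
    have h1 : ∀ i : Fin m, ∑ e ∈ F (Fin.castAdd m₀ i), c0 e * one (h e) v = if v = r then 0 else 1 := by
      intro i
      rw [← hone (Fin.castAdd m₀ i)]
      apply Finset.sum_congr rfl
      intro e he; rw [hc0r i e he, one_mul]
    have h2 : ∀ i : Fin m₀, ∑ e ∈ F (Fin.natAdd m i), c0 e * one (h e) v = - if v = r then 0 else 1 := by
      intro i
      rw [← hone (Fin.natAdd m i), ← Finset.sum_neg_distrib]
      apply Finset.sum_congr rfl
      intro e he; rw [hc0b i e he]; ring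
    rw [Finset.sum_congr rfl (fun i _ => h1 i), Finset.sum_congr rfl (fun i _ => h2 i)]
    split_ifs <;> simp; ring
  obtain ⟨s, hs, hs1⟩ : ∃ s : ℤ, (s = 1 ∨ s = -1) ∧ -2 * (m₀ : ℤ) ≤ 2 * s ∧ 2 * s ≤ 2 * (m : ℤ) := by
    rcases Nat.eq_zero_or_pos m with h0 | h0
    · exact ⟨-1, Or.inr rfl, by omega, by omega⟩
    · exact ⟨1, Or.inl rfl, by omega, by omega⟩
  have hcol := colour t h r ((m + m₀ : ℕ) : ℤ) s (by exact_mod_cast hM) hs _ (Q \ T) rfl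
    (fun v => ∑ e ∈ T, c0 e * one (t e) v) (fun v => ∑ e ∈ T, one (t e) v) ?_ ?_ ?_
  · obtain ⟨c, hc, hc1, hc2⟩ := hcol
    have hsum : ∀ v, ∑ e ∈ Q, (if e ∈ T then c0 e else c e) * (one (t e) v + one (h e) v) =
        (∑ e ∈ T, c0 e * one (t e) v + ∑ e ∈ Q \ T, c e * (one (t e) v + one (h e) v)) +
          ∑ e ∈ T, c0 e * one (h e) v := by
      intro v
      rw [← Finset.sum_sdiff hTQ]
      have h1 : ∑ e ∈ Q \ T, (if e ∈ T then c0 e else c e) * (one (t e) v + one (h e) v)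
        = ∑ e ∈ Q \ T, c e * (one (t e) v + one (h e) v) := by
        apply Finset.sum_congr rfl
        intro e he; rw [if_neg (Finset.mem_sdiff.1 he).2]
      have h2 : ∑ e ∈ T, (if e ∈ T then c0 e else c e) * (one (t e) v + one (h e) v)
        = ∑ e ∈ T, c0 e * one (t e) v + ∑ e ∈ T, c0 e * one (h e) v := by
        rw [← Finset.sum_add_distrib]
        apply Finset.sum_congr rfl
        intro e he; rw [if_pos he]; ring
      rw [h1, h2]; ring
    refine ⟨fun e => if e ∈ T then c0 e else c e, ?_, ?_, ?_, ?_⟩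
    · intro e; dsimp only; split_ifs
      · exact hc0 e
      · exact hc e
    · intro i e he
      dsimp only
      rw [if_pos (Finset.mem_biUnion.2 ⟨_, by simp, he⟩)]; exact hc0r i e he
    · intro i e he
      dsimp only
      rw [if_pos (Finset.mem_biUnion.2 ⟨_, by simp, he⟩)]; exact hc0b i e he
    · intro v
      rw [hsum, hTc]
      by_cases hv : v = r
      · subst hv
        rw [if_pos rfl]
        rcases hc2 with h | h <;> rw [h] <;> constructor <;> omega
      · rw [if_neg hv]
        have := hc1 v hv
        rw [abs_le] at this
        push_cast at this
        constructor <;> linarith [this.1, this.2]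
  · intro v
    refine (Finset.abs_sum_le_sum_abs _ _).trans (Finset.sum_le_sum ?_)
    intro e _
    rw [abs_mul, abs_of_nonneg (one_nonneg (t e) v)]
    rcases hc0 e with h | h <;> rw [h] <;> simp
  · intro v
    rw [← Finset.sum_sub_distrib]
    apply Finset.dvd_sum
    intro e _
    rcases hc0 e with h | h <;> rw [h]
    · simp
    · exact ⟨one (t e) v, by ring⟩
  · intro v
    have h1 := hb v
    rw [← Finset.sum_sdiff hTQ, ← Finset.sum_sdiff hTQ, hTh] at h1
    linarith

lemma mdeg_cast (ends : E → V × V) (S : Finset E) (v : V) :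
    (mdeg ends S v : ℤ) = ∑ e ∈ S, (one (ends e).1 v + one (ends e).2 v) := by
  unfold mdeg one; push_cast; rfl

lemma mdeg_union (ends : E → V × V) {S S' : Finset E} (h : Disjoint S S') (v : V) :
    mdeg ends (S ∪ S') v = mdeg ends S v + mdeg ends S' v := by
  unfold mdeg; rw [Finset.sum_union h]

lemma sum_mdeg (ends : E → V × V) (S : Finset E) : ∑ v, mdeg ends S v = 2 * S.card := by
  unfold mdeg
  rw [Finset.sum_comm]
  have : ∀ e ∈ S, ∑ v, ((if (ends e).1 = v then 1 else 0) + (if (ends e).2 = v then 1 else 0)) = 2 := by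
    intro e _
    rw [Finset.sum_add_distrib]; simp
  rw [Finset.sum_congr rfl this]; simp; ring

lemma Ori.sum {ends : E → V × V} {t h : E → V} (ho : Ori ends t h) (e : E) (v : V) :
    one (t e) v + one (h e) v = one (ends e).1 v + one (ends e).2 v := by
  rcases ho e with hh | hh <;> rw [hh]
  ring

lemma bal_din {ends : E → V × V} {t h : E → V} (ho : Ori ends t h) {Q : Finset E}
    (hb : ∀ v, ∑ e ∈ Q, one (t e) v = ∑ e ∈ Q, one (h e) v) (A : Finset V) :
    (cutEdges ends Q A).card = 2 * din t h Q A := by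
  have h1 : ∑ v ∈ A, ∑ e ∈ Q, one (t e) v = ∑ v ∈ A, ∑ e ∈ Q, one (h e) v :=
    Finset.sum_congr rfl fun v _ => hb v
  rw [Finset.sum_comm, Finset.sum_comm (s := A)] at h1
  have h2 : ∀ x : V, ∑ v ∈ A, one x v = if x ∈ A then 1 else 0 := by
    intro x; unfold one; rw [Finset.sum_ite_eq]
  simp only [h2] at h1
  have h3 : ((cutEdges ends Q A).card : ℤ) = 2 * (din t h Q A : ℤ) := by
    unfold cutEdges din
    rw [Finset.card_filter, Finset.card_filter]
    push_cast
    rw [Finset.mul_sum]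
    have h4 : ∑ e ∈ Q, (if ¬((ends e).1 ∈ A ↔ (ends e).2 ∈ A) then (1:ℤ) else 0) =
        ∑ e ∈ Q, 2 * (if h e ∈ A ∧ t e ∉ A then (1:ℤ) else 0) + ∑ e ∈ Q, (if t e ∈ A then (1:ℤ) else 0)
          - ∑ e ∈ Q, (if h e ∈ A then (1:ℤ) else 0) := by
      rw [← Finset.sum_add_distrib, ← Finset.sum_sub_distrib]
      apply Finset.sum_congr rfl
      intro e _
      rcases ho e with hh | hh <;> rw [hh] <;> by_cases p : t e ∈ A <;> by_cases q : h e ∈ A <;> simp [p, q]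
    rw [h4, h1]; ring
  exact_mod_cast h3

theorem setup [Fintype E] [Nonempty V] (ends : E → V × V) (k m m₀ : ℕ) (hk : 2 ≤ k) (hmm : 0 < m + m₀)
    (hG : TreeConnected ends (2 * m + 2 * m₀ + 6 * k - 5) (univ : Finset E)) :
    ∃ (X : Finset V) (J R Q : Finset E) (c : E → ℤ),
      (∀ e ∈ J, ((ends e).1 ∈ X ↔ (ends e).2 ∈ X)) ∧ J.card ≤ k - 1 ∧
      (J.card = k - 1 ∨ ∀ e, ((ends e).1 ∈ X ↔ (ends e).2 ∈ X) → e ∈ J) ∧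
      (∀ e ∈ R, ¬ ((ends e).1 ∈ X ↔ (ends e).2 ∈ X)) ∧
      (∀ A : Finset V, A.Nonempty → A ≠ univ → 3 * k - 3 ≤ (cutEdges ends R A).card) ∧
      Q = univ \ (J ∪ R) ∧ (∀ e, c e = 1 ∨ c e = -1) ∧
      TreeConnected ends m (Q.filter fun e => c e = 1) ∧
      TreeConnected ends m₀ (Q.filter fun e => c e = -1) ∧
      ∀ v, -2 * (m₀ : ℤ) ≤ ∑ e ∈ Q, c e * (one (ends e).1 v + one (ends e).2 v) ∧
        ∑ e ∈ Q, c e * (one (ends e).1 v + one (ends e).2 v) ≤ 2 * (m : ℤ) := by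
  have hN : 2 * m + 2 * m₀ + 6 * k - 5 = (2 * (m + m₀) - 1) + (6 * k - 4) := by omega
  rw [hN] at hG
  obtain ⟨X, J, Ts, R, hJ1, hJ2, hJ3, hTs, hR, hdis, hconn, hRc, hW⟩ := choice_sets ends k _ hk hG
  obtain ⟨Js, hJs, hev⟩ := tjoin hconn (fun v => mdeg ends (univ \ (J ∪ R ∪ Ts)) v)
    (by rw [sum_mdeg]; exact even_two_mul _)
  set Q := univ \ (J ∪ (R ∪ (Ts \ Js))) with hQ
  have hQ2 : Q = (univ \ (J ∪ R ∪ Ts)) ∪ Js := by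
    ext e
    have h1 : e ∈ Js → e ∈ Ts := fun h => hJs h
    have h2 : e ∈ Ts → e ∉ R := fun h h' => Finset.disjoint_left.1 hdis h h'
    have h3 : e ∈ Ts → e ∉ J := fun h h' => hTs e h (hJ1 e h')
    simp only [hQ, Finset.mem_sdiff, Finset.mem_univ, true_and, Finset.mem_union]
    tauto
  have hdis2 : Disjoint (univ \ (J ∪ R ∪ Ts)) Js := by
    rw [Finset.disjoint_left]
    intro e he hh
    rw [Finset.mem_sdiff] at he
    exact he.2 (Finset.mem_union_right _ (hJs hh))
  obtain ⟨t, h, ho, hb⟩ := euler _ ends Q rfl (by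
    intro v
    rw [hQ2, mdeg_union _ hdis2]; exact hev v)
  have hb' : ∀ v, ∑ e ∈ Q, one (t e) v = ∑ e ∈ Q, one (h e) v := by
    intro v
    have := hb v
    rw [Finset.sum_sub_distrib] at this
    unfold one; linarith
  obtain ⟨r⟩ : Nonempty V := inferInstance
  obtain ⟨F, hF, hd⟩ := edmonds t h r (m + m₀) Q (by
    intro A hA hrA
    have h1 := bal_din ho hb' A
    have hA' : A ≠ univ := by rintro rfl; simp at hrA
    have h2 := hW A hA hA'
    have h3 := cut_mono ends (S := univ \ (J ∪ R ∪ Ts)) (S' := Q) (by rw [hQ2]; exact Finset.subset_union_left) A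
    omega)
  obtain ⟨c, hc, hcr, hcb, hcd⟩ := colour_Q t h r Q m m₀ hmm hb' F hF hd
  refine ⟨X, J, R ∪ (Ts \ Js), Q, c, hJ1, hJ2, hJ3, ?_, ?_, hQ, hc, ?_, ?_, ?_⟩
  · intro e he
    rw [Finset.mem_union, Finset.mem_sdiff] at he
    rcases he with he | he
    · exact hR e he
    · exact hTs e he.1
  · intro A hA hA'
    exact (hRc A hA hA').trans (cut_mono ends Finset.subset_union_left A)
  · refine ⟨fun i => F (Fin.castAdd m₀ i), fun i => ⟨?_, (hF _).2.tree ho⟩, fun i j hij => hd _ _ ?_⟩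
    · intro e he
      rw [Finset.mem_filter]
      exact ⟨(hF _).1 he, hcr i e he⟩
    · intro hh; exact hij (Fin.castAdd_injective m m₀ hh)
  · refine ⟨fun i => F (Fin.natAdd m i), fun i => ⟨?_, (hF _).2.tree ho⟩, fun i j hij => hd _ _ ?_⟩
    · intro e he
      rw [Finset.mem_filter]
      exact ⟨(hF _).1 he, hcb i e he⟩
    · intro hh; exact hij (Fin.natAdd_injective m₀ m hh)
  · intro v
    have := hcd v
    simpa only [ho.sum] using this

def wt (ends : E → V × V) (R : Finset E) (u v : V) : ℤ :=
  ∑ e ∈ R, (one (ends e).1 u * one (ends e).2 v + one (ends e).2 u * one (ends e).1 v)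

lemma sum_one (x : V) : ∑ u, one x u = 1 := by
  unfold one; rw [Finset.sum_ite_eq]; simp

lemma sum_one_mem (x : V) (A : Finset V) : ∑ v ∈ A, one x v = if x ∈ A then 1 else 0 := by
  unfold one; rw [Finset.sum_ite_eq]

lemma wt_sym (ends : E → V × V) (R : Finset E) (u v : V) : wt ends R u v = wt ends R v u := by
  unfold wt; apply Finset.sum_congr rfl; intro e _; ring

lemma wt_nonneg (ends : E → V × V) (R : Finset E) (u v : V) : 0 ≤ wt ends R u v := by
  unfold wt; apply Finset.sum_nonneg; intro e _
  have := one_nonneg (ends e).1 u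
  have := one_nonneg (ends e).2 v
  have := one_nonneg (ends e).2 u
  have := one_nonneg (ends e).1 v
  positivity

lemma term_same {X : Finset V} {x y u v : V} (hxy : ¬ (x ∈ X ↔ y ∈ X)) (huv : u ∈ X ↔ v ∈ X) :
    one x u * one y v + one y u * one x v = 0 := by
  have h1 : one x u * one y v = 0 := by
    by_cases h1 : x = u
    · by_cases h2 : y = v
      · subst h1; subst h2; exact absurd huv hxy
      · rw [one_ne h2, mul_zero]
    · rw [one_ne h1, zero_mul]
  have h2 : one y u * one x v = 0 := by
    by_cases h1 : y = u
    · by_cases h2 : x = v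
      · subst h1; subst h2; exact absurd huv.symm hxy
      · rw [one_ne h2, mul_zero]
    · rw [one_ne h1, zero_mul]
  rw [h1, h2, add_zero]

lemma wt_same {ends : E → V × V} {R : Finset E} {X : Finset V}
    (hR : ∀ e ∈ R, ¬ ((ends e).1 ∈ X ↔ (ends e).2 ∈ X)) {u v : V} (h : u ∈ X ↔ v ∈ X) :
    wt ends R u v = 0 := by
  unfold wt
  apply Finset.sum_eq_zero
  intro e he
  exact term_same (hR e he) h

lemma wt_sum (ends : E → V × V) (R : Finset E) (v : V) :
    ∑ u, wt ends R v u = ∑ e ∈ R, (one (ends e).1 v + one (ends e).2 v) := by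
  unfold wt
  rw [Finset.sum_comm]
  apply Finset.sum_congr rfl
  intro e _
  rw [Finset.sum_add_distrib, ← Finset.mul_sum, ← Finset.mul_sum, sum_one, sum_one]; ring

lemma wt_cut (ends : E → V × V) (R : Finset E) (A : Finset V) :
    LT.cut (wt ends R) univ A = (cutEdges ends R A).card := by
  unfold LT.cut wt cutEdges
  rw [Finset.card_filter]
  push_cast
  have h1 : ∀ u ∈ A, ∑ v ∈ univ \ A, ∑ e ∈ R, (one (ends e).1 u * one (ends e).2 v + one (ends e).2 u * one (ends e).1 v)
      = ∑ e ∈ R, (one (ends e).1 u * (if (ends e).2 ∈ univ \ A then 1 else 0) + one (ends e).2 u * (if (ends e).1 ∈ univ \ A then 1 else 0)) := by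
    intro u _
    rw [Finset.sum_comm]
    apply Finset.sum_congr rfl
    intro e _
    rw [Finset.sum_add_distrib, ← Finset.mul_sum, ← Finset.mul_sum, sum_one_mem, sum_one_mem]
  rw [Finset.sum_congr rfl h1, Finset.sum_comm]
  apply Finset.sum_congr rfl
  intro e _
  rw [Finset.sum_add_distrib, ← Finset.sum_mul, ← Finset.sum_mul, sum_one_mem, sum_one_mem]
  by_cases p : (ends e).1 ∈ A <;> by_cases q : (ends e).2 ∈ A <;> simp [p, q]

def eps (X : Finset V) (v : V) : ℤ := if v ∈ X then 1 else -1

lemma eps_sq (X : Finset V) (v : V) : eps X v * eps X v = 1 := by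
  unfold eps; split_ifs <;> simp

lemma realise {ends : E → V × V} {R : Finset E} {X : Finset V}
    (hR : ∀ e ∈ R, ¬ ((ends e).1 ∈ X ↔ (ends e).2 ∈ X)) (x : V → V → ℤ)
    (hx : ∀ u v, x u v = - x v u) (hxw : ∀ u v, |x u v| ≤ wt ends R u v ∧ (2:ℤ) ∣ x u v - wt ends R u v) :
    ∃ c : E → ℤ, (∀ e, c e = 1 ∨ c e = -1) ∧
      ∀ v, eps X v * ∑ e ∈ R, c e * (one (ends e).1 v + one (ends e).2 v) = ∑ u, x v u := by
  classical
  let C : V → V → Finset E := fun u v => R.filter fun e => ends e = (u, v) ∨ ends e = (v, u)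
  have hterm : ∀ u v, u ≠ v → ∀ e, one (ends e).1 u * one (ends e).2 v + one (ends e).2 u * one (ends e).1 v
      = if ends e = (u, v) ∨ ends e = (v, u) then 1 else 0 := by
    intro u v huv e
    obtain ⟨p, q, hpq⟩ : ∃ p q, ends e = (p, q) := ⟨_, _, rfl⟩
    rw [hpq]
    unfold one
    simp only [Prod.mk.injEq]
    by_cases h1 : p = u
    · have h4 : ¬ p = v := fun h => huv (h1.symm.trans h)
      by_cases h2 : q = v <;> simp [h1, h2, huv]
    · by_cases h3 : q = u
      · have h2 : ¬ q = v := fun h => huv (h3.symm.trans h)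
        by_cases h4 : p = v
        · simp [h3, h4, huv, huv.symm]
        · simp [h1, h4]
      · simp [h1, h3]
  have hC : ∀ u v, u ≠ v → wt ends R u v = (C u v).card := by
    intro u v huv
    unfold wt
    rw [Finset.sum_congr rfl (fun e _ => hterm u v huv e), Finset.card_filter]
    push_cast; rfl
  have hS : ∀ u v, ∃ S ⊆ C u v, u ≠ v → 2 * (S.card : ℤ) = wt ends R u v + x u v := by
    intro u v
    by_cases huv : u = v
    · exact ⟨∅, by simp, fun h => absurd huv h⟩
    · obtain ⟨h1, h2⟩ := hxw u v
      rw [abs_le] at h1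
      obtain ⟨S, hS, hc⟩ := Finset.exists_subset_card_eq (s := C u v) (n := ((wt ends R u v + x u v) / 2).toNat) (by
        have := hC u v huv
        omega)
      exact ⟨S, hS, fun _ => by rw [hc]; omega⟩
  choose S hSC hSc using hS
  let xe : E → V := fun e => if (ends e).1 ∈ X then (ends e).1 else (ends e).2
  let ye : E → V := fun e => if (ends e).1 ∈ X then (ends e).2 else (ends e).1
  let c : E → ℤ := fun e => if e ∈ S (xe e) (ye e) then 1 else -1
  have hc : ∀ e, c e = 1 ∨ c e = -1 := by
    intro e; simp only [c]; split_ifs <;> simp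
  let y : V → V → ℤ := fun u v => ∑ e ∈ R, c e * (one (ends e).1 u * one (ends e).2 v + one (ends e).2 u * one (ends e).1 v)
  have hysym : ∀ u v, y u v = y v u := by
    intro u v; apply Finset.sum_congr rfl; intro e _; ring
  have hy0 : ∀ u v, (u ∈ X ↔ v ∈ X) → y u v = 0 := by
    intro u v huv
    apply Finset.sum_eq_zero
    intro e he
    rw [term_same (hR e he) huv, mul_zero]
  have hx0 : ∀ u v, (u ∈ X ↔ v ∈ X) → x u v = 0 := by
    intro u v huv
    have := (hxw u v).1
    rw [wt_same hR huv] at this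
    exact abs_nonpos_iff.1 this
  have hy : ∀ u v, u ∈ X → v ∉ X → y u v = x u v := by
    intro u v hu hv
    have huv : u ≠ v := by rintro rfl; exact hv hu
    have h1 : y u v = ∑ e ∈ C u v, c e := by
      simp only [y, C]
      rw [Finset.sum_filter]
      apply Finset.sum_congr rfl
      intro e _
      rw [hterm u v huv e]; split_ifs <;> simp
    have h2 : ∀ e ∈ C u v, c e = 2 * (if e ∈ S u v then 1 else 0) - 1 := by
      intro e he
      have h3 := (Finset.mem_filter.1 he).2
      have h4 : xe e = u ∧ ye e = v := by
        rcases h3 with h3 | h3 <;> simp [xe, ye, h3, hu, hv]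
      simp only [c, h4.1, h4.2]
      split_ifs <;> simp
    rw [h1, Finset.sum_congr rfl h2, Finset.sum_sub_distrib, ← Finset.mul_sum, ← Finset.sum_filter]
    have h5 : (C u v).filter (fun e => e ∈ S u v) = S u v := by
      ext e; rw [Finset.mem_filter]; exact ⟨fun h => h.2, fun h => ⟨hSC u v h, h⟩⟩
    rw [h5]
    have h6 := hSc u v huv
    have h7 := hC u v huv
    simp only [Finset.sum_const, nsmul_eq_mul, mul_one]
    linarith
  refine ⟨c, hc, ?_⟩
  intro v
  have h1 : ∑ e ∈ R, c e * (one (ends e).1 v + one (ends e).2 v) = ∑ u, y v u := by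
    simp only [y]
    rw [Finset.sum_comm]
    apply Finset.sum_congr rfl
    intro e _
    rw [← Finset.mul_sum, Finset.sum_add_distrib, ← Finset.mul_sum, ← Finset.mul_sum, sum_one, sum_one]; ring
  rw [h1, Finset.mul_sum]
  apply Finset.sum_congr rfl
  intro u _
  unfold eps
  by_cases hv : v ∈ X <;> by_cases hu : u ∈ X
  · rw [hy0 v u (by simp [hu, hv]), hx0 v u (by simp [hu, hv]), mul_zero]
  · rw [if_pos hv, hy v u hv hu, one_mul]
  · rw [if_neg hv, hysym, hy u v hu hv, hx v u]; ring
  · rw [hy0 v u (by simp [hu, hv]), hx0 v u (by simp [hu, hv]), mul_zero]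

lemma eps_one (X : Finset V) (x v : V) : eps X v * (eps X x * one x v) = one x v := by
  by_cases h : x = v
  · subst h; rw [← mul_assoc, eps_sq, one_mul]
  · rw [one_ne h]; ring

lemma sum_eps (X : Finset V) (x : V) : ∑ v, eps X v * one x v = eps X x := by
  unfold one
  simp

lemma J_part {ends : E → V × V} {J Jp : Finset E} {X : Finset V}
    (hJ : ∀ e ∈ J, ((ends e).1 ∈ X ↔ (ends e).2 ∈ X)) (hJp : Jp ⊆ J) :
    ∃ c : E → ℤ, (∀ e, c e = 1 ∨ c e = -1) ∧
      ∀ v, eps X v * ∑ e ∈ J, c e * (one (ends e).1 v + one (ends e).2 v) =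
        (mdeg ends Jp v : ℤ) - mdeg ends (J \ Jp) v := by
  refine ⟨fun e => if e ∈ Jp then eps X (ends e).1 else - eps X (ends e).1, ?_, ?_⟩
  · intro e; unfold eps; dsimp only; split_ifs <;> simp
  · intro v
    rw [mdeg_cast, mdeg_cast, ← Finset.sum_sdiff hJp, mul_add, Finset.mul_sum, Finset.mul_sum]
    have heq : ∀ e ∈ J, eps X (ends e).1 = eps X (ends e).2 := by
      intro e he; unfold eps
      have := hJ e he
      by_cases h : (ends e).1 ∈ X
      · rw [if_pos h, if_pos (this.1 h)]
      · rw [if_neg h, if_neg (fun hh => h (this.2 hh))]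
    have h1 : ∀ e ∈ J, eps X v * (eps X (ends e).1 * (one (ends e).1 v + one (ends e).2 v)) =
        one (ends e).1 v + one (ends e).2 v := by
      intro e he
      have h2 := eps_one X (ends e).1 v
      have h3 := eps_one X (ends e).2 v
      rw [← heq e he] at h3
      linear_combination h2 + h3
    have h2 : ∑ e ∈ J \ Jp, eps X v * ((if e ∈ Jp then eps X (ends e).1 else - eps X (ends e).1) * (one (ends e).1 v + one (ends e).2 v))
        = - ∑ e ∈ J \ Jp, (one (ends e).1 v + one (ends e).2 v) := by
      rw [← Finset.sum_neg_distrib]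
      apply Finset.sum_congr rfl
      intro e he
      rw [if_neg (Finset.mem_sdiff.1 he).2]
      have h4 := h1 e (Finset.mem_sdiff.1 he).1
      linear_combination -h4
    have h3 : ∑ e ∈ Jp, eps X v * ((if e ∈ Jp then eps X (ends e).1 else - eps X (ends e).1) * (one (ends e).1 v + one (ends e).2 v))
        = ∑ e ∈ Jp, (one (ends e).1 v + one (ends e).2 v) := by
      apply Finset.sum_congr rfl
      intro e he
      rw [if_pos he]; exact h1 e (hJp he)
    rw [h2, h3]; ring

lemma sum_eps_deg (ends : E → V × V) (S : Finset E) (X : Finset V) (g : E → ℤ) :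
    ∑ v, eps X v * ∑ e ∈ S, g e * (one (ends e).1 v + one (ends e).2 v) =
      ∑ e ∈ S, g e * (eps X (ends e).1 + eps X (ends e).2) := by
  simp only [Finset.mul_sum]
  rw [Finset.sum_comm]
  apply Finset.sum_congr rfl
  intro e _
  rw [← sum_eps X (ends e).1, ← sum_eps X (ends e).2, ← Finset.sum_add_distrib, Finset.mul_sum]
  apply Finset.sum_congr rfl
  intro v _; ring

/-- choice of the number of positive inner edges -/
lemma choose_p [Fintype E] {ends : E → V × V} {k : ℕ} (hk : 2 ≤ k) {f : V → ZMod k} {X : Finset V}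
    (hf : CompatibleWrt ends (univ : Finset E) f X) {J : Finset E}
    (hJ : ∀ e ∈ J, ((ends e).1 ∈ X ↔ (ends e).2 ∈ X)) (κ : ℤ)
    (h3 : J.card = k - 1 ∨ ((∀ e, ((ends e).1 ∈ X ↔ (ends e).2 ∈ X) → e ∈ J) ∧ κ = 0)) :
    ∃ p : ℕ, p ≤ J.card ∧ (k : ℤ) ∣ (∑ v, eps X v * ((f v).val : ℤ)) -
      2 * (κ + p - ((J.filter fun e => (ends e).1 ∉ X).card : ℤ)) := by
  haveI : NeZero k := ⟨by omega⟩
  have hΔ : (((∑ v, eps X v * ((f v).val : ℤ)) : ℤ) : ZMod k) = ∑ v ∈ X, f v - ∑ v ∈ Xᶜ, f v := by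
    rw [← Finset.sum_add_sum_compl X, Int.cast_add, sub_eq_add_neg, ← Finset.sum_neg_distrib]
    push_cast
    congr 1
    · apply Finset.sum_congr rfl
      intro v hv
      simp [eps, hv]
    · apply Finset.sum_congr rfl
      intro v hv
      rw [Finset.mem_compl] at hv
      simp [eps, hv]
  set JY := (J.filter fun e => (ends e).1 ∉ X).card with hJY
  have hz : ∃ z : ℤ, (k : ℤ) ∣ (∑ v, eps X v * ((f v).val : ℤ)) - 2 * z ∧
      ((0 ≤ z ∧ z ≤ eIn ends univ X) ∨ (z ≤ 0 ∧ -z ≤ eIn ends univ Xᶜ)) := by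
    rcases hf with ⟨x, hx, hh⟩ | ⟨y, hy, hh⟩
    · refine ⟨x, ?_, Or.inl ⟨by omega, by exact_mod_cast hx⟩⟩
      rw [← ZMod.intCast_zmod_eq_zero_iff_dvd, Int.cast_sub, hΔ]
      push_cast
      linear_combination hh
    · refine ⟨-y, ?_, Or.inr ⟨by omega, by rw [neg_neg]; exact_mod_cast hy⟩⟩
      rw [← ZMod.intCast_zmod_eq_zero_iff_dvd, Int.cast_sub, hΔ]
      push_cast
      linear_combination hh
  obtain ⟨z, ⟨d, hd⟩, hzb⟩ := hz
  rcases h3 with h3 | ⟨hall, rfl⟩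
  · have h1 := Int.emod_nonneg (z + JY - κ) (show (k : ℤ) ≠ 0 by omega)
    have h2 := Int.emod_lt_of_pos (z + JY - κ) (show (0 : ℤ) < k by omega)
    have h4 := Int.emod_add_mul_ediv (z + JY - κ) k
    refine ⟨((z + JY - κ) % k).toNat, by omega, ?_⟩
    rw [Int.toNat_of_nonneg h1]
    refine ⟨d + 2 * ((z + JY - κ) / k), ?_⟩
    linear_combination hd - 2 * h4
  · have hX : eIn ends univ X = (J.filter fun e => (ends e).1 ∈ X).card := by
      unfold eIn; congr 1; ext e
      simp only [Finset.mem_filter, Finset.mem_univ, true_and]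
      constructor
      · rintro ⟨h1, h2⟩; exact ⟨hall e (by tauto), h1⟩
      · rintro ⟨h1, h2⟩; exact ⟨h2, (hJ e h1).1 h2⟩
    have hY : eIn ends univ Xᶜ = JY := by
      rw [hJY]
      unfold eIn; congr 1; ext e
      simp only [Finset.mem_filter, Finset.mem_univ, true_and, Finset.mem_compl]
      constructor
      · rintro ⟨h1, h2⟩; exact ⟨hall e (by tauto), h1⟩
      · rintro ⟨h1, h2⟩; exact ⟨h2, fun hh => h2 ((hJ e h1).2 hh)⟩
    have h5 := Finset.card_filter_add_card_filter_not (s := J) (fun e => (ends e).1 ∈ X)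
    rw [← hJY] at h5
    rw [hX, hY] at hzb
    refine ⟨(z + JY).toNat, by omega, d, ?_⟩
    rw [Int.toNat_of_nonneg (by omega)]
    linear_combination hd

lemma tree_mono {ends : E → V × V} {m : ℕ} {S S' : Finset E} (h : TreeConnected ends m S) (hs : S ⊆ S') :
    TreeConnected ends m S' := by
  obtain ⟨T, h1, h2⟩ := h
  exact ⟨T, fun i => ⟨(h1 i).1.trans hs, (h1 i).2⟩, h2⟩

lemma par_aux {S : Finset V} {w : V → V → ℤ} {a b β : V → ℤ}
    (hsym : ∀ u v, w u v = w v u) (hdiag : ∀ v, w v v = 0)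
    (hpar : ∀ v ∈ S, (2:ℤ) ∣ (∑ u ∈ S, w v u) + a v + b v - β v)
    {A : Finset V} (hA : A ⊆ S) :
    (2:ℤ) ∣ LT.Dg w a b S A - ∑ v ∈ A, β v := by
  have h1 : (2:ℤ) ∣ ∑ v ∈ A, ((∑ u ∈ S, w v u) + a v + b v - β v) :=
    Finset.dvd_sum (fun v hv => hpar v (hA hv))
  have h2 := LT.even_in A w hsym hdiag
  have h3 : ∑ v ∈ A, ∑ u ∈ S, w v u = LT.cut w S A + ∑ u ∈ A, ∑ v ∈ A, w u v := by
    unfold LT.cut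
    rw [← Finset.sum_add_distrib]
    exact Finset.sum_congr rfl (fun v _ => (Finset.sum_sdiff hA).symm)
  simp only [Finset.sum_add_distrib, Finset.sum_sub_distrib] at h1
  rw [h3] at h1
  unfold LT.Dg
  simp only [Finset.sum_add_distrib]
  omega

lemma near (k t : ℤ) (hk : 0 < k) : ∃ j : ℤ, -k ≤ t + 2 * k * j ∧ t + 2 * k * j ≤ k := by
  refine ⟨-((t + k) / (2 * k)), ?_⟩
  have h1 := Int.emod_nonneg (t + k) (show 2 * k ≠ 0 by omega)
  have h2 := Int.emod_lt_of_pos (t + k) (show 0 < 2 * k by omega)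
  have h3 := Int.emod_add_mul_ediv (t + k) (2 * k)
  constructor <;> nlinarith

lemma eps_or (X : Finset V) (v : V) : eps X v = 1 ∨ eps X v = -1 := by
  unfold eps; split_ifs <;> simp

lemma eps_inner {X : Finset V} {x y : V} (h : x ∈ X ↔ y ∈ X) : eps X x = eps X y := by
  unfold eps; simp [h]

lemma eps_cross {X : Finset V} {x y : V} (h : ¬ (x ∈ X ↔ y ∈ X)) : eps X x + eps X y = 0 := by
  unfold eps
  by_cases h1 : x ∈ X <;> by_cases h2 : y ∈ X <;> simp_all

lemma final [Fintype E]
    (ends : E → V × V) (k m m₀ : ℕ) (hk : 2 ≤ k) (hmm : 0 < m + m₀)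
    (f : V → ZMod k) (hf : Compatible ends (Finset.univ : Finset E) f)
    (hG : TreeConnected ends (2 * m + 2 * m₀ + 6 * k - 5) (Finset.univ : Finset E)) :
    ∃ H : Finset E, TreeConnected ends m H ∧
      TreeConnected ends m₀ ((Finset.univ : Finset E) \ H) ∧
      (∀ v, (mdeg ends H v : ZMod k) = f v) ∧
      ∀ v, ((mdeg ends (Finset.univ : Finset E) v / 2 : ℕ) : ℤ) - ((k : ℤ) - 1) - (m₀ : ℤ)
              ≤ (mdeg ends H v : ℤ) ∧
            (mdeg ends H v : ℤ) ≤ (((mdeg ends (Finset.univ : Finset E) v + 1) / 2 : ℕ) : ℤ)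
              + ((k : ℤ) - 1) + (m : ℤ) := by
  have : NeZero k := ⟨by omega⟩
  have hne : Nonempty V := by
    obtain ⟨T, h1, -⟩ := hG
    have h2 := (h1 ⟨0, by omega⟩).2.2
    exact Fintype.card_pos_iff.1 (by omega)
  obtain ⟨X, J, R, Q, cQ, hJ, hJc, hJm, hR, hRc, hQ, hcQ, hT1, hT2, hiQ⟩ := setup ends k m m₀ hk hmm hG
  have hJR : Disjoint J R := by
    rw [Finset.disjoint_left]; intro e h1 h2; exact hR e h2 (hJ e h1)
  have hsplit : ∀ g : E → ℤ, ∑ e, g e = ∑ e ∈ Q, g e + (∑ e ∈ J, g e + ∑ e ∈ R, g e) := by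
    intro g
    rw [hQ, ← Finset.sum_union hJR, Finset.sum_sdiff (Finset.subset_univ _)]
  have hQJ : ∀ e ∈ Q, e ∉ J ∧ e ∉ R := by
    intro e he; rw [hQ] at he; simpa using he
  -- the integer κ
  obtain ⟨κ, hκ⟩ : (4:ℤ) ∣ ∑ e ∈ Q, (1 + cQ e) * (eps X (ends e).1 + eps X (ends e).2) := by
    apply Finset.dvd_sum
    intro e _
    rcases hcQ e with h | h <;> rcases eps_or X (ends e).1 with h1 | h1 <;>
      rcases eps_or X (ends e).2 with h2 | h2 <;> rw [h, h1, h2] <;> norm_num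
  have hch : J.card = k - 1 ∨ ((∀ e, ((ends e).1 ∈ X ↔ (ends e).2 ∈ X) → e ∈ J) ∧ κ = 0) := by
    rcases hJm with h | h
    · exact Or.inl h
    · refine Or.inr ⟨h, ?_⟩
      have : ∑ e ∈ Q, (1 + cQ e) * (eps X (ends e).1 + eps X (ends e).2) = 0 := by
        apply Finset.sum_eq_zero
        intro e he
        rw [eps_cross (fun hh => (hQJ e he).1 (h e hh)), mul_zero]
      omega
  obtain ⟨p, hp, hpd⟩ := choose_p hk (hf X) hJ κ hch
  obtain ⟨Jp, hJp, hJpc⟩ := Finset.exists_subset_card_eq hp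
  set F : V → ℤ := fun v => ((f v).val : ℤ) with hF
  set iQ : V → ℤ := fun v => ∑ e ∈ Q, cQ e * (one (ends e).1 v + one (ends e).2 v) with hiQd
  set D : V → ℤ := fun v => ∑ e, (one (ends e).1 v + one (ends e).2 v) with hD
  set b : V → ℤ := fun v => (mdeg ends Jp v : ℤ) with hb
  set a : V → ℤ := fun v => (mdeg ends (J \ Jp) v : ℤ) with ha
  set β : V → ℤ := fun v => eps X v * (2 * F v - D v - iQ v) with hβ
  have hab : ∀ v, a v + b v = ∑ e ∈ J, (one (ends e).1 v + one (ends e).2 v) := by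
    intro v
    simp only [ha, hb]
    rw [mdeg_cast, mdeg_cast, Finset.sum_sdiff hJp]
  have hpar : ∀ v ∈ (univ : Finset V), (2:ℤ) ∣ (∑ u, wt ends R v u) + a v + b v - β v := by
    intro v _
    have h1 := hab v
    have h2 := wt_sum ends R v
    have h3 : D v = _ := hsplit (fun e => one (ends e).1 v + one (ends e).2 v)
    have h4 : (2:ℤ) ∣ ∑ e ∈ Q, (one (ends e).1 v + one (ends e).2 v) - iQ v := by
      simp only [hiQd]
      rw [← Finset.sum_sub_distrib]
      apply Finset.dvd_sum
      intro e _
      rcases hcQ e with h | h <;> rw [h]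
      · simp
      · exact ⟨one (ends e).1 v + one (ends e).2 v, by ring⟩
    have h5 : β v = eps X v * (2 * F v - D v - iQ v) := rfl
    rcases eps_or X v with h | h <;> rw [h] at h5 <;> omega
  have hsumb : ∑ v, b v = 2 * (p : ℤ) := by
    simp only [hb]; rw [← hJpc]; exact_mod_cast sum_mdeg ends Jp
  have hsuma : ∑ v, a v = 2 * ((J.card : ℤ) - p) := by
    simp only [ha]
    have h1 : ((J \ Jp).card : ℤ) = (J.card : ℤ) - p := by
      have := Finset.card_sdiff_add_card_eq_card hJp; omega
    rw [← h1]; exact_mod_cast sum_mdeg ends (J \ Jp)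
  have hsumβ : ∑ v, β v = 2 * (∑ v, eps X v * F v) - 4 * κ
      - 2 * ((J.card : ℤ) - 2 * ((J.filter fun e => (ends e).1 ∉ X).card : ℤ)) := by
    have h1 : ∑ v, eps X v * D v = ∑ e, (eps X (ends e).1 + eps X (ends e).2) := by
      have := sum_eps_deg ends univ X (fun _ => 1)
      simpa [hD] using this
    have h2 : ∑ v, eps X v * iQ v = ∑ e ∈ Q, cQ e * (eps X (ends e).1 + eps X (ends e).2) :=
      sum_eps_deg ends Q X cQ
    have h3 : ∑ e ∈ R, (eps X (ends e).1 + eps X (ends e).2) = 0 :=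
      Finset.sum_eq_zero fun e he => eps_cross (hR e he)
    have h4 : ∑ e ∈ J, (eps X (ends e).1 + eps X (ends e).2) =
        2 * ((J.card : ℤ) - 2 * ((J.filter fun e => (ends e).1 ∉ X).card : ℤ)) := by
      rw [Finset.card_filter, Finset.card_eq_sum_ones]
      push_cast
      rw [Finset.mul_sum, ← Finset.sum_sub_distrib, Finset.mul_sum]
      apply Finset.sum_congr rfl
      intro e he
      rw [← eps_inner (hJ e he)]
      unfold eps
      split_ifs <;> norm_num
    have h5 := hsplit (fun e => eps X (ends e).1 + eps X (ends e).2)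
    have h6 : ∑ e ∈ Q, (1 + cQ e) * (eps X (ends e).1 + eps X (ends e).2) =
        ∑ e ∈ Q, (eps X (ends e).1 + eps X (ends e).2) + ∑ e ∈ Q, cQ e * (eps X (ends e).1 + eps X (ends e).2) := by
      rw [← Finset.sum_add_distrib]; apply Finset.sum_congr rfl; intro e _; ring
    have h7 : ∑ v, β v = 2 * (∑ v, eps X v * F v) - ∑ v, eps X v * D v - ∑ v, eps X v * iQ v := by
      rw [Finset.mul_sum, ← Finset.sum_sub_distrib, ← Finset.sum_sub_distrib]
      apply Finset.sum_congr rfl; intro v _; simp only [hβ]; ring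
    rw [h7, h1, h2, h5, h3, h4]
    linarith
  have hwdiag : ∀ v, wt ends R v v = 0 := fun v => wt_same hR Iff.rfl
  have hLG : LT.LG (k : ℤ) (univ : Finset V) none (wt ends R) a b β := by
    refine ⟨wt_sym ends R, wt_nonneg ends R, hwdiag, fun v => Int.natCast_nonneg _,
      fun v => Int.natCast_nonneg _, hpar, ?_, ?_, ?_, ?_⟩
    · obtain ⟨d, hd⟩ := hpd
      refine ⟨d, ?_⟩
      rw [Finset.sum_sub_distrib, hsumb, hsuma, hsumβ]
      linear_combination 2 * hd
    · intro j
      rw [Finset.sum_add_distrib, hsumb, hsuma]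
      have := abs_nonneg (∑ v, β v + 2 * (k : ℤ) * j)
      omega
    · intro A hA hAne hAu _
      obtain ⟨j, h1, h2⟩ := near (k : ℤ) (∑ v ∈ A, β v) (by omega)
      refine ⟨j, ?_⟩
      have h3 := par_aux (wt_sym ends R) hwdiag hpar hA
      have h4 := hRc A hAne hAu
      have h5 := wt_cut ends R A
      have h6 : 0 ≤ ∑ v ∈ A, (a v + b v) :=
        Finset.sum_nonneg fun v _ => add_nonneg (Int.natCast_nonneg _) (Int.natCast_nonneg _)
      have h7 : LT.Dg (wt ends R) a b univ A = LT.cut (wt ends R) univ A + ∑ v ∈ A, (a v + b v) := rfl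
      have h8 : (3 * k - 3 : ℤ) ≤ LT.Dg (wt ends R) a b univ A := by
        rw [h7, h5]; omega
      have h9 : (2:ℤ) ∣ 2 * (k : ℤ) * j := ⟨k * j, by ring⟩
      generalize LT.Dg (wt ends R) a b univ A = dg at *
      generalize 2 * (k : ℤ) * j = kj at *
      generalize ∑ v ∈ A, β v = t at *
      rcases abs_cases (t + kj) with ⟨h, _⟩ | ⟨h, _⟩ <;> rw [h] <;> omega
    · intro v0 h; cases h
  obtain ⟨x, ⟨hx1, hx2⟩, hx3⟩ := LT.main (by exact_mod_cast hk) _ univ rfl Finset.univ_nonempty _ _ _ _ _ hLG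
  obtain ⟨cR, hcR, hcR2⟩ := realise hR x hx1 (fun u v => hx2 u (Finset.mem_univ _) v (Finset.mem_univ _))
  obtain ⟨cJ, hcJ, hcJ2⟩ := J_part hJ hJp
  set c : E → ℤ := fun e => if e ∈ J then cJ e else if e ∈ R then cR e else cQ e with hc
  have hcc : ∀ e, c e = 1 ∨ c e = -1 := by
    intro e; simp only [hc]; split_ifs
    · exact hcJ e
    · exact hcR e
    · exact hcQ e
  have hcQe : ∀ e ∈ Q, c e = cQ e := by
    intro e he; simp only [hc]; rw [if_neg (hQJ e he).1, if_neg (hQJ e he).2]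
  have key : ∀ v, 2 * (mdeg ends (univ.filter fun e => c e = 1) v : ℤ) - D v =
      iQ v + eps X v * LT.net univ x a b v := by
    intro v
    have h1 : 2 * (mdeg ends (univ.filter fun e => c e = 1) v : ℤ) - D v =
        ∑ e, c e * (one (ends e).1 v + one (ends e).2 v) := by
      rw [mdeg_cast, Finset.sum_filter, Finset.mul_sum]
      simp only [hD]
      rw [← Finset.sum_sub_distrib]
      apply Finset.sum_congr rfl
      intro e _
      rcases hcc e with h | h <;> rw [h]
      · rw [if_pos rfl]; ring
      · rw [if_neg (by norm_num)]; ring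
    have h2 : ∑ e ∈ Q, c e * (one (ends e).1 v + one (ends e).2 v) = iQ v :=
      Finset.sum_congr rfl fun e he => by rw [hcQe e he]
    have h3 : ∑ e ∈ J, c e * (one (ends e).1 v + one (ends e).2 v) =
        ∑ e ∈ J, cJ e * (one (ends e).1 v + one (ends e).2 v) :=
      Finset.sum_congr rfl fun e he => by simp only [hc]; rw [if_pos he]
    have h4 : ∑ e ∈ R, c e * (one (ends e).1 v + one (ends e).2 v) =
        ∑ e ∈ R, cR e * (one (ends e).1 v + one (ends e).2 v) :=
      Finset.sum_congr rfl fun e he => by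
        simp only [hc]; rw [if_neg (Finset.disjoint_right.1 hJR he), if_pos he]
    have h5 := hcR2 v
    have h6 : _ = b v - a v := hcJ2 v
    have h7 := eps_sq X v
    rw [h1, hsplit, h2, h3, h4]
    unfold LT.net
    generalize ∑ e ∈ J, cJ e * (one (ends e).1 v + one (ends e).2 v) = y at *
    generalize ∑ e ∈ R, cR e * (one (ends e).1 v + one (ends e).2 v) = z at *
    rw [← h5]
    linear_combination (-y - z) * h7 + eps X v * h6
  refine ⟨univ.filter fun e => c e = 1, ?_, ?_, ?_, ?_⟩
  · refine tree_mono hT1 ?_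
    intro e he
    rw [Finset.mem_filter] at he ⊢
    exact ⟨Finset.mem_univ _, by rw [hcQe e he.1]; exact he.2⟩
  · refine tree_mono hT2 ?_
    intro e he
    rw [Finset.mem_filter] at he
    rw [Finset.mem_sdiff, Finset.mem_filter]
    refine ⟨Finset.mem_univ _, fun h => ?_⟩
    have h1 := h.2
    rw [hcQe e he.1, he.2] at h1
    norm_num at h1
  · intro v
    have h1 := key v
    obtain ⟨⟨d, hd⟩, -⟩ := hx3 v (Finset.mem_univ _)
    have h2 : β v = eps X v * (2 * F v - D v - iQ v) := rfl
    have h3 := eps_sq X v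
    have h4 : (mdeg ends (univ.filter fun e => c e = 1) v : ℤ) = F v + k * (eps X v * d) := by
      have : 2 * (mdeg ends (univ.filter fun e => c e = 1) v : ℤ) = 2 * (F v + k * (eps X v * d)) := by
        linear_combination h1 + eps X v * hd + eps X v * h2 + (2 * F v - D v - iQ v) * h3
      linarith
    have h5 : ((mdeg ends (univ.filter fun e => c e = 1) v : ℤ) : ZMod k) = ((F v + k * (eps X v * d) : ℤ) : ZMod k) := by
      rw [h4]
    push_cast at h5
    rw [h5]
    simp [hF]
  · intro v
    have h1 := key v
    have h2 := (hx3 v (Finset.mem_univ _)).2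
    have h3 := hiQ v
    have h4 : D v = (mdeg ends univ v : ℤ) := (mdeg_cast ends univ v).symm
    have h5 : iQ v = ∑ e ∈ Q, cQ e * (one (ends e).1 v + one (ends e).2 v) := rfl
    rw [← h5] at h3
    rw [abs_lt] at h2
    rcases eps_or X v with h | h <;> rw [h] at h1 <;> omega

end GR

/-- General-graph version: if `f` is compatible with `G` and `G` is
`(2m+2m₀+6k-5)`-tree-connected with `m+m₀ > 0`, then `G` has an `m`-tree-connected
`f`-factor whose complement is `m₀`-tree-connected, with the stated degree bounds. -/
theorem statement_2 [Fintype V] [DecidableEq V] [Fintype E] [DecidableEq E]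
    (ends : E → V × V) (k m m₀ : ℕ) (hk : 2 ≤ k) (hmm : 0 < m + m₀)
    (f : V → ZMod k) (hf : Compatible ends (Finset.univ : Finset E) f)
    (hG : TreeConnected ends (2 * m + 2 * m₀ + 6 * k - 5) (Finset.univ : Finset E)) :
    ∃ H : Finset E, TreeConnected ends m H ∧
      TreeConnected ends m₀ ((Finset.univ : Finset E) \ H) ∧
      (∀ v, (mdeg ends H v : ZMod k) = f v) ∧
      ∀ v, ((mdeg ends (Finset.univ : Finset E) v / 2 : ℕ) : ℤ) - ((k : ℤ) - 1) - (m₀ : ℤ)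
              ≤ (mdeg ends H v : ℤ) ∧
            (mdeg ends H v : ℤ) ≤ (((mdeg ends (Finset.univ : Finset E) v + 1) / 2 : ℕ) : ℤ)
              + ((k : ℤ) - 1) + (m : ℤ) := by
  exact GR.final ends k m m₀ hk hmm f hf hG
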